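/- arXiv:1506.05223 — 3 statements merged into one kernel-verified Lean document; each statement's English description precedes it below -/
import Mathlib

section
/- In the group G = C₂⁴ ⊕ C₆ (with D(G) = 11 and exp(G) = 6), there exists a zero-sum sequence B over G whose set of factorization lengths is exactly {2, 8}. -/
/-- A sequence over `G₀` (a multiset with entries in `G₀`) with sum zero. -/
def IsZeroSumSeq {G : Type*} [AddCommGroup G] (G₀ : Set G) (S : Multiset G) : Prop :=
  (∀ g ∈ S, g ∈ G₀) ∧ S.sum = 0

/-- A minimal zero-sum sequence (atom) over `G₀`. -/
def IsAtomSeq {G : Type*} [AddCommGroup G] (G₀ : Set G) (A : Multiset G) : Prop :=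
  IsZeroSumSeq G₀ A ∧ A ≠ 0 ∧ ∀ B ≤ A, B ≠ 0 → B.sum = 0 → B = A

/-- The set of lengths of factorizations of `B` into atoms over `G₀`. -/
def LengthSet {G : Type*} [AddCommGroup G] (G₀ : Set G) (B : Multiset G) : Set ℕ :=
  {k | ∃ F : Multiset (Multiset G), F.card = k ∧ (∀ A ∈ F, IsAtomSeq G₀ A) ∧ F.sum = B}

/-- The set of successive distances of a set of naturals. -/
def DistSet (L : Set ℕ) : Set ℕ :=
  {d | ∃ a b, a ∈ L ∧ b ∈ L ∧ a < b ∧ b - a = d ∧ ∀ c ∈ L, ¬(a < c ∧ c < b)}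

/-- The set of distances `Δ(G₀)`. -/
def DeltaSet {G : Type*} [AddCommGroup G] (G₀ : Set G) : Set ℕ :=
  {d | ∃ B : Multiset G, IsZeroSumSeq G₀ B ∧ d ∈ DistSet (LengthSet G₀ B)}

/-- The cross number of a sequence. -/
noncomputable def crossNum {G : Type*} [AddCommGroup G] (S : Multiset G) : ℚ :=
  (S.map (fun g => (1 : ℚ) / addOrderOf g)).sum

/-- `G₀` is an LCN-set: every atom has cross number at least 1. -/
def IsLCNSet {G : Type*} [AddCommGroup G] (G₀ : Set G) : Prop :=
  ∀ A : Multiset G, IsAtomSeq G₀ A → 1 ≤ crossNum A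

/-- The set of minimal distances `Δ*(G)`. -/
def DeltaStar (G : Type*) [AddCommGroup G] : Set ℕ :=
  {d | ∃ G₀ : Set G, DeltaSet G₀ ≠ ∅ ∧ d = sInf (DeltaSet G₀)}

/-- `m(G)`: the maximum of `min Δ(G₀)` over non-half-factorial LCN-sets `G₀`. -/
noncomputable def mConst (G : Type*) [AddCommGroup G] : ℕ :=
  sSup {d | ∃ G₀ : Set G, IsLCNSet G₀ ∧ DeltaSet G₀ ≠ ∅ ∧ d = sInf (DeltaSet G₀)}

/-- The rank of a finite abelian group: the maximal `k` such that `(ZMod p)^k`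
embeds into `G` for some prime `p`. -/
noncomputable def grank (G : Type*) [AddCommGroup G] : ℕ :=
  sSup {k | ∃ p : ℕ, p.Prime ∧ ∃ f : (Fin k → ZMod p) →+ G, Function.Injective f}

/-- The system of sets of lengths `L(G)`. -/
def SystemSets (G : Type*) [AddCommGroup G] : Set (Set ℕ) :=
  {L | ∃ B : Multiset G, B.sum = 0 ∧ L = LengthSet Set.univ B}

/-- The Davenport constant: the maximal length of a minimal zero-sum sequence. -/
noncomputable def DavenportC (G : Type*) [AddCommGroup G] : ℕ :=
  sSup {k | ∃ A : Multiset G, IsAtomSeq (Set.univ : Set G) A ∧ A.card = k}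

lemma sum_card_fiber_le {ι W : Type*} [DecidableEq ι] [DecidableEq W]
    (P : Finset ι) (T : Finset W) (f : ι → W) :
    ∑ w ∈ T, (P.filter (fun p => f p = w)).card ≤ P.card := by
  classical
  rw [← Finset.card_biUnion]
  · apply Finset.card_le_card
    intro p hp
    simp only [Finset.mem_biUnion, Finset.mem_filter] at hp
    obtain ⟨_, _, h, _⟩ := hp
    exact h
  · intro x _ y _ hxy
    rw [Function.onFun, Finset.disjoint_left]
    intro p hp hq
    simp only [Finset.mem_filter] at hp hq
    exact hxy (hp.2.symm.trans hq.2)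

lemma two_le_card_fiber {ι W : Type*} [DecidableEq ι] [AddCommGroup W] [DecidableEq W]
    (htwo : ∀ w : W, w + w = 0) (u : ι → W) (S : Finset ι) {w : W} (hw : w ≠ 0)
    (h : ∃ p ∈ S, ∃ q ∈ S, u p + u q = w) :
    2 ≤ (S.offDiag.filter (fun p => u p.1 + u p.2 = w)).card := by
  obtain ⟨p, hp, q, hq, rfl⟩ := h
  have hpq : p ≠ q := by
    rintro rfl
    exact hw (htwo _)
  have hsub : ({(p, q), (q, p)} : Finset (ι × ι)) ⊆
      S.offDiag.filter (fun r => u r.1 + u r.2 = u p + u q) := by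
    intro r hr
    simp only [Finset.mem_insert, Finset.mem_singleton] at hr
    rcases hr with rfl | rfl <;> simp [hp, hq, hpq, hpq.symm, add_comm]
  have := Finset.card_le_card hsub
  rwa [Finset.card_pair (by simp [hpq])] at this

/-- The sums of pairs from at most 11 elements of an elementary 2-group of order 64 miss
some nonzero element. -/
lemma not_cover {W : Type*} [AddCommGroup W] [DecidableEq W] [Fintype W]
    (hW : Fintype.card W = 64) (htwo : ∀ w : W, w + w = 0)
    {ι : Type*} [DecidableEq ι] (u : ι → W) (S : Finset ι) (hS : S.card ≤ 11)
    (h : ∀ w ≠ 0, ∃ p ∈ S, ∃ q ∈ S, u p + u q = w) : False := by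
  have h1 := sum_card_fiber_le S.offDiag (Finset.univ.erase (0 : W)) (fun p => u p.1 + u p.2)
  have h2 : ∑ w ∈ Finset.univ.erase (0 : W), 2 ≤
      ∑ w ∈ Finset.univ.erase (0 : W),
        (S.offDiag.filter (fun p => u p.1 + u p.2 = w)).card :=
    Finset.sum_le_sum fun w hw =>
      two_le_card_fiber htwo u S (Finset.ne_of_mem_erase hw) (h w (Finset.ne_of_mem_erase hw))
  rw [Finset.sum_const, Finset.card_erase_of_mem (Finset.mem_univ _), Finset.card_univ, hW] at h2
  rw [Finset.offDiag_card] at h1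
  simp only [smul_eq_mul] at h2
  have : S.card * S.card - S.card ≤ 110 := by
    generalize S.card = n at *
    interval_cases n <;> simp
  omega

/-- A form `∑ b i * χ (u i)` with 12 terms over `ZMod 3` cannot have a square that vanishes
exactly at the origin of an elementary 2-group of rank 6, compared coefficient by coefficient. -/
lemma pair_coefficients_contra {W : Type*} [AddCommGroup W] [DecidableEq W] [Fintype W]
    (hW : Fintype.card W = 64) (htwo : ∀ w : W, w + w = 0)
    (u : Fin 12 → W) (b : Fin 12 → ZMod 3)
    (h : ∀ w ≠ 0, ∑ p : Fin 12 × Fin 12,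
      (if u p.1 + u p.2 = w then b p.1 * b p.2 else 0) = -1) : False := by
  have hcov : ∀ w ≠ 0, ∃ p q, u p + u q = w ∧ b p ≠ 0 ∧ b q ≠ 0 := by
    intro w hw
    by_contra! hc
    have : ∑ p : Fin 12 × Fin 12, (if u p.1 + u p.2 = w then b p.1 * b p.2 else 0) = 0 := by
      apply Finset.sum_eq_zero
      rintro ⟨p, q⟩ -
      split_ifs with hpq
      · by_cases hp : b p = 0
        · simp [hp]
        · simp [hc p q hpq hp]
      · rfl
    rw [h w hw] at this
    exact absurd this (by decide)
  have hcard : ∀ i : Fin 12, (Finset.univ.erase i).card ≤ 11 := by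
    intro i; simp
  have hb : ∀ i, b i ≠ 0 := by
    intro i hi
    refine not_cover hW htwo u (Finset.univ.erase i) (hcard i) ?_
    intro w hw
    obtain ⟨p, q, hpq, hp, hq⟩ := hcov w hw
    refine ⟨p, ?_, q, ?_, hpq⟩ <;> simp <;> rintro rfl <;> contradiction
  have hinj : Function.Injective u := by
    intro i j hij
    by_contra hne
    refine not_cover hW htwo u (Finset.univ.erase j) (hcard j) ?_
    intro w hw
    obtain ⟨p, q, hpq, -, -⟩ := hcov w hw
    refine ⟨if p = j then i else p, ?_, if q = j then i else q, ?_, ?_⟩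
    · split_ifs <;> simp_all
    · split_ifs <;> simp_all
    · rw [← hpq]
      congr 1 <;> split_ifs <;> simp_all
  set N : W → Finset (Fin 12 × Fin 12) :=
    fun w => (Finset.univ : Finset (Fin 12)).offDiag.filter (fun p => u p.1 + u p.2 = w) with hN
  have hmem : ∀ {w : W} {p q : Fin 12}, (p, q) ∈ N w ↔ p ≠ q ∧ u p + u q = w := by
    intro w p q
    simp [hN]
  have hN2 : ∀ w ≠ 0, 2 ≤ (N w).card := by
    intro w hw
    obtain ⟨p, q, hpq, -, -⟩ := hcov w hw
    exact two_le_card_fiber htwo u _ hw ⟨p, by simp, q, by simp, hpq⟩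
  have hcardE : (Finset.univ.erase (0 : W)).card = 63 := by
    rw [Finset.card_erase_of_mem (Finset.mem_univ _), Finset.card_univ, hW]
  have hoff : (Finset.univ : Finset (Fin 12)).offDiag.card = 132 := by
    simp [Finset.offDiag_card]
  have htot : ∑ w ∈ Finset.univ.erase (0 : W), (N w).card ≤ 132 := by
    rw [← hoff]
    exact sum_card_fiber_le _ _ _
  have htot' : ∑ w ∈ Finset.univ.erase (0 : W), (N w).card = 132 := by
    rw [← hoff]
    symm
    apply Finset.card_eq_sum_card_fiberwise
    rintro ⟨p, q⟩ hpq
    simp only [Finset.coe_offDiag, Set.mem_offDiag] at hpq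
    simp only [Finset.coe_erase, Finset.coe_univ, Set.mem_sdiff, Set.mem_univ, true_and,
      Set.mem_singleton_iff]
    intro h0
    apply hpq.2.2
    apply hinj
    have := htwo (u q)
    exact add_right_cancel (h0.trans this.symm)
  obtain ⟨i, j, k, l, hij, hik, hil, hjk, hjl, hkl, hs⟩ : ∃ i j k l : Fin 12,
      i ≠ j ∧ i ≠ k ∧ i ≠ l ∧ j ≠ k ∧ j ≠ l ∧ k ≠ l ∧ u i + u j = u k + u l := by
    have : ∃ w, 2 < (N w).card := by
      by_contra! hc
      have := Finset.sum_le_card_nsmul (Finset.univ.erase (0 : W)) (fun w => (N w).card) 2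
        (fun w _ => hc w)
      rw [hcardE, htot'] at this
      simp at this
    obtain ⟨w, hw⟩ := this
    obtain ⟨⟨i, j⟩, hij⟩ : (N w).Nonempty := Finset.card_pos.mp (by omega)
    obtain ⟨⟨k, l⟩, hkl, hne⟩ : ∃ p ∈ N w, p ∉ ({(i, j), (j, i)} : Finset (Fin 12 × Fin 12)) := by
      apply Finset.exists_mem_notMem_of_card_lt_card
      exact Finset.card_le_two.trans_lt hw
    rw [hmem] at hij hkl
    simp only [Finset.mem_insert, Finset.mem_singleton, Prod.mk.injEq, not_or, not_and] at hne
    have hs := hij.2.trans hkl.2.symm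
    have hik : i ≠ k := by
      rintro rfl
      exact hne.1 rfl (hinj (add_left_cancel hs)).symm
    have hjl : j ≠ l := by
      rintro rfl
      exact hne.1 (hinj (add_right_cancel hs)).symm rfl
    have hil : i ≠ l := by
      rintro rfl
      rw [add_comm (u k)] at hs
      exact hne.2 (hinj (add_left_cancel hs)).symm rfl
    have hjk : j ≠ k := by
      rintro rfl
      rw [add_comm (u j)] at hs
      exact hne.2 rfl (hinj (add_right_cancel hs)).symm
    exact ⟨i, j, k, l, hij.1, hik, hil, hjk, hjl, hkl.1, hs⟩
  have hswap : ∀ {x y z t : W}, x + y = z + t → x + z = y + t := by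
    intro x y z t e
    have hy := htwo y
    have hz := htwo z
    calc x + z = (x + y) + (y + z) - (y + y) := by abel
      _ = (z + t) + (y + z) := by rw [e, hy, sub_zero]
      _ = (y + t) + (z + z) := by abel
      _ = y + t := by rw [hz, add_zero]
  have key : ∀ i j k l : Fin 12, i ≠ j → i ≠ k → i ≠ l → j ≠ k → j ≠ l → k ≠ l →
      u i + u j = u k + u l → b i = b j → False := by
    intro i j k l hij hik hil hjk hjl hkl hs hbij
    have hne0 : ∀ {p q : Fin 12}, p ≠ q → u p + u q ≠ 0 := by
      intro p q hpq h0
      exact hpq (hinj (add_right_cancel (h0.trans (htwo (u q)).symm)))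
    have hfour : ∀ i j k l : Fin 12, i ≠ j → i ≠ k → i ≠ l → j ≠ k → j ≠ l → k ≠ l →
        u i + u j = u k + u l →
        ({(i, j), (j, i), (k, l), (l, k)} : Finset (Fin 12 × Fin 12)) ⊆ N (u i + u j) ∧
        ({(i, j), (j, i), (k, l), (l, k)} : Finset (Fin 12 × Fin 12)).card = 4 := by
      intro i j k l hij hik hil hjk hjl hkl hs
      constructor
      · rintro ⟨p, q⟩ hpq
        rw [hmem]
        simp only [Finset.mem_insert, Finset.mem_singleton, Prod.mk.injEq] at hpq
        rcases hpq with ⟨rfl, rfl⟩ | ⟨rfl, rfl⟩ | ⟨rfl, rfl⟩ | ⟨rfl, rfl⟩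
        · exact ⟨hij, rfl⟩
        · exact ⟨hij.symm, add_comm _ _⟩
        · exact ⟨hkl, hs.symm⟩
        · exact ⟨hkl.symm, (add_comm _ _).trans hs.symm⟩
      · rw [Finset.card_insert_of_notMem, Finset.card_insert_of_notMem,
          Finset.card_insert_of_notMem, Finset.card_singleton] <;>
          simp [hij, hik, hil, hjk, hjl, hkl, hij.symm, hkl.symm]
    have hs2 : u i + u k = u j + u l := hswap hs
    have hs3 : u i + u l = u j + u k := hswap (hs.trans (add_comm _ _))
    have h1 := hfour i j k l hij hik hil hjk hjl hkl hs
    have h2 := hfour i k j l hik hij hil hjk.symm hkl hjl hs2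
    have h3 := hfour i l j k hil hij hik hjl.symm hkl.symm hjk hs3
    have c2 : 4 ≤ (N (u i + u k)).card := h2.2 ▸ Finset.card_le_card h2.1
    have c3 : 4 ≤ (N (u i + u l)).card := h3.2 ▸ Finset.card_le_card h3.1
    have c1 : 5 ≤ (N (u i + u j)).card := by
      by_contra hc
      have heq := Finset.eq_of_subset_of_card_le h1.1 (by rw [h1.2]; omega)
      have hsum := h _ (hne0 hij)
      have hconv : ∑ p : Fin 12 × Fin 12,
          (if u p.1 + u p.2 = u i + u j then b p.1 * b p.2 else 0) =
          ∑ p ∈ N (u i + u j), b p.1 * b p.2 := by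
        rw [← Finset.sum_filter]
        apply Finset.sum_congr _ fun _ _ => rfl
        ext ⟨p, q⟩
        rw [hmem]
        simp only [Finset.mem_filter, Finset.mem_univ, true_and]
        refine ⟨fun e => ⟨?_, e⟩, fun e => e.2⟩
        rintro rfl
        rw [htwo] at e
        exact hne0 hij e.symm
      rw [hconv, ← heq, Finset.sum_insert, Finset.sum_insert, Finset.sum_insert,
        Finset.sum_singleton] at hsum
      · have hbi := hb j
        have hbk := hb k
        have hbl := hb l
        simp only [hbij] at hsum
        revert hsum hbi hbk hbl
        generalize b j = x
        generalize b k = y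
        generalize b l = z
        revert x y z
        decide
      all_goals simp [hij, hik, hil, hjk, hjl, hkl, hij.symm, hkl.symm]
    have hw12 : u i + u j ≠ u i + u k := fun e => hjk (hinj (add_left_cancel e))
    have hw13 : u i + u j ≠ u i + u l := fun e => hjl (hinj (add_left_cancel e))
    have hw23 : u i + u k ≠ u i + u l := fun e => hkl (hinj (add_left_cancel e))
    have hfin : ∑ w ∈ Finset.univ.erase (0 : W),
        (2 + (if w = u i + u j then 3 else 0) + (if w = u i + u k then 2 else 0)
          + (if w = u i + u l then 2 else 0)) ≤
        ∑ w ∈ Finset.univ.erase (0 : W), (N w).card := by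
      apply Finset.sum_le_sum
      intro w hw
      have := hN2 w (Finset.ne_of_mem_erase hw)
      by_cases e1 : w = u i + u j
      · rw [e1, if_pos rfl, if_neg hw12, if_neg hw13]
        exact c1
      by_cases e2 : w = u i + u k
      · rw [e2, if_neg hw12.symm, if_pos rfl, if_neg hw23]
        exact c2
      by_cases e3 : w = u i + u l
      · rw [e3, if_neg hw13.symm, if_neg hw23.symm, if_pos rfl]
        exact c3
      rw [if_neg e1, if_neg e2, if_neg e3]
      exact this
    rw [htot'] at hfin
    simp only [Finset.sum_add_distrib, Finset.sum_ite_eq', Finset.sum_const, hcardE,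
      Finset.mem_erase, Finset.mem_univ, and_true, ne_eq, hne0 hij, hne0 hik, hne0 hil,
      not_false_eq_true, if_true] at hfin
    simp at hfin
  have hpig : b i = b j ∨ b i = b k ∨ b j = b k := by
    have h1 := hb i
    have h2 := hb j
    have h3 := hb k
    revert h1 h2 h3
    generalize b i = x
    generalize b j = y
    generalize b k = z
    revert x y z
    decide
  rcases hpig with e | e | e
  · exact key i j k l hij hik hil hjk hjl hkl hs e
  · exact key i k j l hik hij hil hjk.symm hkl hjl (hswap hs) e
  · exact key j k i l hjk hij.symm hjl hik.symm hkl hil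
      (hswap (hs.trans (add_comm _ _))).symm e

/-- The nontrivial character of `ZMod 2` with values in `ZMod 3`. -/
def signChar (t : ZMod 2) : ZMod 3 := if t = 0 then 1 else -1

lemma signChar_zero : signChar 0 = 1 := rfl

lemma signChar_add (s t : ZMod 2) : signChar (s + t) = signChar s * signChar t := by
  revert s t; decide

lemma sum_signChar_dotProduct (w : Fin 6 → ZMod 2) :
    ∑ x : Fin 6 → ZMod 2, signChar (w ⬝ᵥ x) = if w = 0 then 1 else 0 := by
  split_ifs with hw
  · subst hw
    simp only [zero_dotProduct, signChar_zero, Finset.sum_const, Finset.card_univ,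
      Fintype.card_pi, ZMod.card, Finset.prod_const, Fintype.card_fin]
    decide
  · obtain ⟨i, hi⟩ := Function.ne_iff.mp hw
    have h1 : w ⬝ᵥ Pi.single i 1 = 1 := by
      have : ∀ t : ZMod 2, t ≠ 0 → t = 1 := by decide
      simpa using this _ hi
    have h2 := Equiv.sum_comp (Equiv.addRight (Pi.single i (1 : ZMod 2)))
      (fun x => signChar (w ⬝ᵥ x))
    simp only [Equiv.coe_addRight, dotProduct_add, h1, signChar_add] at h2
    rw [← Finset.sum_mul] at h2
    revert h2
    generalize ∑ x : Fin 6 → ZMod 2, signChar (w ⬝ᵥ x) = s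
    revert s
    decide

/-- Eleven elements of `C₂⁵ ⊕ C₃` have a nonempty zero-sum subfamily. -/
lemma exists_sum_eq_zero (v : Fin 11 → Fin 5 → ZMod 2) (a : Fin 11 → ZMod 3) :
    ∃ s : Finset (Fin 11), s.Nonempty ∧ ∑ i ∈ s, v i = 0 ∧ ∑ i ∈ s, a i = 0 := by
  classical
  by_contra! hcon
  let T := Fintype.linearCombination (ZMod 2) v
  have hker : 6 ≤ Module.finrank (ZMod 2) (LinearMap.ker T) := by
    have h1 := LinearMap.finrank_range_add_finrank_ker T
    have h2 := Submodule.finrank_le (LinearMap.range T)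
    simp only [Module.finrank_fin_fun] at h1 h2
    omega
  obtain ⟨f, hf⟩ := exists_linearIndependent_of_le_finrank hker
  let u' : Fin 11 → Fin 6 → ZMod 2 := fun i j => (f j : Fin 11 → ZMod 2) i
  let s : (Fin 6 → ZMod 2) → Finset (Fin 11) := fun x =>
    Finset.univ.filter (fun i => u' i ⬝ᵥ x ≠ 0)
  have hcode : ∀ x : Fin 6 → ZMod 2, (fun i => u' i ⬝ᵥ x) =
      ((∑ j, x j • f j : LinearMap.ker T) : Fin 11 → ZMod 2) := by
    intro x
    ext i
    simp [u', dotProduct, mul_comm]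
  have hone : ∀ t : ZMod 2, t ≠ 0 → t = 1 := by decide
  have hsv : ∀ x, ∑ i ∈ s x, v i = 0 := by
    intro x
    have h : T (fun i => u' i ⬝ᵥ x) = 0 := by
      rw [hcode]
      exact LinearMap.mem_ker.mp (Subtype.prop _)
    rw [← h, Fintype.linearCombination_apply, Finset.sum_filter]
    apply Finset.sum_congr rfl
    intro i _
    split_ifs with hi
    · rw [hone _ hi, one_smul]
    · rw [not_not.mp hi, zero_smul]
  have hsne : ∀ x ≠ 0, (s x).Nonempty := by
    intro x hx
    by_contra hemp
    rw [Finset.not_nonempty_iff_eq_empty, Finset.filter_eq_empty_iff] at hemp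
    have h0 : (∑ j, x j • f j : LinearMap.ker T) = 0 := by
      apply Subtype.ext
      rw [← hcode]
      ext i
      simpa using hemp (Finset.mem_univ i)
    exact hx (funext (Fintype.linearIndependent_iff.mp hf x h0))
  let u : Fin 12 → Fin 6 → ZMod 2 := Fin.cons 0 u'
  let b : Fin 12 → ZMod 3 := Fin.cons (-∑ i, a i) a
  let A : (Fin 6 → ZMod 2) → ZMod 3 := fun x => ∑ i, b i * signChar (u i ⬝ᵥ x)
  have hA : ∀ x, A x = ∑ i ∈ s x, a i := by
    intro x
    simp only [A, u, b]
    rw [Fin.sum_univ_succ, Finset.sum_filter]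
    simp only [Fin.cons_zero, Fin.cons_succ, zero_dotProduct, signChar_zero, mul_one]
    rw [← Finset.sum_neg_distrib, ← Finset.sum_add_distrib]
    apply Finset.sum_congr rfl
    intro i _
    rw [signChar]
    have : ∀ t : ZMod 3, -t + t * -1 = t := by decide
    by_cases hi : u' i ⬝ᵥ x = 0
    · simp [hi]
    · simp only [hi, if_false, ne_eq, not_false_eq_true, if_true]
      exact this _
  have hA2 : ∀ x, A x * A x = 1 - if x = 0 then 1 else 0 := by
    intro x
    rw [hA]
    split_ifs with hx
    · subst hx
      simp [s]
    · have h1 := hcon (s x) (hsne x hx) (hsv x)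
      revert h1
      generalize ∑ i ∈ s x, a i = t
      revert t
      decide
  refine pair_coefficients_contra (W := Fin 6 → ZMod 2) (by simp [ZMod.card])
    (fun w => by ext i; exact CharTwo.add_self_eq_zero _) u b ?_
  intro w hw
  have hF1 : ∑ x : Fin 6 → ZMod 2, signChar (w ⬝ᵥ x) * (A x * A x) = -1 := by
    simp only [hA2, mul_sub, mul_one, Finset.sum_sub_distrib, sum_signChar_dotProduct, if_neg hw]
    simp [signChar_zero]
  rw [← hF1]
  have hx : ∀ x : Fin 6 → ZMod 2, signChar (w ⬝ᵥ x) * (A x * A x) =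
      ∑ p : Fin 12 × Fin 12, b p.1 * b p.2 * signChar ((u p.1 + u p.2 + w) ⬝ᵥ x) := by
    intro x
    simp only [A]
    rw [Finset.sum_mul_sum, Fintype.sum_prod_type, Finset.mul_sum]
    apply Finset.sum_congr rfl
    intro i _
    rw [Finset.mul_sum]
    apply Finset.sum_congr rfl
    intro j _
    rw [add_dotProduct, add_dotProduct, signChar_add, signChar_add]
    ring
  simp only [hx]
  rw [Finset.sum_comm]
  apply Finset.sum_congr rfl
  rintro ⟨i, j⟩ _
  rw [← Finset.mul_sum, sum_signChar_dotProduct]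
  have : u i + u j + w = 0 ↔ u i + u j = w := by
    have hww : w + w = 0 := by ext i; exact CharTwo.add_self_eq_zero _
    rw [← hww, add_left_inj]
  simp only [this]
  split_ifs <;> simp

lemma exists_sum_eq_zero_prod (g : Fin 11 → (Fin 4 → ZMod 2) × ZMod 6) :
    ∃ s : Finset (Fin 11), s.Nonempty ∧ ∑ i ∈ s, g i = 0 := by
  let p := ZMod.castHom (show 2 ∣ 6 by norm_num) (ZMod 2)
  let q := ZMod.castHom (show 3 ∣ 6 by norm_num) (ZMod 3)
  obtain ⟨s, hs, h1, h2⟩ := exists_sum_eq_zero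
    (fun i => Fin.cons (p (g i).2) (g i).1) (fun i => q (g i).2)
  refine ⟨s, hs, ?_⟩
  have hp : p (∑ i ∈ s, (g i).2) = 0 := by
    have := congrFun h1 0
    simpa [Finset.sum_apply] using this
  have hq : q (∑ i ∈ s, (g i).2) = 0 := by
    simpa using h2
  have hpq : ∀ t : ZMod 6, p t = 0 → q t = 0 → t = 0 := by decide
  apply Prod.ext
  · rw [Prod.fst_sum]
    ext j
    have := congrFun h1 j.succ
    simpa [Finset.sum_apply] using this
  · rw [Prod.snd_sum]
    exact hpq _ hp hq

lemma card_le_of_isAtomSeq {A : Multiset ((Fin 4 → ZMod 2) × ZMod 6)}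
    (hA : IsAtomSeq Set.univ A) : A.card ≤ 11 := by
  by_contra! hc
  obtain ⟨l, rfl⟩ := Quot.exists_rep A
  change 11 < l.length at hc
  let e : Fin 11 ↪ Fin l.length := Fin.castLEEmb hc.le
  obtain ⟨s, hs, h0⟩ := exists_sum_eq_zero_prod (fun i => l.get (e i))
  have huniv : (Finset.univ : Finset (Fin l.length)).val.map l.get = (l : Multiset _) := by
    rw [Fin.univ_val_map, List.ofFn_get]
  have hle : (s.map e).val.map l.get ≤ (l : Multiset _) := by
    rw [← huniv]
    exact Multiset.map_le_map (Finset.val_le_iff.mpr (Finset.subset_univ _))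
  have hcard : ((s.map e).val.map l.get).card = s.card := by simp
  have heq := hA.2.2 _ hle
    (by
      rw [← Multiset.card_pos, hcard]
      exact hs.card_pos)
    (by
      change ∑ i ∈ s.map e, l.get i = 0
      rw [Finset.sum_map, h0])
  have := congrArg Multiset.card heq
  rw [hcard] at this
  change s.card = l.length at this
  have := s.card_le_univ
  simp at this
  omega

lemma exponent_eq_six : AddMonoid.exponent ((Fin 4 → ZMod 2) × ZMod 6) = 6 := by
  apply Nat.dvd_antisymm
  · rw [AddMonoid.exponent_dvd_iff_forall_nsmul_eq_zero]
    have h2 : ∀ t : ZMod 2, 6 • t = 0 := by decide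
    have h6 : ∀ t : ZMod 6, 6 • t = 0 := by decide
    intro g
    exact Prod.ext (funext fun i => h2 _) (h6 _)
  · rw [AddMonoid.exponent_prod, ZMod.exponent]
    exact dvd_lcm_right _ _

lemma Multiset.sum_eq_sum_count_smul {G ι : Type*} [AddCommMonoid G] [DecidableEq G] [Fintype ι]
    {e : ι → G} (he : Function.Injective e) {S : Multiset G} (hS : ∀ x ∈ S, x ∈ Set.range e) :
    S.sum = ∑ i, S.count (e i) • e i := by
  rw [Finset.sum_multiset_count_of_subset S (Finset.univ.map ⟨e, he⟩), Finset.sum_map]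
  · rfl
  · intro x hx
    obtain ⟨i, rfl⟩ := hS x (Multiset.mem_toFinset.mp hx)
    simp

lemma Multiset.ext_count_range {G ι : Type*} [DecidableEq G] {e : ι → G} {S T : Multiset G}
    (hS : ∀ x ∈ S, x ∈ Set.range e) (hT : ∀ x ∈ T, x ∈ Set.range e)
    (h : ∀ i, S.count (e i) = T.count (e i)) : S = T := by
  ext x
  by_cases hx : x ∈ Set.range e
  · obtain ⟨i, rfl⟩ := hx
    exact h i
  · rw [Multiset.count_eq_zero_of_notMem (fun hc => hx (hS x hc)),
      Multiset.count_eq_zero_of_notMem (fun hc => hx (hT x hc))]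

/-- The support of a minimal zero-sum sequence of length 11. -/
def longElt : Fin 9 → (Fin 4 → ZMod 2) × ZMod 6 :=
  ![(![0, 1, 0, 0], 2), (![1, 1, 0, 0], 5), (![0, 0, 1, 0], 2), (![1, 0, 1, 0], 5),
    (![0, 0, 0, 1], 2), (![1, 0, 0, 1], 5), (![0, 1, 1, 1], 1), (![1, 1, 1, 1], 5), (0, 1)]

/-- A minimal zero-sum sequence of length 11. -/
def longAtom : Multiset ((Fin 4 → ZMod 2) × ZMod 6) :=
  Multiset.map longElt {0, 1, 2, 3, 4, 5, 6, 7, 8, 8, 8}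

lemma longElt_injective : Function.Injective longElt := by decide +kernel

lemma longAtom_counts (x₀ x₁ x₂ x₃ x₄ x₅ x₆ x₇ x₈ : ℕ)
    (h₀ : x₀ ≤ 1) (h₁ : x₁ ≤ 1) (h₂ : x₂ ≤ 1) (h₃ : x₃ ≤ 1) (h₄ : x₄ ≤ 1) (h₅ : x₅ ≤ 1)
    (h₆ : x₆ ≤ 1) (h₇ : x₇ ≤ 1) (h₈ : x₈ ≤ 3)
    (e₀ : 2 ∣ x₁ + (x₃ + (x₅ + x₇))) (e₁ : 2 ∣ x₀ + (x₁ + (x₆ + x₇)))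
    (e₂ : 2 ∣ x₂ + (x₃ + (x₆ + x₇))) (e₃ : 2 ∣ x₄ + (x₅ + (x₆ + x₇)))
    (e₄ : 6 ∣ x₀ * 2 + (x₁ * 5 + (x₂ * 2 + (x₃ * 5 + (x₄ * 2 + (x₅ * 5 + (x₆ + (x₇ * 5 + x₈)))))))) :
    x₁ = x₀ ∧ x₂ = x₀ ∧ x₃ = x₀ ∧ x₄ = x₀ ∧ x₅ = x₀ ∧ x₆ = x₀ ∧ x₇ = x₀ ∧ x₈ = 3 * x₀ := by
  interval_cases x₀ <;> interval_cases x₁ <;> interval_cases x₆ <;> interval_cases x₇ <;> omega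

lemma longAtom_isAtomSeq : IsAtomSeq Set.univ longAtom := by
  have hcount : ∀ i, longAtom.count (longElt i) = if i = 8 then 3 else 1 := by decide +kernel
  refine ⟨⟨fun _ _ => Set.mem_univ _, by decide +kernel⟩, by simp [longAtom], ?_⟩
  intro B hB hB0 hsum
  have hrA : ∀ x ∈ longAtom, x ∈ Set.range longElt := by
    intro x hx
    obtain ⟨i, -, rfl⟩ := Multiset.mem_map.mp hx
    exact ⟨i, rfl⟩
  have hr : ∀ x ∈ B, x ∈ Set.range longElt := fun x hx => hrA x (Multiset.mem_of_le hB hx)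
  have hc : ∀ i, B.count (longElt i) ≤ if i = 8 then 3 else 1 := fun i =>
    hcount i ▸ Multiset.count_le_of_le _ hB
  rw [Multiset.sum_eq_sum_count_smul longElt_injective hr] at hsum
  have hext0 : (∀ i, B.count (longElt i) = 0) → B = 0 := fun h =>
    Multiset.ext_count_range hr (by simp) (by simpa using h)
  have hextA := Multiset.ext_count_range hr hrA
  simp only [hcount] at hextA
  generalize hx : (fun i => B.count (longElt i)) = x at *
  have hx' : ∀ i, B.count (longElt i) = x i := fun i => congrFun hx i
  simp only [hx'] at hsum hc hext0 hextA
  have h1 := congrArg (fun g => g.1) hsum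
  have h2 := congrArg (fun g => g.2) hsum
  have e0 : ((x 1 + (x 3 + (x 5 + x 7)) : ℕ) : ZMod 2) = 0 := by
    simpa [Fin.sum_univ_succ, longElt] using congrFun h1 0
  have e1 : ((x 0 + (x 1 + (x 6 + x 7)) : ℕ) : ZMod 2) = 0 := by
    simpa [Fin.sum_univ_succ, longElt] using congrFun h1 1
  have e2 : ((x 2 + (x 3 + (x 6 + x 7)) : ℕ) : ZMod 2) = 0 := by
    simpa [Fin.sum_univ_succ, longElt] using congrFun h1 2
  have e3 : ((x 4 + (x 5 + (x 6 + x 7)) : ℕ) : ZMod 2) = 0 := by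
    simpa [Fin.sum_univ_succ, longElt] using congrFun h1 3
  have e4 : ((x 0 * 2 + (x 1 * 5 + (x 2 * 2 + (x 3 * 5 + (x 4 * 2 + (x 5 * 5 +
      (x 6 + (x 7 * 5 + x 8))))))) : ℕ) : ZMod 6) = 0 := by
    simpa [Fin.sum_univ_succ, longElt] using h2
  rw [ZMod.natCast_eq_zero_iff] at e0 e1 e2 e3 e4
  obtain ⟨k1, k2, k3, k4, k5, k6, k7, k8⟩ := longAtom_counts (x 0) (x 1) (x 2) (x 3) (x 4) (x 5)
    (x 6) (x 7) (x 8) (hc 0) (hc 1) (hc 2) (hc 3) (hc 4) (hc 5) (hc 6) (hc 7) (hc 8) e0 e1 e2 e3 e4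
  have h01 : x 0 = 0 ∨ x 0 = 1 := by
    have : x 0 ≤ 1 := hc 0
    omega
  rcases h01 with h | h
  · refine absurd (hext0 fun i => ?_) hB0
    fin_cases i <;> simp [*]
  · refine hextA fun i => ?_
    fin_cases i <;> simp [*]

lemma davenportC_eq : DavenportC ((Fin 4 → ZMod 2) × ZMod 6) = 11 := by
  apply IsGreatest.csSup_eq
  constructor
  · exact ⟨longAtom, longAtom_isAtomSeq, by simp [longAtom]⟩
  · rintro _ ⟨A, hA, rfl⟩
    exact card_le_of_isAtomSeq hA

/-- The support of a sequence with set of lengths `{2, 8}`. -/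
def gapElt : Fin 7 → (Fin 4 → ZMod 2) × ZMod 6 :=
  ![(![1, 0, 0, 0], 0), (![0, 1, 0, 0], 0), (![0, 0, 1, 0], 0), (![0, 0, 0, 1], 0),
    (![1, 1, 1, 1], 3), (0, 1), (0, 5)]

/-- The atom of length 8 containing `(0, 1)` three times. -/
def gapAtomPos : Multiset ((Fin 4 → ZMod 2) × ZMod 6) :=
  Multiset.map gapElt {0, 1, 2, 3, 4, 5, 5, 5}

/-- The atom of length 8 containing `-(0, 1)` three times. -/
def gapAtomNeg : Multiset ((Fin 4 → ZMod 2) × ZMod 6) :=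
  Multiset.map gapElt {0, 1, 2, 3, 4, 6, 6, 6}

/-- The factorization of `gapAtomPos + gapAtomNeg` into eight atoms of length 2. -/
def gapPairs : Multiset (Multiset ((Fin 4 → ZMod 2) × ZMod 6)) :=
  Multiset.map (fun p => {gapElt p.1, gapElt p.2})
    ({(0, 0), (1, 1), (2, 2), (3, 3), (4, 4), (5, 6), (5, 6), (5, 6)} : Multiset (Fin 7 × Fin 7))

lemma gapElt_injective : Function.Injective gapElt := by decide +kernel

lemma gap_counts (x₀ x₁ x₂ x₃ x₄ x₅ x₆ : ℕ) (h₀ : x₀ ≤ 1) (h₁ : x₁ ≤ 1) (h₂ : x₂ ≤ 1)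
    (h₃ : x₃ ≤ 1) (h₄ : x₄ ≤ 1) (h₅ : x₅ ≤ 3) (h₆ : x₆ ≤ 3)
    (e₀ : 2 ∣ x₀ + x₄) (e₁ : 2 ∣ x₁ + x₄) (e₂ : 2 ∣ x₂ + x₄) (e₃ : 2 ∣ x₃ + x₄)
    (e₄ : 6 ∣ x₄ * 3 + (x₅ + x₆ * 5)) (h : x₅ = 0 ∨ x₆ = 0) :
    (x₀ = 0 ∧ x₁ = 0 ∧ x₂ = 0 ∧ x₃ = 0 ∧ x₄ = 0 ∧ x₅ = 0 ∧ x₆ = 0) ∨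
      (x₀ = 1 ∧ x₁ = 1 ∧ x₂ = 1 ∧ x₃ = 1 ∧ x₄ = 1 ∧ x₅ = 3 ∧ x₆ = 0) ∨
      (x₀ = 1 ∧ x₁ = 1 ∧ x₂ = 1 ∧ x₃ = 1 ∧ x₄ = 1 ∧ x₅ = 0 ∧ x₆ = 3) := by
  obtain rfl : x₀ = x₄ := by omega
  obtain rfl : x₁ = x₀ := by omega
  obtain rfl : x₂ = x₁ := by omega
  obtain rfl : x₃ = x₂ := by omega
  clear e₀ e₁ e₂ e₃
  interval_cases x₃ <;> interval_cases x₅ <;> interval_cases x₆ <;> simp_all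

lemma zeroSum_le_gap {S : Multiset ((Fin 4 → ZMod 2) × ZMod 6)}
    (hS : S ≤ gapAtomPos + gapAtomNeg) (hS0 : S ≠ 0) (hsum : S.sum = 0) :
    (∃ P ≤ S, P.card = 2 ∧ P.sum = 0) ∨ S = gapAtomPos ∨ S = gapAtomNeg := by
  have hcount : ∀ i, (gapAtomPos + gapAtomNeg).count (gapElt i) = if 5 ≤ i then 3 else 2 := by
    decide +kernel
  have hcountP : ∀ i, gapAtomPos.count (gapElt i) = if i = 5 then 3 else if i = 6 then 0 else 1 := by
    decide +kernel
  have hcountN : ∀ i, gapAtomNeg.count (gapElt i) = if i = 5 then 0 else if i = 6 then 3 else 1 := by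
    decide +kernel
  have hrP : ∀ x ∈ gapAtomPos, x ∈ Set.range gapElt := by
    intro x hx
    obtain ⟨i, -, rfl⟩ := Multiset.mem_map.mp hx
    exact ⟨i, rfl⟩
  have hrN : ∀ x ∈ gapAtomNeg, x ∈ Set.range gapElt := by
    intro x hx
    obtain ⟨i, -, rfl⟩ := Multiset.mem_map.mp hx
    exact ⟨i, rfl⟩
  have hr : ∀ x ∈ S, x ∈ Set.range gapElt := fun x hx =>
    (Multiset.mem_add.mp (Multiset.mem_of_le hS hx)).elim (hrP x) (hrN x)
  have hc : ∀ i, S.count (gapElt i) ≤ if 5 ≤ i then 3 else 2 := fun i =>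
    hcount i ▸ Multiset.count_le_of_le _ hS
  by_cases hpair : ∃ P ≤ S, P.card = 2 ∧ P.sum = 0
  · exact Or.inl hpair
  right
  have hdouble : ∀ i : Fin 7, i < 5 → S.count (gapElt i) ≤ 1 := by
    intro i hi
    by_contra! h
    refine hpair ⟨Multiset.replicate 2 (gapElt i), Multiset.le_count_iff_replicate_le.mp h,
      by simp, ?_⟩
    rw [Multiset.sum_replicate]
    have h2 : ∀ i < 5, 2 • gapElt i = 0 := by decide +kernel
    exact h2 i hi
  have hopp : S.count (gapElt 5) = 0 ∨ S.count (gapElt 6) = 0 := by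
    by_contra! h
    refine hpair ⟨{gapElt 5, gapElt 6}, ?_, by simp, by decide +kernel⟩
    rw [Multiset.le_iff_subset (by decide +kernel)]
    intro x hx
    simp only [Multiset.insert_eq_cons, Multiset.mem_cons, Multiset.mem_singleton] at hx
    rcases hx with rfl | rfl
    · exact Multiset.count_ne_zero.mp h.1
    · exact Multiset.count_ne_zero.mp h.2
  rw [Multiset.sum_eq_sum_count_smul gapElt_injective hr] at hsum
  have hext0 : (∀ i, S.count (gapElt i) = 0) → S = 0 := fun h =>
    Multiset.ext_count_range hr (by simp) (by simpa using h)
  have hextP := Multiset.ext_count_range hr hrP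
  have hextN := Multiset.ext_count_range hr hrN
  simp only [hcountP] at hextP
  simp only [hcountN] at hextN
  generalize hx : (fun i => S.count (gapElt i)) = x at *
  have hx' : ∀ i, S.count (gapElt i) = x i := fun i => congrFun hx i
  simp only [hx'] at hsum hc hext0 hextP hextN hdouble hopp
  have h1 := congrArg (fun g => g.1) hsum
  have h2 := congrArg (fun g => g.2) hsum
  have e0 : ((x 0 + x 4 : ℕ) : ZMod 2) = 0 := by
    simpa [Fin.sum_univ_succ, gapElt] using congrFun h1 0
  have e1 : ((x 1 + x 4 : ℕ) : ZMod 2) = 0 := by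
    simpa [Fin.sum_univ_succ, gapElt] using congrFun h1 1
  have e2 : ((x 2 + x 4 : ℕ) : ZMod 2) = 0 := by
    simpa [Fin.sum_univ_succ, gapElt] using congrFun h1 2
  have e3 : ((x 3 + x 4 : ℕ) : ZMod 2) = 0 := by
    simpa [Fin.sum_univ_succ, gapElt] using congrFun h1 3
  have e4 : ((x 4 * 3 + (x 5 + x 6 * 5) : ℕ) : ZMod 6) = 0 := by
    simpa [Fin.sum_univ_succ, gapElt] using h2
  rw [ZMod.natCast_eq_zero_iff] at e0 e1 e2 e3 e4
  have d0 := hdouble 0 (by decide)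
  have d1 := hdouble 1 (by decide)
  have d2 := hdouble 2 (by decide)
  have d3 := hdouble 3 (by decide)
  have d4 := hdouble 4 (by decide)
  have d5 : x 5 ≤ 3 := hc 5
  have d6 : x 6 ≤ 3 := hc 6
  have hcases := gap_counts (x 0) (x 1) (x 2) (x 3) (x 4) (x 5) (x 6) d0 d1 d2 d3 d4 d5 d6
    e0 e1 e2 e3 e4 hopp
  rcases hcases with h | h | h <;> obtain ⟨k0, k1, k2, k3, k4, k5, k6⟩ := h
  · refine absurd (hext0 fun i => ?_) hS0
    fin_cases i <;> assumption
  · refine Or.inl (hextP fun i => ?_)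
    fin_cases i <;> assumption
  · refine Or.inr (hextN fun i => ?_)
    fin_cases i <;> assumption

lemma gapAtomPos_isAtomSeq : IsAtomSeq Set.univ gapAtomPos := by
  refine ⟨⟨fun _ _ => Set.mem_univ _, by decide +kernel⟩, by simp [gapAtomPos], ?_⟩
  intro B hB hB0 hsum
  rcases zeroSum_le_gap (hB.trans (Multiset.le_add_right _ _)) hB0 hsum with h | h | h
  · obtain ⟨P, hP, hcard, hP0⟩ := h
    have : ∀ P ∈ gapAtomPos.powersetCard 2, P.sum ≠ 0 := by decide +kernel
    exact absurd hP0 (this P (Multiset.mem_powersetCard.mpr ⟨hP.trans hB, hcard⟩))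
  · exact h
  · subst h
    exact absurd hB (by decide +kernel)

lemma gapAtomNeg_isAtomSeq : IsAtomSeq Set.univ gapAtomNeg := by
  refine ⟨⟨fun _ _ => Set.mem_univ _, by decide +kernel⟩, by simp [gapAtomNeg], ?_⟩
  intro B hB hB0 hsum
  rcases zeroSum_le_gap (hB.trans (Multiset.le_add_left _ _)) hB0 hsum with h | h | h
  · obtain ⟨P, hP, hcard, hP0⟩ := h
    have : ∀ P ∈ gapAtomNeg.powersetCard 2, P.sum ≠ 0 := by decide +kernel
    exact absurd hP0 (this P (Multiset.mem_powersetCard.mpr ⟨hP.trans hB, hcard⟩))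
  · subst h
    exact absurd hB (by decide +kernel)
  · exact h

lemma isAtomSeq_pair {G : Type*} [AddCommGroup G] {a b : G} (ha : a ≠ 0) (hb : b ≠ 0)
    (hab : a + b = 0) : IsAtomSeq Set.univ ({a, b} : Multiset G) := by
  refine ⟨⟨fun _ _ => Set.mem_univ _, by simpa using hab⟩, by simp, ?_⟩
  intro B hB hB0 hsum
  refine Multiset.eq_of_le_of_card_le hB ?_
  by_contra! hc
  have hpos := Multiset.card_pos.mpr hB0
  have h1 : B.card = 1 := by
    simp only [Multiset.insert_eq_cons, Multiset.card_cons, Multiset.card_singleton] at hc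
    omega
  obtain ⟨x, rfl⟩ := Multiset.card_eq_one.mp h1
  have hx : x ∈ ({a, b} : Multiset G) := Multiset.mem_of_le hB (Multiset.mem_singleton_self x)
  simp only [Multiset.insert_eq_cons, Multiset.mem_cons, Multiset.mem_singleton] at hx
  rw [Multiset.sum_singleton] at hsum
  rcases hx with rfl | rfl
  · exact ha hsum
  · exact hb hsum

lemma card_eq_one_of_sum_isAtomSeq {G : Type*} [AddCommGroup G] {G₀ : Set G} {A : Multiset G}
    (hA : IsAtomSeq G₀ A) {F : Multiset (Multiset G)} (hF : ∀ C ∈ F, IsAtomSeq G₀ C)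
    (hsum : F.sum = A) : F.card = 1 := by
  rcases F.empty_or_exists_mem with rfl | ⟨C, hC⟩
  · exact absurd hsum.symm hA.2.1
  obtain ⟨F', rfl⟩ := Multiset.exists_cons_of_mem hC
  rw [Multiset.sum_cons] at hsum
  have hCA : C = A := hA.2.2 C (hsum ▸ Multiset.le_add_right _ _) (hF C hC).2.1 (hF C hC).1.2
  rw [hCA, add_eq_left] at hsum
  rcases F'.empty_or_exists_mem with rfl | ⟨D, hD⟩
  · simp
  · obtain ⟨F'', rfl⟩ := Multiset.exists_cons_of_mem hD
    rw [Multiset.sum_cons, add_eq_zero] at hsum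
    exact absurd hsum.1 (hF D (Multiset.mem_cons_of_mem hD)).2.1

lemma lengthSet_gap : LengthSet Set.univ (gapAtomPos + gapAtomNeg) = {2, 8} := by
  ext k
  simp only [Set.mem_insert_iff, Set.mem_singleton_iff]
  constructor
  · rintro ⟨F, rfl, hF, hsum⟩
    by_cases hP : gapAtomPos ∈ F
    · obtain ⟨F', rfl⟩ := Multiset.exists_cons_of_mem hP
      rw [Multiset.sum_cons, add_right_inj] at hsum
      rw [Multiset.card_cons, card_eq_one_of_sum_isAtomSeq gapAtomNeg_isAtomSeq
        (fun C hC => hF C (Multiset.mem_cons_of_mem hC)) hsum]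
      exact Or.inl rfl
    by_cases hN : gapAtomNeg ∈ F
    · obtain ⟨F', rfl⟩ := Multiset.exists_cons_of_mem hN
      rw [Multiset.sum_cons, add_comm gapAtomPos, add_right_inj] at hsum
      rw [Multiset.card_cons, card_eq_one_of_sum_isAtomSeq gapAtomPos_isAtomSeq
        (fun C hC => hF C (Multiset.mem_cons_of_mem hC)) hsum]
      exact Or.inl rfl
    right
    have htwo : ∀ A ∈ F, A.card = 2 := by
      intro A hA
      have hle : A ≤ gapAtomPos + gapAtomNeg := hsum ▸ Multiset.le_sum_of_mem hA
      have hat := hF A hA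
      rcases zeroSum_le_gap hle hat.2.1 hat.1.2 with ⟨P, hPA, hcard, hP0⟩ | rfl | rfl
      · rw [← hat.2.2 P hPA (by rintro rfl; simp at hcard) hP0, hcard]
      · exact absurd hA hP
      · exact absurd hA hN
    have hcard := congrArg Multiset.cardHom hsum
    have h16 : Multiset.cardHom (gapAtomPos + gapAtomNeg) = 16 := by decide +kernel
    have hmap : F.map Multiset.cardHom = F.map (fun _ => 2) := Multiset.map_congr rfl htwo
    rw [map_multiset_sum, hmap, h16, Multiset.map_const', Multiset.sum_replicate,
      smul_eq_mul] at hcard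
    omega
  · rintro (rfl | rfl)
    · refine ⟨{gapAtomPos, gapAtomNeg}, by simp, ?_, by simp⟩
      intro A hA
      simp only [Multiset.insert_eq_cons, Multiset.mem_cons, Multiset.mem_singleton] at hA
      rcases hA with rfl | rfl
      · exact gapAtomPos_isAtomSeq
      · exact gapAtomNeg_isAtomSeq
    · refine ⟨gapPairs, by simp [gapPairs], ?_, by decide +kernel⟩
      intro A hA
      obtain ⟨⟨i, j⟩, hij, rfl⟩ := Multiset.mem_map.mp hA
      have hne : ∀ i, gapElt i ≠ 0 := by decide +kernel
      have hadd : ∀ p ∈ ({(0, 0), (1, 1), (2, 2), (3, 3), (4, 4), (5, 6), (5, 6), (5, 6)} :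
          Multiset (Fin 7 × Fin 7)), gapElt p.1 + gapElt p.2 = 0 := by decide +kernel
      exact isAtomSeq_pair (hne i) (hne j) (hadd _ hij)

theorem stmt_13 :
    DavenportC ((Fin 4 → ZMod 2) × ZMod 6) = 11 ∧
    AddMonoid.exponent ((Fin 4 → ZMod 2) × ZMod 6) = 6 ∧
    ∃ B : Multiset ((Fin 4 → ZMod 2) × ZMod 6), B.sum = 0 ∧
      LengthSet Set.univ B = {2, 8} :=
  ⟨davenportC_eq, exponent_eq_six, gapAtomPos + gapAtomNeg, by decide +kernel, lengthSet_gap⟩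
end

section
/- In the group G = C₃⁵, there is no zero-sum sequence B over G with set of lengths L(B) = {2, 8}; i.e., {2, 8} ∉ L(C₃⁵). -/
section Atoms

variable {G : Type*} [AddCommGroup G]

theorem isAtomSeq_univ_iff {A : Multiset G} :
    IsAtomSeq Set.univ A ↔
      A.sum = 0 ∧ A ≠ 0 ∧ ∀ C ≤ A, C ≠ 0 → C.sum = 0 → C = A := by
  simp [IsAtomSeq, IsZeroSumSeq]

theorem IsAtomSeq.sum_eq_zero {A : Multiset G} (hA : IsAtomSeq Set.univ A) : A.sum = 0 :=
  hA.1.2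

theorem IsAtomSeq.ne_zero {A : Multiset G} (hA : IsAtomSeq Set.univ A) : A ≠ 0 :=
  hA.2.1

theorem IsAtomSeq.eq_of_le {A C : Multiset G} (hA : IsAtomSeq Set.univ A) (hle : C ≤ A)
    (h0 : C ≠ 0) (hs : C.sum = 0) : C = A :=
  hA.2.2 C hle h0 hs

/-- Every zero-sum sequence is a product of atoms. -/
theorem exists_atom_factorization (B : Multiset G) (hB : B.sum = 0) :
    ∃ F : Multiset (Multiset G), (∀ A ∈ F, IsAtomSeq Set.univ A) ∧ F.sum = B := by
  classical
  induction B using Multiset.strongInductionOn with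
  | ih B ih =>
    by_cases h0 : B = 0
    · exact ⟨0, by simp, by simp [h0]⟩
    by_cases hat : IsAtomSeq Set.univ B
    · exact ⟨{B}, by simpa using hat, by simp⟩
    rw [isAtomSeq_univ_iff] at hat
    push Not at hat
    obtain ⟨C, hle, hC0, hCs, hCB⟩ := hat hB h0
    obtain ⟨D, rfl⟩ := Multiset.le_iff_exists_add.1 hle
    have hD : D.sum = 0 := by simpa [hCs] using hB
    have hD0 : D ≠ 0 := by rintro rfl; simp at hCB
    obtain ⟨F₁, h₁, rfl⟩ := ih C (lt_of_le_of_ne hle hCB) hCs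
    obtain ⟨F₂, h₂, rfl⟩ := ih D (lt_of_le_of_ne (Multiset.le_add_left _ _)
      (by simpa using hC0)) hD
    refine ⟨F₁ + F₂, fun A hA => ?_, by simp⟩
    rcases Multiset.mem_add.1 hA with h | h
    exacts [h₁ A h, h₂ A h]

/-- A factorization of an atom consists of that atom alone. -/
theorem IsAtomSeq.card_factorization_eq_one {F : Multiset (Multiset G)}
    (hA : IsAtomSeq Set.univ F.sum) (hF : ∀ A ∈ F, IsAtomSeq Set.univ A) : F.card = 1 := by
  induction F using Multiset.induction with
  | empty => exact absurd rfl hA.ne_zero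
  | cons C F _ =>
    have hC := hF C (Multiset.mem_cons_self _ _)
    rw [Multiset.sum_cons] at hA
    have h := hA.eq_of_le (Multiset.le_add_right _ _) hC.ne_zero hC.sum_eq_zero
    have hs : F.sum = 0 := by simpa using h
    rcases Multiset.empty_or_exists_mem F with rfl | ⟨A, hAF⟩
    · simp
    · have : A ≤ F.sum := Multiset.single_le_sum (fun _ _ => Multiset.zero_le _) A hAF
      rw [hs] at this
      exact absurd (Multiset.le_zero.1 this) (hF A (Multiset.mem_cons_of_mem hAF)).ne_zero

theorem isAtomSeq_pair_s14 {g : G} (hg : g ≠ 0) : IsAtomSeq Set.univ ({g, -g} : Multiset G) := by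
  classical
  refine isAtomSeq_univ_iff.2 ⟨by simp, by simp, fun C hle hC0 hCs => ?_⟩
  refine Multiset.eq_of_le_of_card_le hle ?_
  by_contra! hlt
  have h1 : C.card = 1 := by
    have := Multiset.card_pos.2 hC0
    simp at hlt
    omega
  obtain ⟨a, rfl⟩ := Multiset.card_eq_one.1 h1
  have : a = g ∨ a = -g := by simpa using Multiset.mem_of_le hle (Multiset.mem_singleton_self a)
  simp at hCs
  rcases this with rfl | rfl
  · exact hg hCs
  · exact hg (neg_eq_zero.1 hCs)

theorem IsAtomSeq.pair_eq {A : Multiset G} {g : G} (hA : IsAtomSeq Set.univ A) (hg : g ∈ A)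
    (hn : -g ∈ A) (hne : g ≠ -g) : ({g, -g} : Multiset G) = A := by
  classical
  refine hA.eq_of_le ?_ (by simp) (by simp)
  rw [Multiset.le_iff_subset (by simpa using hne)]
  intro x hx
  rcases (by simpa using hx : x = g ∨ x = -g) with rfl | rfl <;> assumption

/-- In exponent three, two equal terms of an atom may be replaced by their sum. -/
theorem IsAtomSeq.merge {g : G} (h3 : g + g = -g) {T : Multiset G}
    (hA : IsAtomSeq Set.univ (g ::ₘ g ::ₘ T)) : IsAtomSeq Set.univ (-g ::ₘ T) := by
  classical
  refine isAtomSeq_univ_iff.2 ⟨?_, by simp, fun C hle hC0 hCs => ?_⟩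
  · have := hA.sum_eq_zero
    simp only [Multiset.sum_cons, ← add_assoc, h3] at this
    simpa using this
  · by_cases hm : -g ∈ C
    · obtain ⟨D, rfl⟩ := Multiset.exists_cons_of_mem hm
      have hD := (Multiset.cons_le_cons_iff _).1 hle
      have := hA.eq_of_le (C := g ::ₘ g ::ₘ D) (by simpa using hD) (by simp)
        (by simpa only [Multiset.sum_cons, ← add_assoc, h3] using hCs)
      simpa using this
    · have hT := (Multiset.le_cons_of_notMem hm).1 hle
      have := hA.eq_of_le (hT.trans ((Multiset.le_cons_self _ _).trans
        (Multiset.le_cons_self _ _))) hC0 hCs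
      have h := Multiset.card_le_card hT
      simp [this] at h

end Atoms

section Davenport

open MvPolynomial

/-- More than `r * (p - 1)` elements of `C_p ^ r` have a nonempty zero-sum subfamily. -/
theorem exists_zero_sum_subfamily {p r n : ℕ} [Fact p.Prime] (f : Fin n → Fin r → ZMod p)
    (h : r * (p - 1) < n) : ∃ t : Finset (Fin n), t.Nonempty ∧ ∑ i ∈ t, f i = 0 := by
  classical
  have hp := (Fact.out : p.Prime)
  let P : Fin r → MvPolynomial (Fin n) (ZMod p) := fun j => ∑ i, C (f i j) * X i ^ (p - 1)
  have hdeg : ∑ j, (P j).totalDegree < Fintype.card (Fin n) := by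
    refine lt_of_le_of_lt (Finset.sum_le_card_nsmul _ _ (p - 1) fun j _ => ?_) (by simpa using h)
    refine totalDegree_finsetSum_le fun i _ => (totalDegree_mul _ _).trans ?_
    rw [totalDegree_C, totalDegree_X_pow, zero_add]
  have hdvd : p ∣ Nat.card {x : Fin n → ZMod p // ∀ j, eval x (P j) = 0} := by
    convert char_dvd_card_solutions_of_fintype_sum_lt p hdeg
    rw [Nat.card_eq_fintype_card]
    exact congrArg (fun i => @Fintype.card _ i) (Subsingleton.elim _ _)
  have heval : ∀ x j, eval x (P j) = ∑ i, f i j * x i ^ (p - 1) := by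
    intro x j; simp [P]
  have hp1 : p - 1 ≠ 0 := by have := hp.two_le; omega
  let z : {x : Fin n → ZMod p // ∀ j, eval x (P j) = 0} :=
    ⟨0, fun j => by rw [heval]; simp [hp1]⟩
  have hcard := lt_of_lt_of_le hp.one_lt (Nat.le_of_dvd (Nat.card_pos_iff.2 ⟨⟨z⟩, inferInstance⟩) hdvd)
  have := Finite.one_lt_card_iff_nontrivial.1 hcard
  obtain ⟨y, hy⟩ := exists_ne z
  refine ⟨Finset.univ.filter fun i => y.1 i ≠ 0, ?_, ?_⟩
  · obtain ⟨i, hi⟩ := Function.ne_iff.1 fun hz : y.1 = 0 => hy (Subtype.ext hz)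
    exact ⟨i, by simpa using hi⟩
  · funext j
    have := y.2 j
    rw [heval] at this
    rw [Finset.sum_apply, Finset.sum_filter, Pi.zero_apply]
    refine Eq.trans ?_ this
    refine Finset.sum_congr rfl fun i _ => ?_
    by_cases hi : y.1 i = 0
    · simp [hi, hp1]
    · simp [hi, ZMod.pow_card_sub_one_eq_one hi]

theorem IsAtomSeq.card_le {p r : ℕ} [Fact p.Prime] {A : Multiset (Fin r → ZMod p)}
    (hA : IsAtomSeq Set.univ A) : A.card ≤ r * (p - 1) + 1 := by
  classical
  by_contra! hlt
  obtain ⟨a, ha⟩ := Multiset.exists_mem_of_ne_zero hA.ne_zero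
  obtain ⟨T, rfl⟩ := Multiset.exists_cons_of_mem ha
  induction T using Quotient.inductionOn with
  | h l =>
    have hn : r * (p - 1) < l.length := by simpa using hlt
    obtain ⟨t, ht, hs⟩ := exists_zero_sum_subfamily (fun i => l.get i) hn
    have hle : t.val.map l.get ≤ (l : Multiset _) := by
      have h1 : t.val.map l.get ≤ (Finset.univ : Finset (Fin l.length)).val.map l.get :=
        Multiset.map_le_map (Finset.val_le_iff.2 (Finset.subset_univ t))
      have h2 : (Finset.univ : Finset (Fin l.length)).val.map l.get = (l : Multiset _) := by
        simp [Fin.univ_def]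
      rwa [h2] at h1
    have := hA.eq_of_le (hle.trans (Multiset.le_cons_self _ _))
      (by simpa using ht.ne_empty) hs
    have hc := Multiset.card_le_card hle
    rw [this] at hc
    simp at hc

end Davenport

section Multisets

variable {α : Type*}

theorem three_mul_card_le {F : Multiset (Multiset α)} (h : ∀ A ∈ F, 2 ≤ A.card) :
    3 * F.card ≤ F.sum.card + (F.filter fun A => A.card = 2).card := by
  induction F using Multiset.induction with
  | empty => simp
  | cons A F ih =>
    have hA := h A (Multiset.mem_cons_self _ _)
    have := ih fun C hC => h C (Multiset.mem_cons_of_mem hC)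
    rw [Multiset.filter_cons]
    split_ifs with h2 <;> simp <;> omega

theorem two_mul_card_le {F : Multiset (Multiset α)} (h : ∀ A ∈ F, 2 ≤ A.card) :
    2 * F.card ≤ F.sum.card := by
  induction F using Multiset.induction with
  | empty => simp
  | cons A F ih =>
    have hA := h A (Multiset.mem_cons_self _ _)
    have := ih fun C hC => h C (Multiset.mem_cons_of_mem hC)
    simp
    omega

/-- Terms of a sum `U + V` of multisets can be distributed according to any other
decomposition of that sum. -/
theorem exists_split [DecidableEq α] {n : ℕ} (w : Fin n → Multiset α) (U V : Multiset α)
    (h : ∑ i, w i = U + V) :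
    ∃ u v : Fin n → Multiset α, (∀ i, u i + v i = w i) ∧ ∑ i, u i = U ∧ ∑ i, v i = V := by
  induction n generalizing U V with
  | zero =>
    have h' : U + V = 0 := by simpa using h.symm
    obtain ⟨rfl, rfl⟩ := add_eq_zero.1 h'
    exact ⟨w, w, fun i => i.elim0, by simp, by simp⟩
  | succ n ih =>
    rw [Fin.sum_univ_succ] at h
    have hle : w 0 ≤ U + V := h ▸ Multiset.le_add_right _ _
    have hV : w 0 - (U ∩ w 0) ≤ V := by
      rw [Multiset.le_iff_count] at hle ⊢
      intro a
      have := hle a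
      simp only [Multiset.count_add, Multiset.count_sub, Multiset.count_inter] at this ⊢
      omega
    have hU : U ∩ w 0 ≤ U := Multiset.inter_le_left
    have hw : U ∩ w 0 + (w 0 - U ∩ w 0) = w 0 := add_tsub_cancel_of_le Multiset.inter_le_right
    obtain ⟨u, v, huv, hu, hv⟩ := ih (fun i => w i.succ) (U - U ∩ w 0) (V - (w 0 - U ∩ w 0)) (by
      apply add_left_cancel (a := w 0)
      rw [h]
      conv_lhs => rw [← add_tsub_cancel_of_le hU, ← add_tsub_cancel_of_le hV]
      conv_rhs => enter [1]; rw [← hw]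
      exact add_add_add_comm _ _ _ _)
    refine ⟨Fin.cons (U ∩ w 0) u, Fin.cons (w 0 - U ∩ w 0) v, ?_, ?_, ?_⟩
    · intro i
      refine Fin.cases ?_ (fun j => ?_) i
      · simpa using hw
      · simpa using huv j
    · rw [Fin.sum_univ_succ]
      simp [hu, add_tsub_cancel_of_le hU]
    · rw [Fin.sum_univ_succ]
      simp [hv, add_tsub_cancel_of_le hV]

theorem eq_of_mem_of_count_le_one [DecidableEq α] {ι : Type*} [Fintype ι] {u : ι → Multiset α}
    {g : α} (h : Multiset.count g (∑ i, u i) ≤ 1) {i j : ι} (hi : g ∈ u i) (hj : g ∈ u j) :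
    i = j := by
  classical
  by_contra hne
  have h1 := Finset.sum_le_sum_of_subset (f := fun k => Multiset.count g (u k))
    (Finset.subset_univ {i, j})
  rw [Finset.sum_pair hne] at h1
  rw [Multiset.count_sum'] at h
  have := Multiset.one_le_count_iff_mem.2 hi
  have := Multiset.one_le_count_iff_mem.2 hj
  omega

end Multisets

section Lengths

variable {G : Type*} [AddCommGroup G]

/-- Every factorization of `B` into atoms has length `2` or `8`. -/
def LengthsTwoEight (B : Multiset G) : Prop :=
  ∀ F : Multiset (Multiset G), (∀ A ∈ F, IsAtomSeq Set.univ A) → F.sum = B →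
    F.card = 2 ∨ F.card = 8

theorem IsAtomSeq.two_le_card {A : Multiset G} (hA : IsAtomSeq Set.univ A) (h0 : (0 : G) ∉ A) :
    2 ≤ A.card := by
  by_contra! h
  have h1 : A.card = 1 := by
    have := Multiset.card_pos.2 hA.ne_zero
    omega
  obtain ⟨a, rfl⟩ := Multiset.card_eq_one.1 h1
  have := hA.sum_eq_zero
  simp at this h0
  exact h0 this.symm

end Lengths

section TwoEight

variable {G : Type*} [AddCommGroup G]

/-- A sequence over a group of exponent three, all of whose atoms have length at most `11`,
that admits only factorizations of length `2` and `8`, does not contain zero, and has at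
least `16` terms. -/
structure TwoEightSeq (B : Multiset G) : Prop where
  exponent : ∀ g : G, g + g = -g
  card_le : ∀ A : Multiset G, IsAtomSeq Set.univ A → A.card ≤ 11
  lengths : LengthsTwoEight B
  zero_notMem : (0 : G) ∉ B
  le_card : 16 ≤ B.card

namespace TwoEightSeq

variable {B U V : Multiset G}

theorem ne_neg (hB : TwoEightSeq B) {g : G} (hg : g ≠ 0) : g ≠ -g := by
  intro h
  have := hB.exponent g
  rw [← h] at this
  exact hg (by simpa using this)

theorem ne_zero_of_mem (hB : TwoEightSeq B) {g : G} (hg : g ∈ B) : g ≠ 0 := by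
  rintro rfl
  exact hB.zero_notMem hg

theorem neg_notMem (hB : TwoEightSeq B) (hU : IsAtomSeq Set.univ U) (hV : IsAtomSeq Set.univ V)
    (h : U + V = B) {g : G} (hg : g ∈ U) : -g ∉ U := by
  intro hn
  have hg0 := hB.ne_zero_of_mem (h ▸ Multiset.mem_add.2 (.inl hg))
  have h2 := congrArg Multiset.card (hU.pair_eq hg hn (hB.ne_neg hg0))
  have h1 := congrArg Multiset.card h
  have := hB.le_card
  have := hB.card_le V hV
  simp at h1 h2
  omega

theorem not_both_double (hB : TwoEightSeq B) {S T : Multiset G} {g : G}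
    (hU : IsAtomSeq Set.univ (g ::ₘ g ::ₘ T)) (hV : IsAtomSeq Set.univ (-g ::ₘ -g ::ₘ S))
    (h : (g ::ₘ g ::ₘ T) + (-g ::ₘ -g ::ₘ S) = B) : False := by
  have hg0 : g ≠ 0 := hB.ne_zero_of_mem (h ▸ Multiset.mem_add.2 (.inl (by simp)))
  have hU' := hU.merge (hB.exponent g)
  have hV' := hV.merge (hB.exponent (-g))
  rw [neg_neg] at hV'
  have := hB.lengths {{g, -g}, -g ::ₘ T, g ::ₘ S} (by
    intro A hA
    simp only [Multiset.insert_eq_cons, Multiset.mem_cons, Multiset.mem_singleton] at hA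
    rcases hA with rfl | rfl | rfl
    exacts [isAtomSeq_pair_s14 hg0, hU', hV']) (by
    rw [← h]
    simp only [Multiset.insert_eq_cons, Multiset.sum_cons, Multiset.sum_singleton]
    simp only [← Multiset.singleton_add]
    abel)
  simp at this

theorem not_both_two_le_count (hB : TwoEightSeq B) [DecidableEq G] (hU : IsAtomSeq Set.univ U)
    (hV : IsAtomSeq Set.univ V) (h : U + V = B) {g : G} (h1 : 2 ≤ U.count g)
    (h2 : 2 ≤ V.count (-g)) : False := by
  obtain ⟨T, rfl⟩ := Multiset.le_iff_exists_add.1 (Multiset.le_count_iff_replicate_le.1 h1)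
  obtain ⟨S, rfl⟩ := Multiset.le_iff_exists_add.1 (Multiset.le_count_iff_replicate_le.1 h2)
  have e : ∀ (a : G) (R : Multiset G), Multiset.replicate 2 a + R = a ::ₘ a ::ₘ R := by
    intro a R
    simp [Multiset.replicate_succ]
  rw [e] at hU hV
  rw [e, e] at h
  exact hB.not_both_double hU hV h

/-- A doubled term of one atom can be moved to the other atom. -/
theorem transfer (hB : TwoEightSeq B) {S T : Multiset G} {g : G}
    (hU : IsAtomSeq Set.univ (g ::ₘ g ::ₘ T)) (hV : IsAtomSeq Set.univ (-g ::ₘ S))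
    (h : (g ::ₘ g ::ₘ T) + (-g ::ₘ S) = B) :
    IsAtomSeq Set.univ (-g ::ₘ T) ∧ IsAtomSeq Set.univ (g ::ₘ g ::ₘ S) := by
  classical
  have hU' := hU.merge (hB.exponent g)
  refine ⟨hU', ?_⟩
  have hs : (g ::ₘ g ::ₘ S).sum = 0 := by
    have := hV.sum_eq_zero
    simp only [Multiset.sum_cons, ← add_assoc, hB.exponent g] at this ⊢
    exact this
  obtain ⟨F, hF, hFs⟩ := exists_atom_factorization _ hs
  have hlen := hB.lengths ((-g ::ₘ T) ::ₘ F) (by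
    intro A hA
    rcases Multiset.mem_cons.1 hA with rfl | hA
    exacts [hU', hF A hA]) (by
    rw [Multiset.sum_cons, hFs, ← h]
    simp only [← Multiset.singleton_add]
    abel)
  rw [Multiset.card_cons] at hlen
  rcases hlen with hlen | hlen
  · obtain ⟨A, rfl⟩ := Multiset.card_eq_one.1 (show F.card = 1 by omega)
    rw [← hFs]
    simpa using hF
  · exfalso
    have hgS : g ∉ S := fun hg => hB.neg_notMem hV hU (by rw [add_comm, h])
      (Multiset.mem_cons_of_mem hg) (Multiset.mem_cons_self _ _)
    have hmem : ∀ A ∈ F, 1 ≤ Multiset.count g A := by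
      intro A hA
      rw [Multiset.one_le_count_iff_mem]
      by_contra hgA
      have hle : A ≤ g ::ₘ g ::ₘ S :=
        hFs ▸ Multiset.single_le_sum (fun _ _ => Multiset.zero_le _) A hA
      have hle' := (Multiset.le_cons_of_notMem hgA).1 ((Multiset.le_cons_of_notMem hgA).1 hle)
      have := hV.eq_of_le (hle'.trans (Multiset.le_cons_self _ _)) (hF A hA).ne_zero
        (hF A hA).sum_eq_zero
      have hc := Multiset.card_le_card hle'
      simp [this] at hc
    have hcount : Multiset.count g F.sum = 2 := by
      rw [hFs]
      simp [Multiset.count_eq_zero_of_notMem hgS]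
    have hge : F.card ≤ Multiset.count g F.sum := by
      have h1 := Multiset.card_nsmul_le_sum (s := F.map (Multiset.count g)) (a := 1)
        (by simpa using hmem)
      rw [← Multiset.coe_countAddMonoidHom, map_multiset_sum]
      simpa using h1
    omega

theorem card_add_le (hB : TwoEightSeq B) (Q S T : Multiset G)
    (hU : IsAtomSeq Set.univ (Q + Q + T)) (hV : IsAtomSeq Set.univ (Q.map Neg.neg + S))
    (h : (Q + Q + T) + (Q.map Neg.neg + S) = B) : S.card + 2 * Q.card ≤ 11 := by
  induction Q using Multiset.induction generalizing S T with
  | empty => simpa using hB.card_le _ hV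
  | cons g Q ih =>
    have e1 : (g ::ₘ Q) + (g ::ₘ Q) + T = g ::ₘ g ::ₘ (Q + Q + T) := by
      simp only [← Multiset.singleton_add]; abel
    have e2 : (g ::ₘ Q).map Neg.neg + S = -g ::ₘ (Q.map Neg.neg + S) := by
      simp
    rw [e1] at hU h
    rw [e2] at hV h
    obtain ⟨h1, h2⟩ := hB.transfer hU hV h
    have e3 : -g ::ₘ (Q + Q + T) = Q + Q + (-g ::ₘ T) := by simp
    have e4 : g ::ₘ g ::ₘ (Q.map Neg.neg + S) = Q.map Neg.neg + (g ::ₘ g ::ₘ S) := by simp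
    have := ih (g ::ₘ g ::ₘ S) (-g ::ₘ T) (e3 ▸ h1) (e4 ▸ h2) (by
      rw [← h, ← e3, ← e4]
      simp only [← Multiset.singleton_add]
      abel)
    simp at this ⊢
    omega

theorem card_add_card_doubled_le (hB : TwoEightSeq B) [DecidableEq G]
    (hU : IsAtomSeq Set.univ U) (hV : IsAtomSeq Set.univ V) (h : U + V = B) (Q : Finset G)
    (hQU : ∀ g ∈ Q, 2 ≤ U.count g) (hQV : ∀ g ∈ Q, -g ∈ V) : V.card + Q.card ≤ 11 := by
  have h1 : Q.val + Q.val ≤ U := by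
    rw [Multiset.le_iff_count]
    intro a
    rw [Multiset.count_add]
    by_cases ha : a ∈ Q
    · have := hQU a ha
      have := Multiset.nodup_iff_count_le_one.1 Q.nodup a
      omega
    · simp [Multiset.count_eq_zero_of_notMem (s := Q.val) ha]
  have h2 : Q.val.map Neg.neg ≤ V := by
    rw [Multiset.le_iff_subset (Q.nodup.map neg_injective)]
    intro a ha
    obtain ⟨g, hg, rfl⟩ := Multiset.mem_map.1 ha
    exact hQV g hg
  obtain ⟨T, rfl⟩ := Multiset.le_iff_exists_add.1 h1
  obtain ⟨S, rfl⟩ := Multiset.le_iff_exists_add.1 h2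
  have := hB.card_add_le _ S T hU hV h
  simp at this ⊢
  omega

/-- Some factorization of length `8` contains `{g, -g}` for all `g` such that `g` is a simple
term of `U` and `-g` is a simple term of `V`. -/
theorem exists_canonical (hB : TwoEightSeq B) [DecidableEq G] (hU : IsAtomSeq Set.univ U)
    (hV : IsAtomSeq Set.univ V) (h : U + V = B) {W : Multiset (Multiset G)} (hW8 : W.card = 8)
    (hW : ∀ A ∈ W, IsAtomSeq Set.univ A) (hWs : W.sum = B) :
    ∃ F : Multiset (Multiset G), F.card = 8 ∧ (∀ A ∈ F, IsAtomSeq Set.univ A) ∧ F.sum = B ∧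
      ∀ g, U.count g = 1 → V.count (-g) = 1 → ({g, -g} : Multiset G) ∈ F := by
  let N := U.toFinset.filter fun g => U.count g = 1 ∧ V.count (-g) = 1
  have hN : ∀ {g}, g ∈ N ↔ U.count g = 1 ∧ V.count (-g) = 1 := by
    intro g
    simp only [N, Finset.mem_filter, Multiset.mem_toFinset, and_iff_right_iff_imp]
    rintro ⟨h1, -⟩
    exact Multiset.count_pos.1 (by omega)
  rcases N.eq_empty_or_nonempty with h0 | ⟨a, ha⟩
  · refine ⟨W, hW8, hW, hWs, fun g h1 h2 => ?_⟩
    have := hN.2 ⟨h1, h2⟩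
    simp [h0] at this
  have h1 : N.val ≤ U := by
    rw [Multiset.le_iff_subset N.nodup]
    intro g hg
    exact Multiset.count_pos.1 (by have := (hN.1 hg).1; omega)
  have h2 : N.val.map Neg.neg ≤ V := by
    rw [Multiset.le_iff_subset (N.nodup.map neg_injective)]
    intro b hb
    obtain ⟨g, hg, rfl⟩ := Multiset.mem_map.1 hb
    exact Multiset.count_pos.1 (by have := (hN.1 hg).2; omega)
  have hpairs : (N.val.map fun g => ({g, -g} : Multiset G)).sum = N.val + N.val.map Neg.neg := by
    have : ∀ g : G, ({g, -g} : Multiset G) = {g} + {-g} := fun g => by simp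
    simp only [this]
    rw [Multiset.sum_map_add, Multiset.sum_map_singleton]
    congr 1
    rw [← Multiset.sum_map_singleton (N.val.map Neg.neg), Multiset.map_map]
    rfl
  obtain ⟨R, hR⟩ := Multiset.le_iff_exists_add.1 (add_le_add h1 h2)
  rw [h, ← hpairs] at hR
  have hBs : B.sum = 0 := by rw [← h, Multiset.sum_add, hU.sum_eq_zero, hV.sum_eq_zero, add_zero]
  have hRs : R.sum = 0 := by
    have := congrArg Multiset.sum hR
    have hneg : (N.val.map Neg.neg).sum = -N.val.sum :=
      (map_multiset_sum (negAddMonoidHom (α := G)) N.val).symm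
    rw [Multiset.sum_add, hpairs, hBs, Multiset.sum_add, hneg, add_neg_cancel, zero_add] at this
    exact this.symm
  obtain ⟨F, hF, hFs⟩ := exists_atom_factorization R hRs
  have hall : ∀ A ∈ (N.val.map fun g => ({g, -g} : Multiset G)) + F, IsAtomSeq Set.univ A := by
    intro A hA
    rcases Multiset.mem_add.1 hA with hA | hA
    · obtain ⟨g, hg, rfl⟩ := Multiset.mem_map.1 hA
      exact isAtomSeq_pair_s14 (hB.ne_zero_of_mem (h ▸ Multiset.mem_add.2
        (.inl (Multiset.mem_of_le h1 hg))))
    · exact hF A hA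
  have hsum : ((N.val.map fun g => ({g, -g} : Multiset G)) + F).sum = B := by
    rw [Multiset.sum_add, hFs, hR]
  refine ⟨_, ?_, hall, hsum, fun g h1 h2 =>
    Multiset.mem_add.2 (.inl (Multiset.mem_map.2 ⟨g, hN.2 ⟨h1, h2⟩, rfl⟩))⟩
  refine (hB.lengths _ hall hsum).resolve_left fun hc => ?_
  obtain ⟨F', hF'⟩ := Multiset.exists_cons_of_mem (Multiset.mem_add.2
    (.inl (Multiset.mem_map_of_mem (fun g => ({g, -g} : Multiset G)) ha)) :
      _ ∈ (N.val.map fun g => ({g, -g} : Multiset G)) + F)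
  rw [hF'] at hc hall hsum
  obtain ⟨A, rfl⟩ := Multiset.card_eq_one.1 (show F'.card = 1 by simpa using hc)
  have h3 := hB.card_le A (hall A (by simp))
  have h4 := hB.le_card
  have h5 := congrArg Multiset.card hsum
  simp at h5
  omega

/-- Every factorization of length `8` contains an atom `{g, -g}` whose terms are simple in
`U` and `V`. -/
theorem exists_simple_pair (hB : TwoEightSeq B) [DecidableEq G] (hU : IsAtomSeq Set.univ U)
    (hV : IsAtomSeq Set.univ V) (h : U + V = B) {F : Multiset (Multiset G)} (hF8 : F.card = 8)
    (hF : ∀ A ∈ F, IsAtomSeq Set.univ A) (hFs : F.sum = B) :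
    ∃ g, U.count g = 1 ∧ V.count (-g) = 1 ∧ ({g, -g} : Multiset G) ∈ F := by
  by_contra! hno
  have h' : V + U = B := by rw [add_comm, h]
  let Q₁ := U.toFinset.filter fun g => 2 ≤ U.count g ∧ -g ∈ V
  let Q₂ := V.toFinset.filter fun g => 2 ≤ V.count g ∧ -g ∈ U
  have hQ₁ : V.card + Q₁.card ≤ 11 := hB.card_add_card_doubled_le hU hV h Q₁
    (fun g hg => (Finset.mem_filter.1 hg).2.1) (fun g hg => (Finset.mem_filter.1 hg).2.2)
  have hQ₂ : U.card + Q₂.card ≤ 11 := hB.card_add_card_doubled_le hV hU h' Q₂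
    (fun g hg => (Finset.mem_filter.1 hg).2.1) (fun g hg => (Finset.mem_filter.1 hg).2.2)
  have hle : ∀ A ∈ F, A ≤ B := fun A hA =>
    hFs ▸ Multiset.single_le_sum (fun _ _ => Multiset.zero_le _) A hA
  have hcross : ∀ A ∈ F, A.card = 2 → ∃ g ∈ U, -g ∈ V ∧ A = {g, -g} := by
    intro A hA hA2
    obtain ⟨a, b, rfl⟩ := Multiset.card_eq_two.1 hA2
    have hb : b = -a := by
      have := (hF _ hA).sum_eq_zero
      simp at this
      exact (neg_eq_of_add_eq_zero_right this).symm
    subst hb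
    have ha : a ∈ U + V := h ▸ Multiset.mem_of_le (hle _ hA) (by simp)
    have hb : -a ∈ U + V := h ▸ Multiset.mem_of_le (hle _ hA) (by simp)
    rcases Multiset.mem_add.1 ha with ha | ha <;> rcases Multiset.mem_add.1 hb with hb | hb
    · exact absurd hb (hB.neg_notMem hU hV h ha)
    · exact ⟨a, ha, hb, rfl⟩
    · exact ⟨-a, hb, by simpa using ha, by rw [neg_neg, Multiset.pair_comm]⟩
    · exact absurd hb (hB.neg_notMem hV hU h' ha)
  have hnodup : (F.filter fun A => A.card = 2).Nodup := by
    rw [Multiset.nodup_iff_count_le_one]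
    intro A
    by_contra! hlt
    have hmem := Multiset.mem_filter.1 (Multiset.count_pos.1 (by omega) :
      A ∈ F.filter fun A => A.card = 2)
    obtain ⟨g, hgU, hgV, rfl⟩ := hcross A hmem.1 hmem.2
    have hrep := (Multiset.le_count_iff_replicate_le.1 hlt).trans (Multiset.filter_le _ _)
    obtain ⟨R, hR⟩ := Multiset.le_iff_exists_add.1 hrep
    have hBle : ({g, -g} : Multiset G) + {g, -g} ≤ B := by
      rw [← hFs, hR, Multiset.sum_add, Multiset.sum_replicate, two_nsmul]
      exact Multiset.le_add_right _ _
    have hgV' : g ∉ V := fun hg => hB.neg_notMem hV hU h' hg hgV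
    have hgU' : -g ∉ U := hB.neg_notMem hU hV h hgU
    have c1 := Multiset.le_iff_count.1 hBle g
    have c2 := Multiset.le_iff_count.1 hBle (-g)
    have d1 : 1 ≤ Multiset.count g {g, -g} := Multiset.one_le_count_iff_mem.2 (by simp)
    have d2 : 1 ≤ Multiset.count (-g) {g, -g} := Multiset.one_le_count_iff_mem.2 (by simp)
    rw [← h, Multiset.count_add, Multiset.count_add] at c1 c2
    rw [Multiset.count_eq_zero_of_notMem hgV'] at c1
    rw [Multiset.count_eq_zero_of_notMem hgU'] at c2
    exact hB.not_both_two_le_count hU hV h (g := g) (by omega) (by omega)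
  have hsub : (F.filter fun A => A.card = 2).toFinset ⊆
      Q₁.image (fun g => ({g, -g} : Multiset G)) ∪ Q₂.image (fun g => {g, -g}) := by
    intro A hA
    rw [Multiset.mem_toFinset, Multiset.mem_filter] at hA
    obtain ⟨g, hgU, hgV, rfl⟩ := hcross A hA.1 hA.2
    have p1 := Multiset.count_pos.2 hgU
    have p2 := Multiset.count_pos.2 hgV
    rw [Finset.mem_union, Finset.mem_image, Finset.mem_image]
    by_cases h1 : 2 ≤ U.count g
    · exact .inl ⟨g, by simp [Q₁, hgU, hgV, h1], rfl⟩
    by_cases h2 : 2 ≤ V.count (-g)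
    · exact .inr ⟨-g, by simp [Q₂, hgU, hgV, h2], by rw [neg_neg, Multiset.pair_comm]⟩
    exact absurd hA.1 (hno g (by omega) (by omega))
  have hcard := Finset.card_le_card hsub
  rw [Multiset.toFinset_card_of_nodup hnodup] at hcard
  have h1 := hcard.trans ((Finset.card_union_le _ _).trans
    (add_le_add Finset.card_image_le Finset.card_image_le))
  have h2 := three_mul_card_le fun A hA => (hF A hA).two_le_card
    fun h0 => hB.zero_notMem (Multiset.mem_of_le (hle A hA) h0)
  have h3 := congrArg Multiset.card h
  rw [hFs, hF8] at h2
  simp at h3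
  omega

theorem left_ne_zero {n : ℕ} (hn : n ≠ 2) {u v : Fin n → Multiset G}
    (hU : IsAtomSeq Set.univ (∑ i, u i)) (hV : IsAtomSeq Set.univ (∑ i, v i))
    (h : ∀ i, IsAtomSeq Set.univ (u i + v i)) (i : Fin n) : u i ≠ 0 := by
  classical
  intro h0
  have hi := h i
  rw [h0, zero_add] at hi
  have hvi : v i = ∑ j, v j := hV.eq_of_le
    (Finset.single_le_sum (fun _ _ => Multiset.zero_le _) (Finset.mem_univ i)) hi.ne_zero
    hi.sum_eq_zero
  have hv0 : ∑ j ∈ Finset.univ.erase i, v j = 0 := by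
    rw [← Finset.add_sum_erase _ _ (Finset.mem_univ i)] at hvi
    simpa using hvi
  have hu : ∑ j ∈ Finset.univ.erase i, (u j + v j) = ∑ j, u j := by
    rw [Finset.sum_add_distrib, hv0, add_zero, ← Finset.add_sum_erase _ u (Finset.mem_univ i),
      h0, zero_add]
  have := IsAtomSeq.card_factorization_eq_one
    (F := (Finset.univ.erase i).val.map fun j => u j + v j) (by rw [← hu] at hU; exact hU)
    (by
      intro A hA
      obtain ⟨j, -, rfl⟩ := Multiset.mem_map.1 hA
      exact h j)
  simp at this
  omega

end TwoEightSeq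

theorem sum_fiber_eq_sum_fiber_add_one {ι M : Type*} [Fintype ι] [AddCommGroup M]
    [Module (ZMod 3) M] (x : ι → ZMod 3) (e : ι → M) (h1 : ∑ i, e i = 0)
    (hx : ∑ i, x i • e i = 0) (a : ZMod 3) :
    ∑ i with x i = a, e i = ∑ i with x i = a + 1, e i := by
  have key : ∀ y a : ZMod 3, (if y = a then 1 else 0) - (if y = a + 1 then 1 else 0) =
      (1 - a) + y := by decide
  rw [← sub_eq_zero, Finset.sum_filter, Finset.sum_filter, ← Finset.sum_sub_distrib]
  calc ∑ i, ((if x i = a then e i else 0) - if x i = a + 1 then e i else 0)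
      = ∑ i, ((1 - a) • e i + x i • e i) := by
        refine Finset.sum_congr rfl fun i _ => ?_
        rw [← add_smul, ← key (x i) a, sub_smul, ite_smul, ite_smul, one_smul, zero_smul]
    _ = 0 := by rw [Finset.sum_add_distrib, ← Finset.smul_sum, h1, hx]; simp

theorem exists_relation (e : Fin 8 → Fin 5 → ZMod 3) :
    ∃ x : Fin 8 → ZMod 3, x 0 = 0 ∧ x ≠ 0 ∧ ∑ i, x i • e i = 0 := by
  let f : (Fin 8 → ZMod 3) →ₗ[ZMod 3] (Fin 5 → ZMod 3) × ZMod 3 :=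
    (Fintype.linearCombination (ZMod 3) e).prod (LinearMap.proj 0)
  have hf : LinearMap.ker f ≠ ⊥ := LinearMap.ker_ne_bot_of_finrank_lt (by simp)
  obtain ⟨x, hx, hx0⟩ := (Submodule.ne_bot_iff _).1 hf
  have hx' : ∑ i, x i • e i = 0 ∧ x 0 = 0 := by
    simpa [f, Fintype.linearCombination_apply] using hx
  exact ⟨x, hx'.2, hx0, hx'.1⟩

theorem TwoEightSeq.false_of_factorizations {B U V : Multiset (Fin 5 → ZMod 3)}
    (hB : TwoEightSeq B) (hU : IsAtomSeq Set.univ U) (hV : IsAtomSeq Set.univ V)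
    (h : U + V = B) {W : Multiset (Multiset (Fin 5 → ZMod 3))} (hW8 : W.card = 8)
    (hW : ∀ A ∈ W, IsAtomSeq Set.univ A) (hWs : W.sum = B) : False := by
  obtain ⟨F, hF8, hF, hFs, hpair⟩ := hB.exists_canonical hU hV h hW8 hW hWs
  obtain ⟨w, rfl⟩ : ∃ w : Fin 8 → Multiset (Fin 5 → ZMod 3), F = Finset.univ.val.map w := by
    induction F using Quotient.inductionOn with
    | h l =>
      have hl : l.length = 8 := hF8
      refine ⟨fun i => l.get (i.cast hl.symm), ?_⟩
      rw [Fin.univ_val_map]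
      congr 1
      exact (List.ofFn_get l).symm.trans (List.ofFn_congr hl _)
  obtain ⟨u, v, huv, rfl, rfl⟩ := exists_split w U V (hFs.trans h.symm)
  have hat : ∀ i, IsAtomSeq Set.univ (u i + v i) := fun i =>
    huv i ▸ hF _ (Multiset.mem_map_of_mem w (Finset.mem_univ i))
  have hu0 : ∀ i, u i ≠ 0 := TwoEightSeq.left_ne_zero (by norm_num) hU hV hat
  obtain ⟨x, hx0, hx, hrel⟩ := exists_relation fun i => (u i).sum
  have husum : ∑ i, (u i).sum = 0 := by
    rw [← hU.sum_eq_zero]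
    exact (map_sum Multiset.sumAddMonoidHom u _).symm
  have hvneg : ∀ i, (v i).sum = -(u i).sum := fun i => by
    have := (hat i).sum_eq_zero
    rw [Multiset.sum_add] at this
    exact (neg_eq_of_add_eq_zero_right this).symm
  let P : ZMod 3 → Multiset (Fin 5 → ZMod 3) := fun a =>
    (∑ i with x i = a, u i) + ∑ i with x i = a + 1, v i
  have hP : ∀ a, (P a).sum = 0 := by
    intro a
    have h1 := map_sum (Multiset.sumAddMonoidHom : Multiset (Fin 5 → ZMod 3) →+ _) u
      (Finset.univ.filter fun i => x i = a)
    have h2 := map_sum (Multiset.sumAddMonoidHom : Multiset (Fin 5 → ZMod 3) →+ _) v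
      (Finset.univ.filter fun i => x i = a + 1)
    simp only [Multiset.coe_sumAddMonoidHom] at h1 h2
    rw [Multiset.sum_add, h1, h2, sum_fiber_eq_sum_fiber_add_one x _ husum hrel a]
    simp [hvneg]
  have hv0 : ∀ i, v i ≠ 0 := TwoEightSeq.left_ne_zero (by norm_num) hV hU
    (fun i => by rw [add_comm]; exact hat i)
  have hPu : ∀ i, P (x i) ≠ 0 := by
    intro i h0
    have : u i ≤ P (x i) := (Finset.single_le_sum (f := u) (fun _ _ => Multiset.zero_le _)
      (by simp)).trans (Multiset.le_add_right _ _)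
    exact hu0 i (Multiset.le_zero.1 (h0 ▸ this))
  have hPv : ∀ i, P (x i - 1) ≠ 0 := by
    intro i h0
    have : v i ≤ P (x i - 1) := (Finset.single_le_sum (f := v) (fun _ _ => Multiset.zero_le _)
      (by simp)).trans (Multiset.le_add_left _ _)
    exact hv0 i (Multiset.le_zero.1 (h0 ▸ this))
  have hP0 : ∀ a, P a ≠ 0 := by
    obtain ⟨i, hi⟩ := Function.ne_iff.1 hx
    have q1 := hPu 0
    have q2 := hPv 0
    have q3 := hPu i
    have q4 := hPv i
    rw [hx0] at q1 q2
    have : ∀ y a : ZMod 3, y ≠ 0 → a = 0 ∨ a = 0 - 1 ∨ a = y ∨ a = y - 1 := by decide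
    intro a
    rcases this (x i) a hi with rfl | rfl | rfl | rfl <;> assumption
  choose E hE hEs using fun a => exists_atom_factorization (P a) (hP a)
  have hEmem : ∀ A ∈ ∑ a, E a, IsAtomSeq Set.univ A := by
    intro A hA
    obtain ⟨a, -, ha⟩ := Multiset.mem_sum.1 hA
    exact hE a A ha
  have hEsum : (∑ a, E a).sum = B := by
    have h1 := map_sum (Multiset.sumAddMonoidHom : Multiset (Multiset (Fin 5 → ZMod 3)) →+ _) E Finset.univ
    simp only [Multiset.coe_sumAddMonoidHom, hEs] at h1
    rw [h1, ← h]
    simp only [P]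
    have hshift : ∑ a, ∑ i with x i = a + 1, v i = ∑ i, v i :=
      (Equiv.sum_comp (Equiv.addRight (1 : ZMod 3)) fun a => ∑ i with x i = a, v i).trans
        (Finset.sum_fiberwise _ _ _)
    rw [Finset.sum_add_distrib, Finset.sum_fiberwise, hshift]
  have hE8 : (∑ a, E a).card = 8 := by
    refine (hB.lengths _ hEmem hEsum).resolve_left fun h2 => ?_
    have hpos : ∀ a, 1 ≤ (E a).card := by
      intro a
      refine Multiset.card_pos.2 fun h0 => hP0 a ?_
      rw [← hEs a, h0, Multiset.sum_zero]
    have := Finset.card_nsmul_le_sum Finset.univ (fun a => (E a).card) 1 fun a _ => hpos a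
    rw [Multiset.card_sum] at h2
    simp [ZMod.card] at this
    omega
  obtain ⟨g, hg1, hg2, hgE⟩ := hB.exists_simple_pair hU hV h hE8 hEmem hEsum
  obtain ⟨k, -, hk⟩ := Multiset.mem_map.1 (hpair g hg1 hg2)
  obtain ⟨a, -, ha⟩ := Multiset.mem_sum.1 hgE
  have hle : ({g, -g} : Multiset _) ≤ P a :=
    hEs a ▸ Multiset.single_le_sum (fun _ _ => Multiset.zero_le _) _ ha
  have hgU : g ∈ ∑ i, u i := Multiset.count_pos.1 (by omega)
  have hgV : -g ∈ ∑ i, v i := Multiset.count_pos.1 (by omega)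
  have hgV' : ∀ i, g ∉ v i := fun i hi => hB.neg_notMem hV hU (by rw [add_comm, h])
    (Multiset.mem_sum.2 ⟨i, Finset.mem_univ i, hi⟩) hgV
  have hgU' : ∀ i, -g ∉ u i := fun i hi => hB.neg_notMem hU hV h hgU
    (Multiset.mem_sum.2 ⟨i, Finset.mem_univ i, hi⟩)
  have huk : g ∈ u k := by
    have : g ∈ u k + v k := by rw [huv, hk]; simp
    exact (Multiset.mem_add.1 this).resolve_right (hgV' k)
  have hvk : -g ∈ v k := by
    have : -g ∈ u k + v k := by rw [huv, hk]; simp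
    exact (Multiset.mem_add.1 this).resolve_left (hgU' k)
  obtain ⟨i, hia, hi⟩ : ∃ i, x i = a ∧ g ∈ u i := by
    rcases Multiset.mem_add.1 (Multiset.mem_of_le hle (by simp : g ∈ _)) with hm | hm
    · obtain ⟨i, hi, hm⟩ := Multiset.mem_sum.1 hm
      exact ⟨i, by simpa using hi, hm⟩
    · obtain ⟨i, -, hm⟩ := Multiset.mem_sum.1 hm
      exact absurd hm (hgV' i)
  obtain ⟨j, hja, hj⟩ : ∃ j, x j = a + 1 ∧ -g ∈ v j := by
    rcases Multiset.mem_add.1 (Multiset.mem_of_le hle (by simp : -g ∈ _)) with hm | hm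
    · obtain ⟨i, -, hm⟩ := Multiset.mem_sum.1 hm
      exact absurd hm (hgU' i)
    · obtain ⟨i, hi, hm⟩ := Multiset.mem_sum.1 hm
      exact ⟨i, by simpa using hi, hm⟩
  have hik := eq_of_mem_of_count_le_one hg1.le hi huk
  have hjk := eq_of_mem_of_count_le_one hg2.le hj hvk
  rw [hik] at hia
  rw [hjk, hia] at hja
  simp at hja

end TwoEight

theorem stmt_14 :
    ∀ B : Multiset (Fin 5 → ZMod 3), B.sum = 0 →
      LengthSet Set.univ B ≠ {2, 8} := by
  classical
  intro B _ hL
  have hlen : LengthsTwoEight B := fun F hF hFs => by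
    have : F.card ∈ LengthSet Set.univ B := ⟨F, rfl, hF, hFs⟩
    simpa [hL] using this
  obtain ⟨F, hF2, hF, hFs⟩ : 2 ∈ LengthSet Set.univ B := by simp [hL]
  obtain ⟨W, hW8, hW, hWs⟩ : 8 ∈ LengthSet Set.univ B := by simp [hL]
  obtain ⟨U, V, rfl⟩ := Multiset.card_eq_two.1 hF2
  have hUV : U + V = B := by simpa using hFs
  have hU := hF U (by simp)
  have hV := hF V (by simp)
  have hzero : (0 : Fin 5 → ZMod 3) ∉ B := by
    intro h0
    have h0W : ({0} : Multiset (Fin 5 → ZMod 3)) ∈ W := by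
      obtain ⟨A, hA, h0A⟩ := Multiset.mem_join.1 (show 0 ∈ W.sum by rwa [hWs])
      rwa [(hW A hA).eq_of_le (Multiset.singleton_le.2 h0A) (by simp) (by simp)]
    obtain ⟨W', rfl⟩ := Multiset.exists_cons_of_mem h0W
    have key : ∀ X Y : Multiset (Fin 5 → ZMod 3), IsAtomSeq Set.univ X → IsAtomSeq Set.univ Y →
        X + Y = B → 0 ∈ X → False := by
      intro X Y hX hY hXY h0X
      have hX0 := hX.eq_of_le (Multiset.singleton_le.2 h0X) (by simp) (by simp)
      rw [← hXY, ← hX0, Multiset.sum_cons] at hWs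
      rw [← add_left_cancel hWs] at hY
      have := hY.card_factorization_eq_one fun A hA => hW A (Multiset.mem_cons_of_mem hA)
      simp [this] at hW8
    rcases Multiset.mem_add.1 (hUV ▸ h0) with h | h
    · exact key U V hU hV hUV h
    · exact key V U hV hU (by rw [add_comm, hUV]) h
  have h16 := two_mul_card_le fun A hA => (hW A hA).two_le_card fun h0 =>
    hzero (hWs ▸ Multiset.mem_of_le
      (Multiset.single_le_sum (fun _ _ => Multiset.zero_le _) A hA) h0)
  rw [hW8, hWs] at h16
  have hB : TwoEightSeq B :=
    { exponent := fun g => by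
        funext i
        have : ∀ y : ZMod 3, y + y = -y := by decide
        exact this (g i)
      card_le := fun A hA => hA.card_le
      lengths := hlen
      zero_notMem := hzero
      le_card := h16 }
  exact hB.false_of_factorizations hU hV hUV hW8 hW hWs
end

section
/- Suppose G and G' are finite abelian groups with L(G) = L(G'), G has exponent n and rank r with 2 ≤ r ≤ (n−2)/4. Then exp(G') = n and exp(G') > r(G') + 1. -/
/-- Minimal zero-sum sequences over the whole group. -/
def IsMinZeroSum {G : Type*} [AddCommGroup G] (A : Multiset G) : Prop :=
  A.sum = 0 ∧ A ≠ 0 ∧ ∀ B ≤ A, B ≠ 0 → B.sum = 0 → B = A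

/-- The lengths of the factorizations of `B` into minimal zero-sum sequences. -/
def factLengths {G : Type*} [AddCommGroup G] (B : Multiset G) : Set ℕ :=
  {k | ∃ F : Multiset (Multiset G), F.card = k ∧ (∀ A ∈ F, IsMinZeroSum A) ∧ F.sum = B}

/-- The cross number of a sequence, multiplied by the exponent of the group. -/
noncomputable def crossWeight {G : Type*} [AddCommGroup G] (S : Multiset G) : ℕ :=
  (S.map fun g => AddMonoid.exponent G / addOrderOf g).sum

/-- All factorization lengths of a zero-sum sequence over `G₀` agree modulo `d`. -/
def LengthsCongr {G : Type*} [AddCommGroup G] (d : ℕ) (G₀ : Finset G) : Prop :=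
  ∀ B : Multiset G, B.sum = 0 → (∀ g ∈ B, g ∈ G₀) →
    ∀ a ∈ factLengths B, ∀ b ∈ factLengths B, a ≡ b [MOD d]

/-- There are sets of lengths of arbitrarily large diameter that lie in one class modulo `d`. -/
def HasLongLengths (G : Type*) [AddCommGroup G] (d : ℕ) : Prop :=
  ∀ N : ℕ, ∃ L ∈ SystemSets G, (∀ a ∈ L, ∀ b ∈ L, a ≡ b [MOD d]) ∧
    ∃ a ∈ L, ∃ b ∈ L, a + N ≤ b

lemma LengthsCongr.mono {G : Type*} [AddCommGroup G] {d : ℕ} {G₀ G₁ : Finset G}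
    (h : LengthsCongr d G₁) (hs : G₀ ⊆ G₁) :
    LengthsCongr d G₀ :=
  fun B hB hg => h B hB fun g hgB => hs (hg g hgB)

lemma mem_of_mem_factorization {G : Type*} {G₀ : Finset G} {F : Multiset (Multiset G)}
    {A : Multiset G}
    (hF : ∀ g ∈ F.sum, g ∈ G₀) (hA : A ∈ F) : ∀ g ∈ A, g ∈ G₀ :=
  fun g hg => hF g (Multiset.mem_of_le (Multiset.le_sum_of_mem hA) hg)

section Factorizations

variable {G : Type*} [AddCommGroup G]

lemma lengthSet_univ (B : Multiset G) : LengthSet Set.univ B = factLengths B := by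
  simp [LengthSet, factLengths, IsAtomSeq, IsZeroSumSeq, IsMinZeroSum]

lemma sum_eq_zero_of_factorization {F : Multiset (Multiset G)}
    (hF : ∀ A ∈ F, IsMinZeroSum A) : F.sum.sum = 0 := by
  induction F using Multiset.induction with
  | empty => simp
  | cons A F ih =>
    simp only [Multiset.sum_cons, Multiset.sum_add]
    rw [(hF A (by simp)).1, ih fun B hB => hF B (by simp [hB]), add_zero]

lemma IsMinZeroSum.one_mem_factLengths {A : Multiset G} (hA : IsMinZeroSum A) :
    1 ∈ factLengths A :=
  ⟨{A}, by simp, by simpa using hA, by simp⟩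

lemma zero_mem_factLengths_zero : 0 ∈ factLengths (0 : Multiset G) :=
  ⟨0, by simp, by simp, by simp⟩

lemma add_mem_factLengths {A B : Multiset G} {a b : ℕ} (ha : a ∈ factLengths A)
    (hb : b ∈ factLengths B) : a + b ∈ factLengths (A + B) := by
  obtain ⟨F, rfl, hF, rfl⟩ := ha
  obtain ⟨E, rfl, hE, rfl⟩ := hb
  refine ⟨F + E, by simp, fun A hA => ?_, by simp⟩
  rcases Multiset.mem_add.1 hA with h | h
  exacts [hF A h, hE A h]

lemma mul_mem_factLengths_nsmul {A : Multiset G} {a : ℕ} (ha : a ∈ factLengths A) (k : ℕ) :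
    k * a ∈ factLengths (k • A) := by
  induction k with
  | zero => simpa using zero_mem_factLengths_zero
  | succ k ih => rw [succ_nsmul, Nat.succ_mul]; exact add_mem_factLengths ih ha

lemma IsMinZeroSum.mem_factLengths_nsmul {A : Multiset G} (hA : IsMinZeroSum A) (k : ℕ) :
    k ∈ factLengths (k • A) := by
  simpa using mul_mem_factLengths_nsmul hA.one_mem_factLengths k

lemma exists_isMinZeroSum_le {B : Multiset G} (hB : B.sum = 0) (h0 : B ≠ 0) :
    ∃ A ≤ B, IsMinZeroSum A := by
  induction B using Multiset.strongInductionOn with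
  | ih B ih =>
    by_cases h : ∀ C ≤ B, C ≠ 0 → C.sum = 0 → C = B
    · exact ⟨B, le_rfl, hB, h0, h⟩
    · push Not at h
      obtain ⟨C, hCB, hC0, hC, hne⟩ := h
      obtain ⟨A, hA, hA'⟩ := ih C (lt_of_le_of_ne hCB hne) hC hC0
      exact ⟨A, hA.trans hCB, hA'⟩

lemma exists_mem_factLengths {B : Multiset G} (hB : B.sum = 0) : ∃ l, l ∈ factLengths B := by
  induction B using Multiset.strongInductionOn with
  | ih B ih =>
    by_cases h0 : B = 0
    · exact ⟨0, h0 ▸ zero_mem_factLengths_zero⟩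
    · obtain ⟨A, hAB, hA⟩ := exists_isMinZeroSum_le hB h0
      obtain ⟨X, rfl⟩ := Multiset.le_iff_exists_add.1 hAB
      have hX : X.sum = 0 := by simpa [hA.1] using hB
      obtain ⟨l, hl⟩ := ih X (by
        rw [add_comm]; exact lt_add_of_pos_right _ (pos_iff_ne_zero.2 hA.2.1)) hX
      exact ⟨1 + l, add_mem_factLengths hA.one_mem_factLengths hl⟩

lemma eq_zero_of_mem_factLengths_zero {l : ℕ} (h : l ∈ factLengths (0 : Multiset G)) :
    l = 0 := by
  obtain ⟨F, rfl, hF, h0⟩ := h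
  rw [Multiset.card_eq_zero]
  by_contra hne
  obtain ⟨A, hA⟩ := Multiset.exists_mem_of_ne_zero hne
  have : A ≤ 0 := h0 ▸ Multiset.le_sum_of_mem hA
  exact (hF A hA).2.1 (by simpa using this)

lemma IsMinZeroSum.eq_one_of_mem_factLengths {A : Multiset G} (hA : IsMinZeroSum A) {l : ℕ}
    (h : l ∈ factLengths A) : l = 1 := by
  obtain ⟨F, rfl, hF, h0⟩ := h
  have hne : F ≠ 0 := by rintro rfl; exact hA.2.1 (by simpa using h0.symm)
  obtain ⟨C, hC⟩ := Multiset.exists_mem_of_ne_zero hne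
  obtain ⟨F', rfl⟩ := Multiset.exists_cons_of_mem hC
  have hCA : C = A := hA.2.2 C (h0 ▸ Multiset.le_sum_of_mem hC) (hF C hC).2.1 (hF C hC).1
  rw [Multiset.sum_cons, hCA] at h0
  have h0' : F'.sum = 0 := by simpa using h0
  have : F'.card = 0 := eq_zero_of_mem_factLengths_zero
    ⟨F', rfl, fun B hB => hF B (by simp [hB]), h0'⟩
  simp [this]

lemma pos_of_mem_factLengths {B : Multiset G} (hB : B ≠ 0) {l : ℕ} (h : l ∈ factLengths B) :
    0 < l := by
  obtain ⟨F, rfl, hF, rfl⟩ := h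
  rw [Multiset.card_pos]
  rintro rfl
  simp at hB

lemma crossWeight_add (S T : Multiset G) :
    crossWeight (S + T) = crossWeight S + crossWeight T := by
  simp [crossWeight]

lemma crossWeight_zero : crossWeight (0 : Multiset G) = 0 := by simp [crossWeight]

lemma crossWeight_nsmul (k : ℕ) (S : Multiset G) :
    crossWeight (k • S) = k * crossWeight S := by
  simp [crossWeight, Multiset.map_nsmul, Multiset.sum_nsmul]

lemma crossWeight_sum (F : Multiset (Multiset G)) :
    crossWeight F.sum = (F.map crossWeight).sum := by
  induction F using Multiset.induction with
  | empty => simp [crossWeight_zero]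
  | cons A F ih => simp [crossWeight_add, ih]

lemma card_mul_le_crossWeight {F : Multiset (Multiset G)} {m : ℕ}
    (h : ∀ A ∈ F, m ≤ crossWeight A) : F.card * m ≤ crossWeight F.sum := by
  rw [crossWeight_sum]
  simpa using Multiset.card_nsmul_le_sum (s := F.map crossWeight) (a := m) (by simpa using h)

lemma crossWeight_le_card_mul {F : Multiset (Multiset G)} {m : ℕ}
    (h : ∀ A ∈ F, crossWeight A ≤ m) : crossWeight F.sum ≤ F.card * m := by
  rw [crossWeight_sum]
  simpa using Multiset.sum_le_card_nsmul (F.map crossWeight) m (by simpa using h)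

lemma crossWeight_eq_card_mul {F : Multiset (Multiset G)} {m : ℕ}
    (h : ∀ A ∈ F, crossWeight A = m) : crossWeight F.sum = F.card * m :=
  le_antisymm (crossWeight_le_card_mul fun A hA => (h A hA).le)
    (card_mul_le_crossWeight fun A hA => (h A hA).ge)

lemma crossWeight_mono {S T : Multiset G} (h : S ≤ T) : crossWeight S ≤ crossWeight T := by
  obtain ⟨X, rfl⟩ := Multiset.le_iff_exists_add.1 h
  simp [crossWeight_add]

variable [Finite G]

lemma exponent_pos : 0 < AddMonoid.exponent G :=
  Nat.pos_of_ne_zero AddMonoid.exponent_ne_zero_of_finite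

lemma isMinZeroSum_replicate (g : G) :
    IsMinZeroSum (Multiset.replicate (addOrderOf g) g) := by
  have hpos : 0 < addOrderOf g := addOrderOf_pos g
  refine ⟨by simp [addOrderOf_nsmul_eq_zero], ?_, fun B hB h0 hs => ?_⟩
  · intro h
    have := congrArg Multiset.card h
    rw [Multiset.card_replicate, Multiset.card_zero] at this
    omega
  · obtain ⟨k, hk, rfl⟩ := Multiset.le_replicate_iff.1 hB
    rw [Multiset.sum_replicate] at hs
    have hk0 : k ≠ 0 := by rintro rfl; simp at h0
    have := Nat.le_of_dvd (Nat.pos_of_ne_zero hk0) (addOrderOf_dvd_of_nsmul_eq_zero hs)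
    rw [le_antisymm hk this]

lemma IsMinZeroSum.eq_replicate {A : Multiset G} (hA : IsMinZeroSum A) {g : G}
    (h : Multiset.replicate (addOrderOf g) g ≤ A) :
    A = Multiset.replicate (addOrderOf g) g :=
  (hA.2.2 _ h (isMinZeroSum_replicate g).2.1 (isMinZeroSum_replicate g).1).symm

omit [Finite G] in
lemma crossWeight_replicate (g : G) :
    crossWeight (Multiset.replicate (addOrderOf g) g) = AddMonoid.exponent G := by
  simp [crossWeight, Nat.mul_div_cancel' (AddMonoid.addOrder_dvd_exponent g)]

lemma card_le_crossWeight (S : Multiset G) : S.card ≤ crossWeight S := by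
  have := Multiset.card_nsmul_le_sum
    (s := S.map fun g => AddMonoid.exponent G / addOrderOf g) (a := 1) (by
      simp only [Multiset.mem_map]
      rintro _ ⟨g, -, rfl⟩
      exact Nat.div_pos (Nat.le_of_dvd exponent_pos (AddMonoid.addOrder_dvd_exponent g))
        (addOrderOf_pos g))
  simpa [crossWeight] using this

lemma crossWeight_pos {S : Multiset G} (h : S ≠ 0) : 0 < crossWeight S :=
  (Multiset.card_pos.2 h).trans_le (card_le_crossWeight S)

omit [Finite G] in
lemma exponent_nsmul_eq (S : Multiset G) :
    AddMonoid.exponent G • S = (S.map fun g => (AddMonoid.exponent G / addOrderOf g) •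
      Multiset.replicate (addOrderOf g) g).sum := by
  induction S using Multiset.induction with
  | empty => simp
  | cons g S ih =>
    rw [← Multiset.singleton_add, nsmul_add, ih]
    simp only [Multiset.map_add, Multiset.sum_add, Multiset.map_singleton,
      Multiset.sum_singleton, Multiset.nsmul_singleton, Multiset.nsmul_replicate]
    rw [Nat.div_mul_cancel (AddMonoid.addOrder_dvd_exponent g)]

lemma crossWeight_mem_factLengths (S : Multiset G) :
    crossWeight S ∈ factLengths (AddMonoid.exponent G • S) := by
  rw [exponent_nsmul_eq]
  induction S using Multiset.induction with
  | empty => simpa [crossWeight] using zero_mem_factLengths_zero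
  | cons g S ih =>
    simp only [crossWeight, Multiset.map_cons, Multiset.sum_cons]
    exact add_mem_factLengths ((isMinZeroSum_replicate g).mem_factLengths_nsmul _) ih

lemma IsMinZeroSum.crossWeight_le [Fintype G] [DecidableEq G] {A : Multiset G}
    (hA : IsMinZeroSum A) :
    crossWeight A ≤ Fintype.card G * AddMonoid.exponent G := by
  have hle : A ≤ ∑ g : G, Multiset.replicate (addOrderOf g) g := by
    rw [Multiset.le_iff_count]
    intro h
    rw [Multiset.count_sum']
    refine le_trans ?_ (Finset.single_le_sum (f := fun g =>
      Multiset.count h (Multiset.replicate (addOrderOf g) g)) (fun _ _ => Nat.zero_le _)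
      (Finset.mem_univ h))
    simp only [Multiset.count_replicate_self]
    by_contra hlt
    push Not at hlt
    have := hA.eq_replicate (Multiset.le_count_iff_replicate_le.1 hlt.le)
    rw [this] at hlt
    simp at hlt
  refine (crossWeight_mono hle).trans ?_
  have : ∑ g : G, Multiset.replicate (addOrderOf g) g =
    ((Finset.univ.val : Multiset G).map fun g => Multiset.replicate (addOrderOf g) g).sum := rfl
  rw [this]
  refine (crossWeight_le_card_mul (m := AddMonoid.exponent G) ?_).trans (by simp)
  simp only [Multiset.mem_map]
  rintro _ ⟨g, -, rfl⟩
  exact (crossWeight_replicate g).le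

end Factorizations

section Distances

variable {G : Type*} [AddCommGroup G] [Fintype G] [DecidableEq G]

/-- If some atom over `G₀` has cross number larger than one, then the differences of lengths
are bounded in terms of `#G₀`. -/
lemma LengthsCongr.add_two_le_card {d : ℕ} {G₀ : Finset G} (hG : LengthsCongr d G₀)
    (hA : ∃ A, IsMinZeroSum A ∧ (∀ g ∈ A, g ∈ G₀) ∧ AddMonoid.exponent G < crossWeight A) :
    d + 2 ≤ G₀.card := by
  obtain ⟨A, ⟨hA, hAG, hAK⟩, hmax⟩ : ∃ A, (IsMinZeroSum A ∧ (∀ g ∈ A, g ∈ G₀) ∧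
      AddMonoid.exponent G < crossWeight A) ∧ ∀ B, IsMinZeroSum B → (∀ g ∈ B, g ∈ G₀) →
      crossWeight B ≤ crossWeight A := by
    let s : Set ℕ := {k | ∃ A, IsMinZeroSum A ∧ (∀ g ∈ A, g ∈ G₀) ∧ crossWeight A = k}
    have hbdd : BddAbove s := by
      refine ⟨Fintype.card G * AddMonoid.exponent G, ?_⟩
      rintro _ ⟨B, hB, -, rfl⟩
      exact hB.crossWeight_le
    obtain ⟨A, hA, hAG, hAK⟩ := hA
    obtain ⟨C, hC, hCG, hCs⟩ : sSup s ∈ s := Nat.sSup_mem ⟨_, A, hA, hAG, rfl⟩ hbdd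
    have key : ∀ B, IsMinZeroSum B → (∀ g ∈ B, g ∈ G₀) → crossWeight B ≤ crossWeight C :=
      fun B hB hBG => hCs ▸ le_csSup hbdd ⟨B, hB, hBG, rfl⟩
    exact ⟨C, ⟨hC, hCG, hAK.trans_le (key A hA hAG)⟩, key⟩
  have hex : ∃ j, ∃ t ∈ factLengths (j • A), j < t :=
    ⟨_, _, crossWeight_mem_factLengths A, hAK⟩
  obtain ⟨j, ⟨t, ht, hjt⟩, hmin⟩ : ∃ j, (∃ t ∈ factLengths (j • A), j < t) ∧
      ∀ i < j, ¬ ∃ t ∈ factLengths (i • A), i < t :=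
    by
    classical exact ⟨Nat.find hex, Nat.find_spec hex, fun i hi => Nat.find_min hex hi⟩
  have hj0 : j ≠ 0 := by
    rintro rfl
    rw [zero_nsmul] at ht
    have := eq_zero_of_mem_factLengths_zero ht
    omega
  have hj1 : j ≠ 1 := by
    rintro rfl
    rw [one_nsmul] at ht
    have := hA.eq_one_of_mem_factLengths ht
    omega
  obtain ⟨i, rfl⟩ : ∃ i, j = i + 2 := ⟨j - 2, by omega⟩
  have hjA : ∀ g ∈ (i + 2) • A, g ∈ G₀ := fun g hg => hAG g (Multiset.mem_of_mem_nsmul hg)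
  have hdt : i + 2 + d ≤ t := by
    have hmod := hG ((i + 2) • A) (by simp [Multiset.sum_nsmul, hA.1]) hjA _
      (hA.mem_factLengths_nsmul _) _ ht
    have := Nat.le_of_dvd (by omega) ((Nat.modEq_iff_dvd' hjt.le).1 hmod)
    omega
  obtain ⟨F, hFt, hF, hFA⟩ := ht
  set K := crossWeight A with hK
  have hFG : ∀ C ∈ F, ∀ g ∈ C, g ∈ G₀ := fun C hC =>
    mem_of_mem_factorization (by rw [hFA]; exact hjA) hC
  set E := F.filter fun C => crossWeight C < K with hE
  set U := F.filter fun C => ¬ crossWeight C < K with hU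
  have hEU : E + U = F := Multiset.filter_add_not _ _
  have hown : ∀ C ∈ E, ∃ g ∈ G₀, (i + 1) * A.count g < C.count g := by
    intro C hC
    obtain ⟨hCF, hCK⟩ := Multiset.mem_filter.1 hC
    have hnle : ¬ C ≤ (i + 1) • A := by
      intro hle
      obtain ⟨X, hX⟩ := Multiset.le_iff_exists_add.1 hle
      have hXs : X.sum = 0 := by
        have := congrArg Multiset.sum hX
        simpa [Multiset.sum_nsmul, hA.1, (hF C hCF).1] using this.symm
      obtain ⟨l, hl⟩ := exists_mem_factLengths hXs
      refine hmin (i + 1) (by omega)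
        ⟨1 + l, hX ▸ add_mem_factLengths (hF C hCF).one_mem_factLengths hl, ?_⟩
      obtain ⟨FX, rfl, hFX, rfl⟩ := hl
      have h1 : crossWeight FX.sum ≤ FX.card * K :=
        crossWeight_le_card_mul fun B hB => hmax B (hFX B hB) fun g hg =>
          hAG g (Multiset.mem_of_mem_nsmul (n := i + 1) (by
            rw [hX]
            exact Multiset.mem_add.2 (Or.inr
              (Multiset.mem_of_le (Multiset.le_sum_of_mem hB) hg))))
      have h2 : (i + 1) * K = crossWeight C + crossWeight FX.sum := by
        rw [← crossWeight_add, ← hX, crossWeight_nsmul]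
      by_contra hcon
      have : FX.card * K ≤ i * K := Nat.mul_le_mul_right _ (by omega)
      have : (i + 1) * K = i * K + K := by ring
      omega
    rw [Multiset.le_iff_count] at hnle
    push Not at hnle
    obtain ⟨g, hg⟩ := hnle
    rw [Multiset.count_nsmul] at hg
    exact ⟨g, hFG C hCF g (Multiset.count_pos.1 (by omega)), hg⟩
  have hcount : ∀ g, (F.map (Multiset.count g)).sum = (i + 2) * A.count g := by
    intro g
    rw [← Multiset.count_nsmul, ← hFA]
    exact (map_multiset_sum (Multiset.countAddMonoidHom g) F).symm
  have hone : ∀ g, E.countP (fun C => (i + 1) * A.count g < C.count g) ≤ 1 := by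
    intro g
    have h1 := Multiset.card_nsmul_le_sum
      (s := (E.filter fun C => (i + 1) * A.count g < C.count g).map (Multiset.count g))
      (a := (i + 1) * A.count g + 1) (by
        simp only [Multiset.mem_map, Multiset.mem_filter]
        rintro _ ⟨C, ⟨-, hC⟩, rfl⟩
        exact hC)
    rw [Multiset.card_map, ← Multiset.countP_eq_card_filter, smul_eq_mul] at h1
    have h2 : ((E.filter fun C => (i + 1) * A.count g < C.count g).map
        (Multiset.count g)).sum ≤ (F.map (Multiset.count g)).sum :=
      by
      obtain ⟨X, hX⟩ := Multiset.le_iff_exists_add.1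
        ((Multiset.filter_le (fun C => (i + 1) * A.count g < C.count g) E).trans
          (Multiset.filter_le (fun C => crossWeight C < K) F))
      conv_rhs => rw [hX, Multiset.map_add, Multiset.sum_add]
      exact Nat.le_add_right _ _
    rw [hcount g] at h2
    by_contra hcon
    push Not at hcon
    have h3 := Nat.mul_le_mul_right ((i + 1) * A.count g + 1) hcon
    have : 2 * ((i + 1) * A.count g + 1) = (i + 2) * A.count g + i * A.count g + 2 := by ring
    omega
  have hcard : E.card ≤ ∑ g ∈ G₀, E.countP (fun C => (i + 1) * A.count g < C.count g) := by
    clear_value E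
    clear hone hEU hE
    induction E using Multiset.induction with
    | empty => simp
    | cons C E ih =>
      have := ih fun B hB => hown B (by simp [hB])
      obtain ⟨g, hg, hgC⟩ := hown C (by simp)
      simp only [Multiset.countP_cons, Multiset.card_cons, Finset.sum_add_distrib]
      have : 1 ≤ ∑ g ∈ G₀, if (i + 1) * A.count g < C.count g then 1 else 0 := by
        refine le_trans (by simp [hgC]) (Finset.single_le_sum
          (f := fun g => if (i + 1) * A.count g < C.count g then 1 else 0)
          (fun _ _ => Nat.zero_le _) hg)
      omega
  have hle : ∑ g ∈ G₀, E.countP (fun C => (i + 1) * A.count g < C.count g) ≤ G₀.card := by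
    simpa using Finset.sum_le_card_nsmul G₀ _ 1 fun g _ => hone g
  have hUK : U.card * K ≤ crossWeight U.sum := card_mul_le_crossWeight fun C hC => by
    simpa using (Multiset.mem_filter.1 hC).2
  have hsum : crossWeight E.sum + crossWeight U.sum = (i + 2) * K := by
    rw [← crossWeight_add, ← Multiset.sum_add, hEU, hFA, crossWeight_nsmul]
  have hc : E.card + U.card = t := by rw [← Multiset.card_add, hEU, hFt]
  have hK0 : 0 < K := (Nat.zero_le _).trans_lt hAK
  have hUle : U.card ≤ i + 2 := Nat.le_of_mul_le_mul_right (by omega) hK0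
  have hE0 : E ≠ 0 := by
    intro h
    rw [h] at hc
    simp at hc
    omega
  have hEpos : 0 < crossWeight E.sum := by
    obtain ⟨C, hC⟩ := Multiset.exists_mem_of_ne_zero hE0
    exact (crossWeight_pos (hF C (Multiset.mem_of_mem_filter hC)).2.1).trans_le
      (crossWeight_mono (Multiset.le_sum_of_mem hC))
  have hUlt : U.card < i + 2 := by
    refine lt_of_le_of_ne hUle fun h => ?_
    rw [h] at hUK
    omega
  by_contra hcon
  have hUi : U.card = i + 1 := by omega
  have hEc : E.card = G₀.card := by omega
  have hall : ∀ g ∈ G₀, E.countP (fun C => (i + 1) * A.count g < C.count g) = 1 := by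
    have : ∑ g ∈ G₀, E.countP (fun C => (i + 1) * A.count g < C.count g) = ∑ g ∈ G₀, 1 := by
      simp; omega
    exact (Finset.sum_eq_sum_iff_of_le fun g _ => hone g).1 this
  obtain ⟨C, hC⟩ : ∃ C, C ∈ U := Multiset.card_pos_iff_exists_mem.1 (by omega)
  have hCF := Multiset.mem_of_mem_filter hC
  have hlt : ∀ g ∈ G₀, C.count g + 1 ≤ A.count g := by
    intro g hg
    obtain ⟨D, hD, hDg⟩ := Multiset.countP_pos.1 (by rw [hall g hg]; exact Nat.one_pos)
    have h1 : C.count g ≤ (U.map (Multiset.count g)).sum :=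
      Multiset.le_sum_of_mem (Multiset.mem_map_of_mem _ hC)
    have h2 : D.count g ≤ (E.map (Multiset.count g)).sum :=
      Multiset.le_sum_of_mem (Multiset.mem_map_of_mem _ hD)
    have h3 : (E.map (Multiset.count g)).sum + (U.map (Multiset.count g)).sum =
        (i + 2) * A.count g := by
      rw [← hcount g, ← hEU, Multiset.map_add, Multiset.sum_add]
    have : (i + 2) * A.count g = (i + 1) * A.count g + A.count g := by ring
    omega
  have hCA : C = A := by
    refine hA.2.2 C (Multiset.le_iff_count.2 fun g => ?_) (hF C hCF).2.1 (hF C hCF).1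
    by_cases hg : g ∈ G₀
    · have := hlt g hg; omega
    · rw [Multiset.count_eq_zero_of_notMem fun h => hg (hFG C hCF g h)]
      exact Nat.zero_le _
  obtain ⟨g, hg⟩ := Multiset.exists_mem_of_ne_zero hA.2.1
  have := hlt g (hAG g hg)
  rw [hCA] at this
  omega

/-- Some factorization length grows by at least two when a sequence `g ^ ord g` is appended, and
this bounds the differences of lengths. -/
lemma LengthsCongr.two_mul_add_three_le {d : ℕ} {G₀ : Finset G} (hG : LengthsCongr d G₀)
    (hge : ∀ A, IsMinZeroSum A → (∀ g ∈ A, g ∈ G₀) → AddMonoid.exponent G ≤ crossWeight A)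
    (hproper : ∀ i ∈ G₀, ∀ A, IsMinZeroSum A → (∀ g ∈ A, g ∈ G₀.erase i) →
      crossWeight A = AddMonoid.exponent G)
    (hex : ∃ P : Multiset G, P.sum = 0 ∧ (∀ g ∈ P, g ∈ G₀) ∧ ∃ g ∈ G₀, ∃ t ∈ factLengths
      (P + Multiset.replicate (addOrderOf g) g), ∀ l ∈ factLengths P, l + 2 ≤ t) :
    2 * d + 3 ≤ AddMonoid.exponent G := by
  obtain ⟨P, ⟨hP, hPG, g, hg, t, ht, hlt⟩, hmin⟩ := (measure (Multiset.card (α := G))).wf.has_min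
    {P | P.sum = 0 ∧ (∀ g ∈ P, g ∈ G₀) ∧ ∃ g ∈ G₀, ∃ t ∈ factLengths
      (P + Multiset.replicate (addOrderOf g) g), ∀ l ∈ factLengths P, l + 2 ≤ t} hex
  obtain ⟨l, hl⟩ := exists_mem_factLengths hP
  have hP0 : P ≠ 0 := by
    rintro rfl
    rw [zero_add] at ht
    have := (isMinZeroSum_replicate g).eq_one_of_mem_factLengths ht
    have := hlt l hl
    omega
  have hl0 := pos_of_mem_factLengths hP0 hl
  have hPgG : ∀ h ∈ P + Multiset.replicate (addOrderOf g) g, h ∈ G₀ := by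
    intro h hh
    rcases Multiset.mem_add.1 hh with hh | hh
    · exact hPG h hh
    · rwa [Multiset.eq_of_mem_replicate hh]
  have hdt : l + 1 + d ≤ t := by
    have hmod := hG _ (by simp [hP, addOrderOf_nsmul_eq_zero]) hPgG _
      (add_mem_factLengths hl (isMinZeroSum_replicate g).one_mem_factLengths) _ ht
    have := hlt l hl
    have := Nat.le_of_dvd (by omega) ((Nat.modEq_iff_dvd' (by omega)).1 hmod)
    omega
  obtain ⟨F, rfl, hF, hFs⟩ := ht
  have hcount : ∀ D ∈ F, P.count g + 1 ≤ D.count g := by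
    intro D hD
    have hDle : D ≤ P + Multiset.replicate (addOrderOf g) g :=
      hFs ▸ Multiset.le_sum_of_mem hD
    have hnle : ¬ D ≤ P := by
      intro hle
      obtain ⟨X, rfl⟩ := Multiset.le_iff_exists_add.1 hle
      obtain ⟨F', rfl⟩ := Multiset.exists_cons_of_mem hD
      have hDa := hF D hD
      refine hmin X ⟨by simpa [hDa.1] using hP, fun h hh => hPG h (by simp [hh]), g, hg,
        F'.card, ⟨F', rfl, fun B hB => hF B (by simp [hB]), ?_⟩, fun m hm => ?_⟩ ?_
      · rw [Multiset.sum_cons, add_assoc] at hFs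
        exact add_left_cancel hFs
      · have := hlt _ (add_mem_factLengths hDa.one_mem_factLengths hm)
        rw [Multiset.card_cons] at this
        omega
      · change X.card < (D + X).card
        have := Multiset.card_pos.2 hDa.2.1
        rw [Multiset.card_add]
        omega
    rw [Multiset.le_iff_count] at hnle
    push Not at hnle
    obtain ⟨h, hh⟩ := hnle
    have h1 := Multiset.le_iff_count.1 hDle h
    rw [Multiset.count_add, Multiset.count_replicate] at h1
    split_ifs at h1 with heq
    · subst heq; omega
    · omega
  have hsum : F.card * (P.count g + 1) ≤ P.count g + addOrderOf g := by
    have h1 := Multiset.card_nsmul_le_sum (s := F.map (Multiset.count g))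
      (a := P.count g + 1) (by simpa using hcount)
    have h2 : (F.map (Multiset.count g)).sum = P.count g + addOrderOf g := by
      have := congrArg (Multiset.count g) hFs
      rw [Multiset.count_add, Multiset.count_replicate_self] at this
      rw [← this]
      exact (map_multiset_sum (Multiset.countAddMonoidHom g) F).symm
    rw [h2] at h1
    simpa using h1
  have hl2 := hlt l hl
  have hpos : 0 < P.count g := by
    by_contra hcon
    have hgP : g ∉ P := fun h => hcon (Multiset.count_pos.2 h)
    obtain ⟨E, rfl, hE, rfl⟩ := hl
    have h1 : crossWeight E.sum = E.card * AddMonoid.exponent G :=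
      crossWeight_eq_card_mul fun A hA => hproper g hg A (hE A hA) fun h hh =>
        have hhE := Multiset.mem_of_le (Multiset.le_sum_of_mem hA) hh
        Finset.mem_erase.2 ⟨fun h' => hgP (h' ▸ hhE), hPG h hhE⟩
    have h2 : F.card * AddMonoid.exponent G ≤ crossWeight F.sum :=
      card_mul_le_crossWeight fun A hA => hge A (hF A hA)
        (mem_of_mem_factorization (by rw [hFs]; exact hPgG) hA)
    rw [hFs, crossWeight_add, crossWeight_replicate, h1] at h2
    have h3 : F.card ≤ E.card + 1 :=
      Nat.le_of_mul_le_mul_right (by linarith) (exponent_pos (G := G))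
    omega
  have hord := Nat.le_of_dvd exponent_pos (AddMonoid.addOrder_dvd_exponent g)
  obtain ⟨x, hx⟩ : ∃ x, P.count g = x + 1 := ⟨_, (Nat.succ_pred_eq_of_pos hpos).symm⟩
  obtain ⟨s, hs⟩ : ∃ s, F.card = s + 1 := ⟨F.card - 1, by omega⟩
  rw [hx, hs] at hsum
  have : (s + 1) * (x + 1 + 1) = s * x + 2 * s + x + 2 := by ring
  omega

end Distances

section Rank

variable {G : Type*} [AddCommGroup G] [Finite G]

lemma bddAbove_grank_set : BddAbove {k | ∃ p : ℕ, p.Prime ∧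
    ∃ f : (Fin k → ZMod p) →+ G, Function.Injective f} := by
  refine ⟨Nat.card G, ?_⟩
  rintro k ⟨p, hp, f, hf⟩
  have : NeZero p := ⟨hp.ne_zero⟩
  have h := Nat.card_le_card_of_injective f hf
  simp only [Nat.card_eq_fintype_card, Fintype.card_pi, ZMod.card, Finset.prod_const,
    Finset.card_univ, Fintype.card_fin] at h
  exact (Nat.lt_pow_self hp.one_lt).le.trans h

lemma exists_injective_of_grank : ∃ p : ℕ, p.Prime ∧
    ∃ f : (Fin (grank G) → ZMod p) →+ G, Function.Injective f :=
  Nat.sSup_mem (s := {k | ∃ p : ℕ, p.Prime ∧ ∃ f : (Fin k → ZMod p) →+ G, Function.Injective f})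
    ⟨0, 2, Nat.prime_two, 0, Function.injective_of_subsingleton _⟩ bddAbove_grank_set

lemma card_le_pow_grank {K : Type*} [AddCommGroup K] {p : ℕ} (hp : p.Prime)
    [Module (ZMod p) K] (f : K →+ G) (hf : Function.Injective f) :
    Nat.card K ≤ p ^ grank G := by
  have : Finite K := Finite.of_injective f hf
  have : Fact p.Prime := ⟨hp⟩
  have : Module.Finite (ZMod p) K := Module.Finite.of_finite
  let e := (Module.finBasis (ZMod p) K).equivFun
  have hk : Module.finrank (ZMod p) K ≤ grank G :=
    le_csSup bddAbove_grank_set ⟨p, hp, f.comp e.symm.toAddEquiv.toAddMonoidHom,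
      hf.comp e.symm.injective⟩
  have hc : Nat.card K = p ^ Module.finrank (ZMod p) K := by
    rw [Nat.card_congr e.toEquiv]
    simp
  exact hc.trans_le (Nat.pow_le_pow_right hp.pos hk)

lemma card_ker_nsmul_le {p : ℕ} (hp : p.Prime) {H : Type*} [AddCommGroup H] (f : H →+ G)
    (hf : Function.Injective f) :
    Nat.card (nsmulAddMonoidHom (α := H) p).ker ≤ p ^ grank G := by
  let K := (nsmulAddMonoidHom (α := H) p).ker
  let : Module (ZMod p) K := AddCommGroup.zmodModule fun x => by
    have := x.2
    rw [AddMonoidHom.mem_ker] at this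
    exact Subtype.ext this
  exact card_le_pow_grank hp (f.comp K.subtype) (hf.comp Subtype.val_injective)

lemma card_ker_nsmul_le_pow {m : ℕ} (hm : m ≠ 0) :
    Nat.card (nsmulAddMonoidHom (α := G) m).ker ≤ m ^ grank G := by
  induction m using Nat.recOnMul with
  | zero => simp at hm
  | one =>
    rw [one_pow, Finite.card_le_one_iff_subsingleton]
    refine ⟨fun x y => Subtype.ext ?_⟩
    have hx := x.2
    have hy := y.2
    rw [AddMonoidHom.mem_ker] at hx hy
    simp only [nsmulAddMonoidHom_apply, one_nsmul] at hx hy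
    rw [hx, hy]
  | prime p hp => exact card_ker_nsmul_le hp (AddMonoidHom.id G) Function.injective_id
  | mul a b iha ihb =>
    have ha : a ≠ 0 := left_ne_zero_of_mul hm
    have hb : b ≠ 0 := right_ne_zero_of_mul hm
    let K := (nsmulAddMonoidHom (α := G) (a * b)).ker
    let f : K →+ (nsmulAddMonoidHom (α := G) b).ker :=
      ((nsmulAddMonoidHom (α := G) a).comp K.subtype).codRestrict _ fun x => by
        have := x.2
        rw [AddMonoidHom.mem_ker] at this ⊢
        change b • a • (x : G) = 0
        rw [← mul_nsmul]
        exact this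
    have h1 : Nat.card K = Nat.card f.ker * Nat.card f.range := by
      rw [← f.ker.card_mul_index, AddSubgroup.index_ker]
    have h2 : Nat.card f.ker ≤ Nat.card (nsmulAddMonoidHom (α := G) a).ker :=
      Nat.card_le_card_of_injective (fun x => ⟨x.1.1, by
        have := x.2
        rw [AddMonoidHom.mem_ker] at this ⊢
        exact congrArg Subtype.val this⟩) fun x y h => by
          simp only [Subtype.mk.injEq] at h
          exact Subtype.ext (Subtype.ext h)
    have h3 : Nat.card f.range ≤ Nat.card (nsmulAddMonoidHom (α := G) b).ker :=
      Nat.card_le_card_of_injective _ Subtype.val_injective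
    change Nat.card K ≤ _
    rw [h1, mul_pow]
    exact Nat.mul_le_mul (h2.trans (iha ha)) (h3.trans (ihb hb))

lemma card_le_exponent_pow : Nat.card G ≤ AddMonoid.exponent G ^ grank G := by
  refine le_trans ?_ (card_ker_nsmul_le_pow (G := G) (exponent_pos (G := G)).ne')
  refine Nat.card_le_card_of_injective (fun x => ⟨x, ?_⟩) fun x y h => by simpa using h
  rw [AddMonoidHom.mem_ker]
  exact AddMonoid.exponent_nsmul_eq_zero x

end Rank

section Relations

variable {G : Type*} [AddCommGroup G] [Fintype G]

/-- The lattice of integral relations between the elements of `S`. -/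
def relations (S : Finset G) : AddSubgroup (G → ℤ) where
  carrier := {x | (∀ g ∉ S, x g = 0) ∧ ∑ g, x g • g = 0}
  zero_mem' := by simp
  add_mem' := by
    rintro x y ⟨hx, hx'⟩ ⟨hy, hy'⟩
    exact ⟨fun g hg => by simp [hx g hg, hy g hg], by
      simp [add_smul, Finset.sum_add_distrib, hx', hy']⟩
  neg_mem' := by
    rintro x ⟨hx, hx'⟩
    exact ⟨fun g hg => by simp [hx g hg], by simp [hx']⟩

lemma mem_relations {S : Finset G} {x : G → ℤ} :
    x ∈ relations S ↔ (∀ g ∉ S, x g = 0) ∧ ∑ g, x g • g = 0 := Iff.rfl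

lemma relations_mono {S T : Finset G} (h : S ⊆ T) : relations S ≤ relations T :=
  fun _ hx => ⟨fun g hg => hx.1 g fun hgS => hg (h hgS), hx.2⟩

lemma exists_mem_relations {p : ℕ} (hp : p.Prime) {S : Finset G} (hS : grank G < S.card) :
    ∃ x ∈ relations S, ∃ g ∈ S, ¬ (p : ℤ) ∣ x g := by
  classical
  let H : Submodule ℤ G := Submodule.span ℤ (S : Set G)
  let R := (nsmulAddMonoidHom (α := H) p).range
  let φ : (S → Fin p) → H ⧸ R := fun c => QuotientAddGroup.mk
    (∑ g : S, (c g : ℕ) • (⟨g.1, Submodule.subset_span g.2⟩ : H))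
  have hnot : ¬ Function.Injective φ := by
    intro hinj
    have h1 := Nat.card_le_card_of_injective φ hinj
    have h2 : Nat.card (H ⧸ R) = Nat.card (nsmulAddMonoidHom (α := H) p).ker := by
      have e1 := R.card_mul_index
      have e2 := (nsmulAddMonoidHom (α := H) p).ker.card_mul_index
      rw [AddSubgroup.index_ker, mul_comm] at e2
      exact Nat.eq_of_mul_eq_mul_left (Nat.card_pos (α := R)) (e1.trans e2.symm)
    rw [h2] at h1
    have h3 := h1.trans (card_ker_nsmul_le hp H.subtype.toAddMonoidHom Subtype.val_injective)
    simp only [Nat.card_eq_fintype_card, Fintype.card_pi, Fintype.card_fin, Finset.prod_const,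
      Finset.card_univ, Fintype.card_coe] at h3
    exact absurd ((Nat.pow_le_pow_iff_right hp.one_lt).1 h3) (by omega)
  simp only [Function.Injective] at hnot
  push Not at hnot
  obtain ⟨a, b, hab, hne⟩ := hnot
  obtain ⟨⟨y, hyH⟩, hy⟩ := (QuotientAddGroup.eq.1 hab)
  obtain ⟨f, -, hf⟩ := Submodule.mem_span_finset.1 hyH
  have hy' : p • y = -∑ g : S, (a g : ℕ) • g.1 + ∑ g : S, (b g : ℕ) • g.1 := by
    simpa using congrArg H.subtype hy
  obtain ⟨g₀, hg₀⟩ := Function.ne_iff.1 hne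
  refine ⟨fun g => if h : g ∈ S then (p : ℤ) * f g + a ⟨g, h⟩ - b ⟨g, h⟩ else 0,
    ⟨fun g hg => by simp [hg], ?_⟩, g₀.1, g₀.2, ?_⟩
  · rw [← Finset.sum_subset (Finset.subset_univ S) (fun g _ hg => by simp [hg]),
      ← Finset.sum_coe_sort S]
    simp only [Finset.coe_mem, dite_true, sub_smul, add_smul, mul_smul,
      Finset.sum_sub_distrib, Finset.sum_add_distrib, natCast_zsmul]
    rw [← Finset.smul_sum, Finset.sum_coe_sort S (fun g => f g • g), hf, hy']
    abel
  · simp only [Finset.coe_mem, dite_true]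
    intro hdvd
    have h1 : (p : ℤ) ∣ (a g₀ : ℤ) - b g₀ := by
      have := dvd_sub hdvd (dvd_mul_right (p : ℤ) (f g₀))
      rwa [show (p : ℤ) * f g₀ + a g₀ - b g₀ - p * f g₀ = a g₀ - b g₀ by ring] at this
    have h2 := Int.eq_zero_of_abs_lt_dvd h1 (by
      have := (a g₀).2
      have := (b g₀).2
      rw [abs_lt]
      constructor <;> omega)
    exact hg₀ (Fin.ext (by omega))

lemma relations_le_of_erase [DecidableEq G] {S : Finset G} (hS : grank G + 2 ≤ S.card)
    {M : AddSubgroup (G → ℤ)} (hM : ∀ i ∈ S, relations (S.erase i) ≤ M) : relations S ≤ M := by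
  intro z hz
  let I : AddSubgroup ℤ := M.comap ((smulAddHom ℤ (G → ℤ)).flip z)
  have hI : ∀ q : ℤ, q ∈ I ↔ q • z ∈ M := fun q => Iff.rfl
  obtain ⟨c, hc⟩ := Int.subgroup_cyclic I
  by_cases hc1 : c.natAbs = 1
  · have : (1 : ℤ) ∈ I := by
      rw [hc, AddSubgroup.mem_closure_singleton]
      rcases Int.natAbs_eq_iff.1 hc1 with h | h
      · exact ⟨1, by simp [h]⟩
      · exact ⟨-1, by simp [h]⟩
    simpa using (hI 1).1 this
  · exfalso
    obtain ⟨p, hp, hpc⟩ := Nat.exists_prime_and_dvd hc1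
    have hpI : ∀ q ∈ I, (p : ℤ) ∣ q := by
      intro q hq
      rw [hc, AddSubgroup.mem_closure_singleton] at hq
      obtain ⟨m, rfl⟩ := hq
      exact (Int.natCast_dvd.2 hpc).mul_left m
    obtain ⟨x, hx, i, hi, hxi⟩ := exists_mem_relations hp (S := S) (by omega)
    obtain ⟨y, hy, j, hj, hyj⟩ := exists_mem_relations hp (S := S.erase i) (by
      rw [Finset.card_erase_of_mem hi]; omega)
    obtain ⟨hji, hjS⟩ := Finset.mem_erase.1 hj
    have hyi : y i = 0 := hy.1 i (by simp)
    have hyS := relations_mono (Finset.erase_subset i S) hy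
    have erase_mem : ∀ k : G, ∀ w ∈ relations S, w k = 0 → w ∈ relations (S.erase k) := by
      intro k w hw hwk
      refine ⟨fun g hg => ?_, hw.2⟩
      by_cases hgk : g = k
      · rw [hgk, hwk]
      · exact hw.1 g fun h => hg (Finset.mem_erase.2 ⟨hgk, h⟩)
    have hu : y j • x - x j • y ∈ relations (S.erase j) :=
      erase_mem j _ (sub_mem (zsmul_mem hx _) (zsmul_mem hyS _)) (by simp; ring)
    set u := y j • x - x j • y with hu_def
    have hui : u i = y j * x i := by simp [hu_def, hyi]
    have hv : u i • z - z i • u ∈ relations (S.erase i) :=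
      erase_mem i _ (sub_mem (zsmul_mem hz _)
        (zsmul_mem (relations_mono (Finset.erase_subset j S) hu) _)) (by simp; ring)
    have hmem : u i • z ∈ M := by
      have := add_mem (hM i hi hv) (zsmul_mem (hM j hjS hu) (z i))
      simpa using this
    have := hpI _ ((hI _).2 hmem)
    rw [hui] at this
    rcases (Nat.prime_iff_prime_int.1 hp).dvd_or_dvd this with h | h
    exacts [hyj h, hxi h]

end Relations

section CountVectors

/-- The vector of multiplicities of a multiset. -/
def countVec {G : Type*} [DecidableEq G] (B : Multiset G) : G → ℤ := fun g => (B.count g : ℤ)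

lemma countVec_add {G : Type*} [DecidableEq G] (A B : Multiset G) :
    countVec (A + B) = countVec A + countVec B := by
  ext g
  simp [countVec]

lemma countVec_zero {G : Type*} [DecidableEq G] : countVec (0 : Multiset G) = 0 := by
  ext g
  simp [countVec]

lemma countVec_injective {G : Type*} [DecidableEq G] :
    Function.Injective (countVec (G := G)) := fun _ _ h =>
  Multiset.ext.2 fun g => Nat.cast_injective (R := ℤ) (congrFun h g)

lemma exists_countVec_eq {G : Type*} [Fintype G] [DecidableEq G] {x : G → ℤ} (hx : ∀ g, 0 ≤ x g) :
    ∃ B, countVec B = x := by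
  refine ⟨∑ g, Multiset.replicate (x g).toNat g, funext fun g => ?_⟩
  simp [countVec, Multiset.count_sum', Multiset.count_replicate, hx g]

lemma countVec_mem_of_factorization {G : Type*} [DecidableEq G] {M : AddSubgroup (G → ℤ)}
    {F : Multiset (Multiset G)}
    (hF : ∀ A ∈ F, countVec A ∈ M) : countVec F.sum ∈ M := by
  induction F using Multiset.induction with
  | empty => simp [countVec_zero]
  | cons A F ih =>
    rw [Multiset.sum_cons, countVec_add]
    exact add_mem (hF A (by simp)) (ih fun B hB => hF B (by simp [hB]))

variable {G : Type*} [AddCommGroup G]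

/-- The minimal zero-sum sequences that are powers of the elements of `W`. -/
noncomputable def orderPowers (W : Multiset G) : Multiset (Multiset G) :=
  W.map fun g => Multiset.replicate (addOrderOf g) g

lemma mem_of_mem_orderPowers {W A : Multiset G} (hA : A ∈ orderPowers W) {g : G} (hg : g ∈ A) :
    g ∈ W := by
  obtain ⟨h, hh, rfl⟩ := Multiset.mem_map.1 hA
  rwa [Multiset.eq_of_mem_replicate hg]

lemma exists_orderPowers_eq (S : Multiset G) : ∃ W : Multiset G, (∀ g ∈ W, g ∈ S) ∧
    (orderPowers W).sum = AddMonoid.exponent G • S := by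
  refine ⟨(S.map fun g => (AddMonoid.exponent G / addOrderOf g) • {g}).sum, ?_, ?_⟩
  · intro g hg
    obtain ⟨A, hA, hgA⟩ := Multiset.mem_join.1 hg
    obtain ⟨h, hh, rfl⟩ := Multiset.mem_map.1 hA
    rwa [Multiset.mem_singleton.1 (Multiset.mem_of_mem_nsmul hgA)]
  · rw [exponent_nsmul_eq]
    induction S using Multiset.induction with
    | empty => simp [orderPowers]
    | cons g S ih =>
      simp only [orderPowers, Multiset.map_cons, Multiset.sum_cons, Multiset.map_add,
        Multiset.sum_add, Multiset.map_nsmul, Multiset.map_singleton, Multiset.sum_nsmul,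
        Multiset.sum_singleton] at ih ⊢
      rw [ih]

variable [Fintype G] [DecidableEq G]

lemma sum_countVec (B : Multiset G) : ∑ g, countVec B g • g = B.sum := by
  rw [Finset.sum_multiset_count, ← Finset.sum_subset (Finset.subset_univ B.toFinset)]
  · simp [countVec]
  · intro g _ hg
    simp [countVec, Multiset.count_eq_zero.2 fun h => hg (Multiset.mem_toFinset.2 h)]

lemma countVec_mem_relations {S : Finset G} {B : Multiset G} :
    countVec B ∈ relations S ↔ (∀ g ∈ B, g ∈ S) ∧ B.sum = 0 := by
  rw [mem_relations, sum_countVec]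
  refine and_congr_left fun _ => forall_congr' fun g => ?_
  rw [not_imp_comm]
  simp [countVec]

lemma relations_le {T : Finset G} {M : AddSubgroup (G → ℤ)}
    (h : ∀ A, IsMinZeroSum A → (∀ g ∈ A, g ∈ T) → countVec A ∈ M) : relations T ≤ M := by
  have key : ∀ B : Multiset G, (∀ g ∈ B, g ∈ T) → B.sum = 0 → countVec B ∈ M := by
    intro B hBT hB
    obtain ⟨-, F, -, hF, rfl⟩ := exists_mem_factLengths hB
    exact countVec_mem_of_factorization fun A hA =>
      h A (hF A hA) (mem_of_mem_factorization hBT hA)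
  intro x hx
  let W : Multiset G := ∑ g, (x g).natAbs • Multiset.replicate (addOrderOf g) g
  have hcount : ∀ g, (W.count g : ℤ) = |x g| * addOrderOf g := by
    intro g
    simp [W, Multiset.count_sum', Multiset.count_replicate]
  have hW : countVec W ∈ relations T := by
    refine countVec_mem_relations.2 ⟨fun g hg => ?_, ?_⟩
    · by_contra hgT
      have := hcount g
      rw [hx.1 g hgT] at this
      simp only [abs_zero, zero_mul, Nat.cast_eq_zero, Multiset.count_eq_zero] at this
      exact this hg
    · rw [← Multiset.coe_sumAddMonoidHom, map_sum]
      refine Finset.sum_eq_zero fun g _ => ?_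
      rw [map_nsmul]
      simp [addOrderOf_nsmul_eq_zero]
  obtain ⟨B, hB⟩ := exists_countVec_eq (x := x + countVec W) fun g => by
    have h1 := neg_abs_le (x g)
    have h2 : (1 : ℤ) ≤ addOrderOf g := by exact_mod_cast addOrderOf_pos g
    have h3 := le_mul_of_one_le_right (abs_nonneg (x g)) h2
    simp only [Pi.add_apply, countVec, hcount]
    linarith
  have hBr : countVec B ∈ relations T := hB ▸ add_mem hx hW
  obtain ⟨h1, h2⟩ := countVec_mem_relations.1 hBr
  obtain ⟨h3, h4⟩ := countVec_mem_relations.1 hW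
  have := sub_mem (key B h1 h2) (key W h3 h4)
  rwa [hB, add_sub_cancel_right] at this

/-- The lattice generated by the atoms over `G₀` of cross number one. -/
def crossOneLattice (G₀ : Finset G) : AddSubgroup (G → ℤ) :=
  AddSubgroup.closure {x | ∃ A, IsMinZeroSum A ∧ (∀ g ∈ A, g ∈ G₀) ∧
    crossWeight A = AddMonoid.exponent G ∧ countVec A = x}

lemma exists_of_mem_crossOneLattice {G₀ : Finset G} {x : G → ℤ} (hx : x ∈ crossOneLattice G₀) :
    ∃ (W : Multiset G) (F : Multiset (Multiset G)), (∀ g ∈ W, g ∈ G₀) ∧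
      (∀ A ∈ F, IsMinZeroSum A ∧ (∀ g ∈ A, g ∈ G₀) ∧ crossWeight A = AddMonoid.exponent G) ∧
      x + countVec (orderPowers W).sum = countVec F.sum := by
  induction hx using AddSubgroup.closure_induction with
  | mem x hx =>
    obtain ⟨A, h1, h2, h3, rfl⟩ := hx
    exact ⟨0, {A}, by simp, by simpa using ⟨h1, h2, h3⟩, by simp [orderPowers, countVec_zero]⟩
  | zero => exact ⟨0, 0, by simp, by simp, by simp [orderPowers, countVec_zero]⟩
  | add x y _ _ hx hy =>
    obtain ⟨W, F, hW, hF, h⟩ := hx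
    obtain ⟨W', F', hW', hF', h'⟩ := hy
    refine ⟨W + W', F + F', fun g hg => ?_, fun A hA => ?_, ?_⟩
    · exact (Multiset.mem_add.1 hg).elim (hW g) (hW' g)
    · exact (Multiset.mem_add.1 hA).elim (hF A) (hF' A)
    · simp only [orderPowers, Multiset.map_add, Multiset.sum_add, countVec_add] at h h' ⊢
      rw [← h, ← h']
      abel
  | neg x _ hx =>
    obtain ⟨W, F, hW, hF, h⟩ := hx
    obtain ⟨W', hW', h'⟩ := exists_orderPowers_eq F.sum
    obtain ⟨m, hm⟩ := Nat.exists_eq_succ_of_ne_zero (exponent_pos (G := G)).ne'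
    refine ⟨W', orderPowers W + m • F, fun g hg => ?_, fun A hA => ?_, ?_⟩
    · obtain ⟨A, hA, hgA⟩ := Multiset.mem_join.1 (hW' g hg)
      exact (hF A hA).2.1 g hgA
    · rcases Multiset.mem_add.1 hA with hA | hA
      · refine ⟨?_, fun g hg => hW g (mem_of_mem_orderPowers hA hg), ?_⟩ <;>
          obtain ⟨g, -, rfl⟩ := Multiset.mem_map.1 hA
        exacts [isMinZeroSum_replicate g, crossWeight_replicate g]
      · exact hF A (Multiset.mem_of_mem_nsmul hA)
    · rw [h', hm, Nat.succ_eq_add_one, succ_nsmul, Multiset.sum_add, Multiset.sum_nsmul,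
          countVec_add, countVec_add,
        ← h]
      abel

omit [DecidableEq G] in
lemma exists_mem_factLengths_of_forall {G₀ : Finset G}
    (h : ∀ P : Multiset G, P.sum = 0 → (∀ g ∈ P, g ∈ G₀) → ∀ g ∈ G₀,
      ∀ t ∈ factLengths (P + Multiset.replicate (addOrderOf g) g), ∃ l ∈ factLengths P, t ≤ l + 1)
    {A : Multiset G} (hA : A.sum = 0) (hAG : ∀ g ∈ A, g ∈ G₀) {W : Multiset G}
    (hW : ∀ g ∈ W, g ∈ G₀) {t : ℕ} (ht : t ∈ factLengths (A + (orderPowers W).sum)) :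
    ∃ l ∈ factLengths A, t ≤ l + W.card := by
  induction W using Multiset.induction generalizing t with
  | empty => exact ⟨t, by simpa [orderPowers] using ht, by simp⟩
  | cons g W ih =>
    have hW' : ∀ g ∈ W, g ∈ G₀ := fun x hx => hW x (by simp [hx])
    have h0 : (orderPowers W).sum.sum = 0 := sum_eq_zero_of_factorization fun B hB => by
      obtain ⟨x, -, rfl⟩ := Multiset.mem_map.1 hB
      exact isMinZeroSum_replicate x
    have hmem : ∀ x ∈ A + (orderPowers W).sum, x ∈ G₀ := by
      intro x hx
      rcases Multiset.mem_add.1 hx with hx | hx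
      · exact hAG x hx
      · obtain ⟨B, hB, hxB⟩ := Multiset.mem_join.1 hx
        exact hW' x (mem_of_mem_orderPowers hB hxB)
    obtain ⟨l, hl, htl⟩ := h (A + (orderPowers W).sum) (by simp [hA, h0]) hmem
        g (hW g (by simp)) t (by
      have e : orderPowers (g ::ₘ W) = Multiset.replicate (addOrderOf g) g ::ₘ orderPowers W := by
        simp [orderPowers]
      rw [e, Multiset.sum_cons] at ht
      rwa [add_left_comm, add_comm (Multiset.replicate _ _)] at ht)
    obtain ⟨l', hl', h'⟩ := ih hW' hl
    exact ⟨l', hl', by rw [Multiset.card_cons]; omega⟩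

theorem LengthsCongr.add_one_le_grank_or {d : ℕ} {G₀ : Finset G} (hG : LengthsCongr d G₀)
    (hge : ∀ A, IsMinZeroSum A → (∀ g ∈ A, g ∈ G₀) → AddMonoid.exponent G ≤ crossWeight A)
    (hex : ∃ A, IsMinZeroSum A ∧ (∀ g ∈ A, g ∈ G₀) ∧ crossWeight A ≠ AddMonoid.exponent G) :
    d + 1 ≤ grank G ∨ 2 * d + 3 ≤ AddMonoid.exponent G := by
  induction G₀ using Finset.strongInduction with
  | H G₀ ih =>
  by_cases hproper : ∀ i ∈ G₀, ∀ A, IsMinZeroSum A → (∀ g ∈ A, g ∈ G₀.erase i) →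
      crossWeight A = AddMonoid.exponent G
  swap
  · push Not at hproper
    obtain ⟨i, hi, A, hA, hAG, hne⟩ := hproper
    exact ih (G₀.erase i) (Finset.erase_ssubset hi) (hG.mono (Finset.erase_subset i G₀))
      (fun A hA hAG => hge A hA fun g hg => Finset.erase_subset i G₀ (hAG g hg)) ⟨A, hA, hAG, hne⟩
  obtain ⟨A, hA, hAG, hne⟩ := hex
  have hlt := lt_of_le_of_ne (hge A hA hAG) hne.symm
  by_cases hcard : G₀.card ≤ grank G + 1
  · have := hG.add_two_le_card ⟨A, hA, hAG, hlt⟩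
    left
    omega
  right
  apply hG.two_mul_add_three_le hge hproper
  by_contra hno
  push Not at hno
  have hAM : countVec A ∈ crossOneLattice G₀ := by
    refine relations_le_of_erase (by omega) (fun i hi => relations_le fun C hC hCG => ?_)
      (countVec_mem_relations.2 ⟨hAG, hA.1⟩)
    exact AddSubgroup.subset_closure ⟨C, hC, fun g hg => Finset.erase_subset i G₀ (hCG g hg),
      hproper i hi C hC hCG, rfl⟩
  obtain ⟨W, F, hW, hF, h⟩ := exists_of_mem_crossOneLattice hAM
  rw [← countVec_add] at h
  replace h := countVec_injective h
  obtain ⟨l, hl, hle⟩ := exists_mem_factLengths_of_forall (t := F.card) (fun P hP hPG g hg t ht => by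
    obtain ⟨l, hl, hlt⟩ := hno P hP hPG g hg t ht
    exact ⟨l, hl, by omega⟩) hA.1 hAG hW ⟨F, rfl, fun C hC => (hF C hC).1, h.symm⟩
  rw [hA.eq_one_of_mem_factLengths hl] at hle
  have h1 := crossWeight_eq_card_mul fun C hC => (hF C hC).2.2
  have h2 : crossWeight (orderPowers W).sum = W.card * AddMonoid.exponent G := by
    rw [crossWeight_eq_card_mul (m := AddMonoid.exponent G), orderPowers, Multiset.card_map]
    intro C hC
    obtain ⟨g, -, rfl⟩ := Multiset.mem_map.1 hC
    exact crossWeight_replicate g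
  rw [← h, crossWeight_add, h2] at h1
  have := Nat.mul_le_mul_right (AddMonoid.exponent G) hle
  rw [← h1, add_mul, one_mul] at this
  omega

end CountVectors

section LongLengths

variable {G : Type*} [AddCommGroup G] [Fintype G] [DecidableEq G]

omit [DecidableEq G] in
lemma IsMinZeroSum.two_le_crossWeight {A : Multiset G} (hA : IsMinZeroSum A)
    (hlt : crossWeight A < AddMonoid.exponent G) : 2 ≤ crossWeight A := by
  refine le_trans ?_ (card_le_crossWeight A)
  have h0 : 0 < A.card := Multiset.card_pos.2 hA.2.1
  by_contra h
  obtain ⟨g, rfl⟩ := Multiset.card_eq_one.1 (show A.card = 1 by omega)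
  have hg : g = 0 := by simpa using hA.1
  simp [crossWeight, hg] at hlt

omit [DecidableEq G] in
lemma LengthsCongr.modEq_crossWeight {d : ℕ} {G₀ : Finset G} (hG : LengthsCongr d G₀)
    {A : Multiset G} (hA : IsMinZeroSum A) (hAG : ∀ g ∈ A, g ∈ G₀) :
    AddMonoid.exponent G ≡ crossWeight A [MOD d] :=
  hG (AddMonoid.exponent G • A) (by simp [Multiset.sum_nsmul, hA.1])
    (fun g hg => hAG g (Multiset.mem_of_mem_nsmul hg)) _ (hA.mem_factLengths_nsmul _) _
    (crossWeight_mem_factLengths A)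

lemma LengthsCongr.exists_lt_or {d : ℕ} {G₀ : Finset G} (hG : LengthsCongr d G₀)
    (hex : ∃ A, IsMinZeroSum A ∧ (∀ g ∈ A, g ∈ G₀) ∧ crossWeight A ≠ AddMonoid.exponent G) :
    (∃ A, IsMinZeroSum A ∧ (∀ g ∈ A, g ∈ G₀) ∧ crossWeight A < AddMonoid.exponent G) ∨
      d + 1 ≤ grank G ∨ 2 * d + 3 ≤ AddMonoid.exponent G := by
  by_cases h : ∃ A, IsMinZeroSum A ∧ (∀ g ∈ A, g ∈ G₀) ∧ crossWeight A < AddMonoid.exponent G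
  · exact Or.inl h
  · push Not at h
    exact Or.inr (hG.add_one_le_grank_or h hex)

omit [DecidableEq G] in
lemma LengthsCongr.add_two_le_exponent {d : ℕ} {G₀ : Finset G} (hG : LengthsCongr d G₀)
    (hex : ∃ A, IsMinZeroSum A ∧ (∀ g ∈ A, g ∈ G₀) ∧ crossWeight A < AddMonoid.exponent G) :
    d + 2 ≤ AddMonoid.exponent G := by
  obtain ⟨A, hA, hAG, hlt⟩ := hex
  have h2 := hA.two_le_crossWeight hlt
  have := Nat.le_of_dvd (by omega)
    ((Nat.modEq_iff_dvd' hlt.le).1 (hG.modEq_crossWeight hA hAG).symm)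
  omega

omit [AddCommGroup G] [Fintype G] [DecidableEq G] in
lemma card_le_countP_sum {p : G → Prop} [DecidablePred p] {F : Multiset (Multiset G)}
    (hF : ∀ A ∈ F, ∃ g ∈ A, p g) : F.card ≤ F.sum.countP p := by
  induction F using Multiset.induction with
  | empty => simp
  | cons A F ih =>
    rw [Multiset.card_cons, Multiset.sum_cons, Multiset.countP_add]
    have h1 := Multiset.countP_pos.2 (hF A (by simp))
    have h2 := ih fun B hB => hF B (by simp [hB])
    omega

lemma card_bounds_of_factorization {G₀ : Finset G} {M : ℕ} {F : Multiset (Multiset G)}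
    (hF : ∀ A ∈ F, IsMinZeroSum A)
    (hM : ∀ g ∉ G₀, F.sum.count g ≤ M)
    (hG₀ : ∀ A, IsMinZeroSum A → (∀ g ∈ A, g ∈ G₀) → crossWeight A = AddMonoid.exponent G) :
    F.card * AddMonoid.exponent G ≤
        crossWeight F.sum + Fintype.card G * M * AddMonoid.exponent G ∧
      crossWeight F.sum ≤ F.card * AddMonoid.exponent G +
        Fintype.card G * M * (Fintype.card G * AddMonoid.exponent G) := by
  classical
  let F₁ := F.filter fun A => ∀ g ∈ A, g ∈ G₀
  let F₂ := F.filter fun A => ¬ ∀ g ∈ A, g ∈ G₀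
  have hadd : F₁ + F₂ = F := Multiset.filter_add_not _ F
  have h1 : crossWeight F₁.sum = F₁.card * AddMonoid.exponent G :=
    crossWeight_eq_card_mul fun A hA =>
      hG₀ A (hF A (Multiset.mem_filter.1 hA).1) (Multiset.mem_filter.1 hA).2
  have h2 : crossWeight F₂.sum ≤ F₂.card * (Fintype.card G * AddMonoid.exponent G) :=
    crossWeight_le_card_mul fun A hA => (hF A (Multiset.mem_filter.1 hA).1).crossWeight_le
  have h3 : F₂.card ≤ Fintype.card G * M := by
    calc F₂.card ≤ F₂.sum.countP (· ∉ G₀) := card_le_countP_sum fun A hA => by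
            have := (Multiset.mem_filter.1 hA).2
            push Not at this
            exact this
      _ ≤ F.sum.countP (· ∉ G₀) := Multiset.countP_le_of_le _ (by
            rw [← hadd, Multiset.sum_add]
            exact Multiset.le_add_left _ _)
      _ = ∑ g, (F.sum.filter (· ∉ G₀)).count g := by
            rw [Multiset.sum_count_eq_card fun g _ => Finset.mem_univ g,
              Multiset.countP_eq_card_filter]
      _ ≤ ∑ g : G, M := Finset.sum_le_sum fun g _ => by
            rw [Multiset.count_filter]
            split_ifs with h
            exacts [Nat.zero_le M, hM g h]
      _ = Fintype.card G * M := by simp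
  have h4 : F.card = F₁.card + F₂.card := by rw [← hadd, Multiset.card_add]
  have h5 : crossWeight F.sum = crossWeight F₁.sum + crossWeight F₂.sum := by
    rw [← crossWeight_add, ← Multiset.sum_add, hadd]
  have h6 := Nat.mul_le_mul_right (AddMonoid.exponent G) h3
  have h7 := Nat.mul_le_mul_right (Fintype.card G * AddMonoid.exponent G) h3
  rw [h4, h5, h1, add_mul]
  constructor <;> omega

/-- A version of `HasLongLengths` on a fixed support, for sequences of bounded multiplicity. -/
lemma HasLongLengths.exists_finset {d : ℕ} (h : HasLongLengths G d) (M : ℕ) :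
    ∃ G₀ : Finset G, (∀ S : Multiset G, S.sum = 0 → (∀ g ∈ S, g ∈ G₀) → (∀ g, S.count g ≤ M) →
        ∀ a ∈ factLengths S, ∀ b ∈ factLengths S, a ≡ b [MOD d]) ∧
      ∃ A, IsMinZeroSum A ∧ (∀ g ∈ A, g ∈ G₀) ∧ crossWeight A ≠ AddMonoid.exponent G := by
  let c := Fintype.card G
  obtain ⟨_, ⟨B, hB, rfl⟩, hcongr, a, ha, b, hb, hab⟩ := h (c * M + c * M * c + 1)
  rw [lengthSet_univ] at hcongr ha hb
  refine ⟨Finset.univ.filter fun g => M ≤ B.count g, fun S hS hSG hSM x hx y hy => ?_, ?_⟩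
  · have hSB : S ≤ B := Multiset.le_iff_count.2 fun g => by
      by_cases hg : g ∈ S
      · exact (hSM g).trans (Finset.mem_filter.1 (hSG g hg)).2
      · simp [Multiset.count_eq_zero.2 hg]
    obtain ⟨T, rfl⟩ := Multiset.le_iff_exists_add.1 hSB
    obtain ⟨l, hl⟩ := exists_mem_factLengths (B := T) (by simpa [hS] using hB)
    exact Nat.ModEq.add_right_cancel' l
      (hcongr _ (add_mem_factLengths hx hl) _ (add_mem_factLengths hy hl))
  · by_contra hno
    push Not at hno
    obtain ⟨E, rfl, hE, rfl⟩ := ha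
    obtain ⟨F, rfl, hF, hFE⟩ := hb
    have hM : ∀ g ∉ Finset.univ.filter fun g => M ≤ E.sum.count g, E.sum.count g ≤ M := by
      intro g hg
      simp only [Finset.mem_filter, Finset.mem_univ, true_and] at hg
      omega
    have h1 := (card_bounds_of_factorization hE hM hno).2
    have h2 := (card_bounds_of_factorization hF (fun g hg => hFE.symm ▸ hM g hg) hno).1
    rw [hFE] at h2
    have h3 := Nat.mul_le_mul_right (AddMonoid.exponent G) hab
    have h4 : 0 < AddMonoid.exponent G := exponent_pos
    simp only [c] at h3
    nlinarith

lemma HasLongLengths.exists_lengthsCongr {d : ℕ} (h : HasLongLengths G d) :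
    ∃ G₀ : Finset G, LengthsCongr d G₀ ∧
      ∃ A, IsMinZeroSum A ∧ (∀ g ∈ A, g ∈ G₀) ∧ crossWeight A ≠ AddMonoid.exponent G := by
  by_contra hno
  push Not at hno
  have key : ∀ G₀ : Finset G, ∃ M : ℕ, (∀ S : Multiset G, S.sum = 0 → (∀ g ∈ S, g ∈ G₀) →
      (∀ g, S.count g ≤ M) → ∀ a ∈ factLengths S, ∀ b ∈ factLengths S, a ≡ b [MOD d]) →
      ∀ A, IsMinZeroSum A → (∀ g ∈ A, g ∈ G₀) → crossWeight A = AddMonoid.exponent G := by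
    intro G₀
    by_cases hG : LengthsCongr d G₀
    · exact ⟨0, fun _ => hno G₀ hG⟩
    · simp only [LengthsCongr] at hG
      push Not at hG
      obtain ⟨S, hS, hSG, a, ha, b, hb, hab⟩ := hG
      exact ⟨S.card, fun hcongr => absurd (hcongr S hS hSG
        (fun g => Multiset.count_le_card g S) a ha b hb) hab⟩
  choose m hm using key
  obtain ⟨G₀, h1, A, hA, hAG, hne⟩ := h.exists_finset (Finset.univ.sup m)
  exact hne (hm G₀ (fun S hS hSG hSM => h1 S hS hSG fun g =>
    (hSM g).trans (Finset.le_sup (Finset.mem_univ G₀))) A hA hAG)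

theorem HasLongLengths.le_or {d : ℕ} (h : HasLongLengths G d) :
    d + 2 ≤ AddMonoid.exponent G ∨ d + 1 ≤ grank G := by
  obtain ⟨G₀, hG, hex⟩ := h.exists_lengthsCongr
  rcases hG.exists_lt_or hex with h | h | h
  · exact Or.inl (hG.add_two_le_exponent h)
  · exact Or.inr h
  · left
    omega

end LongLengths

section Gap

variable {G : Type*} [AddCommGroup G]

/-- The only zero-sum sequences over `S` with multiplicities at most `d` are powers of `∏ S`. -/
def OnlyConstantRelations (S : Finset G) (d : ℕ) : Prop :=
  ∀ z : G → ℕ, (∀ g ∈ S, z g ≤ d) → ∑ g ∈ S, z g • g = 0 → ∃ k, ∀ g ∈ S, z g = k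

variable [Finite G] [DecidableEq G]

lemma OnlyConstantRelations.not_of_even {S : Finset G} {d : ℕ}
    (hS : OnlyConstantRelations S d) (hn : AddMonoid.exponent G = 2 * d) (hd : d ≠ 0)
    (hcard : grank G + 1 < S.card) : False := by
  obtain ⟨g₀, hg₀⟩ : S.Nonempty := Finset.card_pos.1 (by omega)
  let T := S.erase g₀
  let φ : T.powerset → (nsmulAddMonoidHom (α := G) 2).ker := fun U =>
    ⟨∑ g ∈ U.1, d • g, by
      rw [AddMonoidHom.mem_ker, nsmulAddMonoidHom_apply, ← Finset.smul_sum, ← mul_nsmul', ← hn]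
      exact AddMonoid.exponent_nsmul_eq_zero _⟩
  have hnot : ¬ Function.Injective φ := by
    intro hinj
    have h1 := (Nat.card_le_card_of_injective φ hinj).trans
      (card_ker_nsmul_le Nat.prime_two (AddMonoidHom.id G) Function.injective_id)
    rw [Nat.card_eq_fintype_card, Fintype.card_coe, Finset.card_powerset,
      Finset.card_erase_of_mem hg₀, Nat.pow_le_pow_iff_right one_lt_two] at h1
    omega
  simp only [Function.Injective] at hnot
  push Not at hnot
  obtain ⟨⟨U, hU⟩, ⟨V, hV⟩, hUV, hne⟩ := hnot
  replace hUV : ∑ g ∈ U, d • g = ∑ g ∈ V, d • g := congrArg Subtype.val hUV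
  have hUT := Finset.mem_powerset.1 hU
  have hVT := Finset.mem_powerset.1 hV
  have hTS : T ⊆ S := Finset.erase_subset g₀ S
  have hdd : ∀ g : G, d • g + d • g = 0 := fun g => by
    rw [← two_nsmul, ← mul_nsmul', ← hn, AddMonoid.exponent_nsmul_eq_zero]
  obtain ⟨k, hk⟩ := hS (fun g => if g ∈ U ↔ g ∈ V then 0 else d)
    (fun g _ => by split_ifs <;> simp) (by
    have h1 : ∀ g : G, (if g ∈ U ↔ g ∈ V then 0 else d) • g =
        (if g ∈ U then d • g else 0) + if g ∈ V then d • g else 0 := by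
      intro g
      by_cases h1 : g ∈ U <;> by_cases h2 : g ∈ V <;> simp [h1, h2, hdd]
    simp only [h1, Finset.sum_add_distrib, Finset.sum_ite_mem]
    rw [Finset.inter_eq_right.2 (hUT.trans hTS), Finset.inter_eq_right.2 (hVT.trans hTS), hUV,
      ← Finset.smul_sum, hdd])
  have hk0 := hk g₀ hg₀
  have h1 : g₀ ∉ U := fun h => Finset.notMem_erase g₀ S (hUT h)
  have h2 : g₀ ∉ V := fun h => Finset.notMem_erase g₀ S (hVT h)
  simp only [h1, h2, if_true] at hk0
  refine hne (Subtype.ext (Finset.ext fun g => ?_))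
  by_cases hg : g ∈ S
  · by_contra hcon
    have := hk g hg
    simp only at hcon
    rw [if_neg hcon] at this
    omega
  · exact iff_of_false (fun h => hg (hTS (hUT h))) fun h => hg (hTS (hVT h))

lemma OnlyConstantRelations.not_of_sqrt {S : Finset G} {d : ℕ}
    (hS : OnlyConstantRelations S d) (hsum : ∑ g ∈ S, g = 0)
    (hd : 2 * (AddMonoid.exponent G).sqrt ≤ d) (hr : grank G ≠ 0)
    (hcard : 2 * grank G + 1 ≤ S.card) : False := by
  obtain ⟨g₀, hg₀⟩ : S.Nonempty := Finset.card_pos.1 (by omega)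
  set X := (AddMonoid.exponent G).sqrt with hX
  let T := S.erase g₀
  let φ : (T → Fin (X + 1)) → G := fun x => ∑ g : T, (x g : ℕ) • g.1
  have hnot : ¬ Function.Injective φ := by
    intro hinj
    have h1 := (Nat.card_le_card_of_injective φ hinj).trans card_le_exponent_pow
    rw [Nat.card_eq_fintype_card, Fintype.card_fun, Fintype.card_fin, Fintype.card_coe,
      Finset.card_erase_of_mem hg₀] at h1
    have h2 : (X + 1) ^ (2 * grank G) ≤ (X + 1) ^ (S.card - 1) :=
      Nat.pow_le_pow_right (Nat.succ_pos X) (by omega)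
    rw [pow_mul] at h2
    have h3 : AddMonoid.exponent G < (X + 1) ^ 2 := by
      rw [sq]
      exact Nat.lt_succ_sqrt _
    exact absurd (Nat.pow_lt_pow_left h3 hr) (by omega)
  simp only [Function.Injective] at hnot
  push Not at hnot
  obtain ⟨x, y, hxy, hne⟩ := hnot
  let ext : (T → Fin (X + 1)) → G → ℕ := fun x g => if h : g ∈ T then x ⟨g, h⟩ else 0
  have ext_le : ∀ x g, ext x g ≤ X := fun x g => by
    simp only [ext]
    split_ifs
    exacts [Nat.lt_succ_iff.1 (x _).2, Nat.zero_le X]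
  have sum_ext : ∀ x, ∑ g ∈ S, ext x g • g = φ x := fun x => by
    rw [← Finset.sum_subset (Finset.erase_subset g₀ S) (fun g _ hg => by
      simp [ext, show g ∉ T from hg]), ← Finset.sum_coe_sort]
    exact Finset.sum_congr rfl fun g _ => by simp [ext, show g.1 ∈ T from g.2]
  have ext_g₀ : ∀ x, ext x g₀ = 0 := fun x => by simp [ext, T]
  obtain ⟨k, hk⟩ := hS (fun g => ext x g + X - ext y g)
    (fun g _ => by have := ext_le x g; omega) (by
    have h : ∑ g ∈ S, ((ext x g + X - ext y g) • g + ext y g • g) =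
        ∑ g ∈ S, (ext x g • g + X • g) := Finset.sum_congr rfl fun g _ => by
      rw [← add_nsmul, ← add_nsmul, Nat.sub_add_cancel ((ext_le y g).trans (Nat.le_add_left _ _))]
    rw [Finset.sum_add_distrib, Finset.sum_add_distrib, sum_ext, sum_ext, ← Finset.smul_sum, hsum,
      hxy, nsmul_zero, add_zero] at h
    simpa using h)
  have hk0 := hk g₀ hg₀
  simp only [ext_g₀] at hk0
  refine hne (funext fun g => Fin.ext ?_)
  have h1 := hk g.1 (Finset.mem_of_mem_erase g.2)
  have h2 := ext_le y g.1
  have h3 : ∀ x, ext x g.1 = x g := fun x => by simp [ext]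
  rw [h3] at h2
  simp only [h3] at h1
  omega

omit [Finite G] [DecidableEq G] in
lemma LengthsCongr.crossWeight_eq_of_le {d m : ℕ} {G₀ : Finset G}
    (hG : LengthsCongr d G₀)
    (hge : ∀ C, IsMinZeroSum C → (∀ g ∈ C, g ∈ G₀) → m ≤ crossWeight C)
    {A : Multiset G} (hA : IsMinZeroSum A) (hAG : ∀ g ∈ A, g ∈ G₀) (hAm : crossWeight A = m)
    {C : Multiset G} (hC : IsMinZeroSum C) (hCA : C ≤ d • A) : crossWeight C = m := by
  have hmem : ∀ g ∈ d • A, g ∈ G₀ := fun g hg => hAG g (Multiset.mem_of_mem_nsmul hg)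
  have hsum : (d • A).sum = 0 := by simp [Multiset.sum_nsmul, hA.1]
  obtain ⟨R, hR⟩ := Multiset.le_iff_exists_add.1 hCA
  have hRsum : R.sum = 0 := by simpa [hR, hC.1] using hsum
  obtain ⟨l, F, rfl, hF, rfl⟩ := exists_mem_factLengths hRsum
  have hcongr := hG _ hsum hmem _ (hA.mem_factLengths_nsmul d) (1 + F.card) (hR ▸
    add_mem_factLengths hC.one_mem_factLengths ⟨F, rfl, hF, rfl⟩)
  have hκ : crossWeight C + crossWeight F.sum = d * m := by
    rw [← crossWeight_add, ← hR, crossWeight_nsmul, hAm]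
  have hκF : F.card * m ≤ crossWeight F.sum := card_mul_le_crossWeight fun D hD =>
    hge D (hF D hD) fun g hg => hmem g (hR ▸ Multiset.mem_add.2
      (Or.inr (Multiset.mem_of_le (Multiset.le_sum_of_mem hD) hg)))
  have hκC := hge C hC fun g hg => hmem g (Multiset.mem_of_le hCA hg)
  have hdvd : d ∣ 1 + F.card := (Nat.modEq_zero_iff_dvd).1
    (hcongr.symm.trans (Nat.modEq_zero_iff_dvd.2 dvd_rfl))
  have hle := Nat.mul_le_mul_right m (Nat.le_of_dvd (by omega) hdvd)
  rw [add_mul, one_mul] at hle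
  omega

lemma LengthsCongr.count_eq_one {d m : ℕ} {G₀ : Finset G} (hG : LengthsCongr d G₀)
    (hmn : m < AddMonoid.exponent G) (hnd : AddMonoid.exponent G ≤ 2 * d)
    (hge : ∀ C, IsMinZeroSum C → (∀ g ∈ C, g ∈ G₀) → m ≤ crossWeight C)
    {A : Multiset G} (hA : IsMinZeroSum A) (hAG : ∀ g ∈ A, g ∈ G₀) (hAm : crossWeight A = m)
    {g : G} (hg : g ∈ A) : A.count g = 1 ∧ addOrderOf g = AddMonoid.exponent G := by
  have hlt : d * A.count g < addOrderOf g := by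
    by_contra hle
    have := hG.crossWeight_eq_of_le hge hA hAG hAm (isMinZeroSum_replicate g)
      (Multiset.le_count_iff_replicate_le.1 (by rw [Multiset.count_nsmul]; omega))
    rw [crossWeight_replicate] at this
    omega
  have hpos := Multiset.count_pos.2 hg
  obtain ⟨q, hq⟩ := AddMonoid.addOrder_dvd_exponent g
  have hn : 0 < AddMonoid.exponent G := exponent_pos
  have hd : d ≤ d * A.count g := Nat.le_mul_of_pos_right d hpos
  have hq1 : q = 1 := by
    rcases Nat.lt_trichotomy q 1 with h | h | h
    · have : q = 0 := by omega
      simp [this] at hq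
      omega
    · exact h
    · have := Nat.mul_le_mul_left (addOrderOf g) h
      omega
  rw [hq1, mul_one] at hq
  refine ⟨?_, hq.symm⟩
  by_contra hne
  have := Nat.mul_le_mul_left d (show 2 ≤ A.count g by omega)
  omega

lemma LengthsCongr.onlyConstantRelations {d m : ℕ} {G₀ : Finset G}
    (hG : LengthsCongr d G₀)
    (hmn : m < AddMonoid.exponent G) (hnd : AddMonoid.exponent G ≤ 2 * d)
    (hge : ∀ C, IsMinZeroSum C → (∀ g ∈ C, g ∈ G₀) → m ≤ crossWeight C)
    {A : Multiset G} (hA : IsMinZeroSum A) (hAG : ∀ g ∈ A, g ∈ G₀) (hAm : crossWeight A = m) :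
    OnlyConstantRelations A.toFinset d ∧ ∑ g ∈ A.toFinset, g = 0 ∧ A.toFinset.card = m := by
  have hcount : ∀ {C : Multiset G}, IsMinZeroSum C → (∀ g ∈ C, g ∈ G₀) → crossWeight C = m →
      ∀ g ∈ C, C.count g = 1 ∧ addOrderOf g = AddMonoid.exponent G :=
    fun hC hCG hCm g hg => hG.count_eq_one hmn hnd hge hC hCG hCm hg
  have hnodup : ∀ {C : Multiset G}, IsMinZeroSum C → (∀ g ∈ C, g ∈ G₀) → crossWeight C = m →
      C.Nodup := fun {C} hC hCG hCm => Multiset.nodup_iff_count_le_one.2 fun g => by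
    by_cases hg : g ∈ C
    · exact (hcount hC hCG hCm g hg).1.le
    · simp [Multiset.count_eq_zero.2 hg]
  have hAnd := hnodup hA hAG hAm
  refine ⟨fun z hz hsum => ?_, ?_, ?_⟩
  · let Z : Multiset G := ∑ g ∈ A.toFinset, Multiset.replicate (z g) g
    have hZcount : ∀ g ∈ A, Z.count g = z g := fun g hg => by
      simp only [Z, Multiset.count_sum', Multiset.count_replicate]
      rw [Finset.sum_ite_eq' A.toFinset g z, if_pos (Multiset.mem_toFinset.2 hg)]
    have hZmem : ∀ g ∈ Z, g ∈ A := fun g hg => by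
      obtain ⟨h, hh, hg⟩ := Multiset.mem_sum.1 hg
      rw [Multiset.eq_of_mem_replicate hg]
      exact Multiset.mem_toFinset.1 hh
    have hZA : Z ≤ d • A := Multiset.le_iff_count.2 fun g => by
      by_cases hg : g ∈ A
      · rw [hZcount g hg, Multiset.count_nsmul, (hcount hA hAG hAm g hg).1, mul_one]
        exact hz g (Multiset.mem_toFinset.2 hg)
      · rw [Multiset.count_eq_zero.2 fun h => hg (hZmem g h)]
        exact Nat.zero_le _
    have hZsum : Z.sum = 0 := by
      simp only [Z]
      rw [← Multiset.coe_sumAddMonoidHom, map_sum]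
      simpa using hsum
    obtain ⟨k, F, hFk, hF, hFZ⟩ := exists_mem_factLengths hZsum
    have hall : ∀ C ∈ F, C = A := fun C hC => by
      have hCZ : C ≤ Z := hFZ ▸ Multiset.le_sum_of_mem hC
      have hCA : ∀ g ∈ C, g ∈ A := fun g hg => hZmem g (Multiset.mem_of_le hCZ hg)
      have hCm := hG.crossWeight_eq_of_le hge hA hAG hAm (hF C hC) (hCZ.trans hZA)
      have hCle : C ≤ A :=
        (Multiset.le_iff_subset (hnodup (hF C hC) (fun g hg => hAG g (hCA g hg)) hCm)).2 hCA
      exact hA.2.2 C hCle (hF C hC).2.1 (hF C hC).1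
    refine ⟨k, fun g hg => ?_⟩
    have hgA := Multiset.mem_toFinset.1 hg
    rw [← hZcount g hgA, ← hFZ, Multiset.eq_replicate.2 ⟨hFk, hall⟩, Multiset.sum_replicate,
      Multiset.count_nsmul, (hcount hA hAG hAm g hgA).1, mul_one]
  · rw [Finset.sum, Multiset.toFinset_val, Multiset.dedup_eq_self.2 hAnd, Multiset.map_id']
    exact hA.1
  · rw [Multiset.toFinset_card_of_nodup hAnd, ← hAm, crossWeight,
      Multiset.map_congr rfl fun g hg => by
        rw [(hcount hA hAG hAm g hg).2, Nat.div_self exponent_pos]]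
    simp

end Gap

theorem not_hasLongLengths_half {G : Type*} [AddCommGroup G] [Fintype G] [DecidableEq G]
    (hr : 2 ≤ grank G) (hn : 4 * grank G + 2 ≤ AddMonoid.exponent G) :
    ¬ HasLongLengths G ((AddMonoid.exponent G + 1) / 2) := by
  intro h
  obtain ⟨G₀, hG, hex⟩ := h.exists_lengthsCongr
  set n := AddMonoid.exponent G with hn_def
  obtain ⟨A, hA, hAG, hAn⟩ : ∃ A, IsMinZeroSum A ∧ (∀ g ∈ A, g ∈ G₀) ∧ crossWeight A < n := by
    rcases hG.exists_lt_or hex with h | h | h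
    · exact h
    · omega
    · omega
  have hlt : ∀ C, IsMinZeroSum C → (∀ g ∈ C, g ∈ G₀) → crossWeight C < n →
      crossWeight C = n / 2 := by
    intro C hC hCG hCn
    have h2 := hC.two_le_crossWeight hCn
    obtain ⟨q, hq⟩ := (Nat.modEq_iff_dvd' hCn.le).1 (hG.modEq_crossWeight hC hCG).symm
    rcases Nat.lt_trichotomy q 1 with h | h | h
    · have : q = 0 := by omega
      simp [this] at hq
      omega
    · rw [h, mul_one] at hq
      omega
    · have := Nat.mul_le_mul_left ((n + 1) / 2) h
      omega
  obtain ⟨hconst, hsum, hcard⟩ := hG.onlyConstantRelations (m := n / 2) (by omega)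
    (by omega) (fun C hC hCG => by
      by_cases hCn : crossWeight C < n
      · exact (hlt C hC hCG hCn).ge
      · omega) hA hAG (hlt A hA hAG hAn)
  rcases Nat.even_or_odd' n with ⟨k, hk | hk⟩
  · exact hconst.not_of_even (by omega) (by omega) (by omega)
  · refine hconst.not_of_sqrt hsum ?_ (by omega) (by omega)
    rw [← hn_def]
    have h1 := Nat.sqrt_le n
    by_cases h4 : 4 ≤ n.sqrt
    · have := Nat.mul_le_mul_right n.sqrt h4
      omega
    · omega

section Constructions

variable {G : Type*} [AddCommGroup G]

lemma modEq_of_mem_factLengths {w : G → ℕ} {N d : ℕ} (hN : N ≠ 0) {B : Multiset G}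
    (h : ∀ A, IsMinZeroSum A → A ≤ B → (A.map w).sum ≡ N [MOD N * d]) {a b : ℕ}
    (ha : a ∈ factLengths B) (hb : b ∈ factLengths B) : a ≡ b [MOD d] := by
  have key : ∀ F : Multiset (Multiset G), (∀ A ∈ F, IsMinZeroSum A) → F.sum ≤ B →
      (F.sum.map w).sum ≡ N * F.card [MOD N * d] := by
    intro F hF hFB
    induction F using Multiset.induction with
    | empty => rfl
    | cons A F ih =>
      rw [Multiset.sum_cons] at hFB
      simp only [Multiset.sum_cons, Multiset.map_add, Multiset.sum_add, Multiset.card_cons]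
      rw [mul_add_one, add_comm]
      exact (ih (fun C hC => hF C (by simp [hC])) ((Multiset.le_add_left _ _).trans hFB)).add
        (h A (hF A (by simp)) ((Multiset.le_add_right _ _).trans hFB))
  obtain ⟨E, rfl, hE, hEB⟩ := ha
  obtain ⟨F, rfl, hF, hFB⟩ := hb
  have h1 := key E hE hEB.le
  have h2 := key F hF hFB.le
  rw [hEB] at h1
  rw [hFB] at h2
  exact (h1.symm.trans h2).mul_left_cancel' hN

lemma hasLongLengths_of_modEq {d : ℕ} (h : ∀ k : ℕ, ∃ B : Multiset G, B.sum = 0 ∧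
    (∀ a ∈ factLengths B, ∀ b ∈ factLengths B, a ≡ b [MOD d]) ∧
    ∃ a ∈ factLengths B, ∃ b ∈ factLengths B, a + k ≤ b) : HasLongLengths G d := by
  intro k
  obtain ⟨B, hB, h⟩ := h k
  exact ⟨factLengths B, ⟨B, hB, (lengthSet_univ B).symm⟩, h⟩

lemma isMinZeroSum_pair {g : G} (hg : g ≠ 0) : IsMinZeroSum ({g, -g} : Multiset G) := by
  refine ⟨by simp, by simp, fun B hB h0 hs => Multiset.eq_of_le_of_card_le hB ?_⟩
  by_contra hlt
  have hpos := Multiset.card_pos.2 h0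
  have h2 : Multiset.card ({g, -g} : Multiset G) = 2 := by simp
  obtain ⟨x, rfl⟩ := Multiset.card_eq_one.1 (show B.card = 1 by omega)
  have hx : x = 0 := by simpa using hs
  have := Multiset.mem_of_le hB (Multiset.mem_singleton_self x)
  simp [hx, hg.symm] at this
  exact hg this

lemma IsMinZeroSum.eq_replicate_of_forall_eq [Finite G] {A : Multiset G} (hA : IsMinZeroSum A)
    {g : G} (h : ∀ x ∈ A, x = g) : A = Multiset.replicate (addOrderOf g) g := by
  have hr := Multiset.eq_replicate_card.2 h
  refine hA.eq_replicate ?_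
  rw [hr]
  have h1 := hA.1
  rw [hr, Multiset.sum_replicate] at h1
  have h2 := Nat.le_of_dvd (Multiset.card_pos.2 hA.2.1) (addOrderOf_dvd_of_nsmul_eq_zero h1)
  exact (Multiset.replicate_le_replicate g).2 h2

lemma hasLongLengths_exponent_sub_two [Finite G] (hn : 3 ≤ AddMonoid.exponent G) :
    HasLongLengths G (AddMonoid.exponent G - 2) := by
  classical
  obtain ⟨g, hg⟩ := AddMonoid.exists_addOrderOf_eq_exponent
    (AddMonoid.ExponentExists.of_finite (G := G))
  set n := AddMonoid.exponent G
  have hg0 : g ≠ 0 := by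
    rintro rfl
    rw [addOrderOf_zero] at hg
    omega
  have hneg : -g ≠ g := by
    intro h
    have h2 : 2 • g = 0 := by rw [two_nsmul, ← neg_eq_iff_add_eq_zero, h]
    have := Nat.le_of_dvd two_pos (addOrderOf_dvd_of_nsmul_eq_zero h2)
    omega
  have hpair : n • ({g, -g} : Multiset G) =
      Multiset.replicate n g + Multiset.replicate n (-g) := by
    rw [show ({g, -g} : Multiset G) = {g} + {-g} from rfl, nsmul_add, Multiset.nsmul_singleton,
      Multiset.nsmul_singleton]
  refine hasLongLengths_of_modEq fun k => ⟨k • n • {g, -g}, by simp [Multiset.sum_nsmul],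
    fun a ha b hb => modEq_of_mem_factLengths (w := fun x => if x = g then 1 else n - 1)
      (N := n) (by omega) (fun A hA hAB => ?_) ha hb, k * 2, mul_mem_factLengths_nsmul ?_ k,
      k * n, mul_mem_factLengths_nsmul ((isMinZeroSum_pair hg0).mem_factLengths_nsmul n) k, ?_⟩
  · have hmem : ∀ x ∈ A, x = g ∨ x = -g := fun x hx => by
      simpa using Multiset.mem_of_mem_nsmul (Multiset.mem_of_mem_nsmul (Multiset.mem_of_le hAB hx))
    by_cases h1 : g ∈ A
    · by_cases h2 : -g ∈ A
      · have hle : ({g, -g} : Multiset G) ≤ A := by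
          refine (Multiset.le_iff_subset (by simpa using hneg.symm)).2 fun x hx => ?_
          rcases (show x = g ∨ x = -g by simpa using hx) with rfl | rfl
          exacts [h1, h2]
        rw [← hA.2.2 _ hle (isMinZeroSum_pair hg0).2.1 (isMinZeroSum_pair hg0).1]
        simp only [Multiset.insert_eq_cons, Multiset.map_cons, Multiset.map_singleton,
          Multiset.sum_cons, Multiset.sum_singleton, if_true, if_neg hneg]
        rw [Nat.add_sub_cancel' (by omega)]
      · rw [hA.eq_replicate_of_forall_eq (g := g) fun x hx => (hmem x hx).resolve_right fun h =>
          h2 (h ▸ hx), hg]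
        simp [Nat.ModEq.refl]
    · rw [hA.eq_replicate_of_forall_eq (g := -g) fun x hx => (hmem x hx).resolve_left fun h =>
          h1 (h ▸ hx), addOrderOf_neg, hg]
      simp only [Multiset.map_replicate, if_neg hneg, Multiset.sum_replicate, smul_eq_mul]
      rw [show n - 1 = 1 + (n - 2) by omega, mul_add, mul_one]
      exact Nat.add_modEq_right
  · rw [hpair]
    refine add_mem_factLengths (a := 1) (b := 1) ?_ ?_
    · exact hg ▸ (isMinZeroSum_replicate g).one_mem_factLengths
    · have := (isMinZeroSum_replicate (-g)).one_mem_factLengths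
      rwa [addOrderOf_neg, hg] at this
  · have := Nat.mul_le_mul_left k hn
    omega

lemma sum_mem_factLengths {ι : Type*} (s : Finset ι) {B : ι → Multiset G} {l : ι → ℕ}
    (h : ∀ i ∈ s, l i ∈ factLengths (B i)) : ∑ i ∈ s, l i ∈ factLengths (∑ i ∈ s, B i) := by
  classical
  induction s using Finset.induction_on with
  | empty => simpa using zero_mem_factLengths_zero
  | insert i s hi ih =>
    rw [Finset.sum_insert hi, Finset.sum_insert hi]
    exact add_mem_factLengths (h i (by simp)) (ih fun j hj => h j (by simp [hj]))

omit [AddCommGroup G] in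
lemma eq_sum_replicate_count {ι : Type*} [Fintype ι] [DecidableEq G] {E : ι → G}
    (hE : Function.Injective E) {A : Multiset G} (hA : ∀ x ∈ A, ∃ i, E i = x) :
    A = ∑ i, Multiset.replicate (A.count (E i)) (E i) := by
  classical
  ext x
  simp only [Multiset.count_sum', Multiset.count_replicate]
  by_cases hx : x ∈ A
  · obtain ⟨j, rfl⟩ := hA x hx
    simp [hE.eq_iff]
  · rw [Multiset.count_eq_zero.2 hx]
    refine (Finset.sum_eq_zero fun i _ => ?_).symm
    split_ifs with h
    exacts [Multiset.count_eq_zero.2 (h ▸ hx), rfl]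

section Independent

variable {p s : ℕ} (f : (Fin s → ZMod p) →+ G)

/-- The images of the standard basis vectors, and of their sum. -/
def basisAndSum : Option (Fin s) → G
  | none => f 1
  | some i => f (Pi.single i 1)

variable {f}

lemma sum_nsmul_basisAndSum (c : Option (Fin s) → ℕ) :
    ∑ o, c o • basisAndSum f o = f fun i => ((c (some i) + c none : ℕ) : ZMod p) := by
  simp only [Fintype.sum_option, basisAndSum, ← map_nsmul, ← map_sum, ← map_add]
  congr 1
  ext i
  simp [Finset.sum_apply, Pi.single_apply, add_comm]

lemma basisAndSum_injective (hp : p.Prime) (hs : 2 ≤ s) (hf : Function.Injective f) :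
    Function.Injective (basisAndSum f) := by
  have : Fact p.Prime := ⟨hp⟩
  have key : ∀ i : Fin s, (1 : Fin s → ZMod p) ≠ Pi.single i 1 := by
    intro i h
    have : Nontrivial (Fin s) := Fin.nontrivial_iff_two_le.2 hs
    obtain ⟨j, hj⟩ := exists_ne i
    simpa [hj] using congrFun h j
  rintro (_ | i) (_ | j) h
  · rfl
  · exact absurd (hf h) (key j)
  · exact absurd (hf h).symm (key i)
  · by_contra hij
    have hne : i ≠ j := fun h => hij (congrArg some h)
    simpa [hne] using congrFun (hf h) i

lemma addOrderOf_basisAndSum (hp : p.Prime) (hs : 2 ≤ s) (hf : Function.Injective f)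
    (o : Option (Fin s)) : addOrderOf (basisAndSum f o) = p := by
  have : Fact p.Prime := ⟨hp⟩
  have h0 : ∀ x, p • f x = 0 := fun x => by
    rw [← map_nsmul, show p • x = 0 by ext; simp, map_zero]
  have i : Fin s := ⟨0, by omega⟩
  have hne : ∀ x, x ≠ 0 → f x ≠ 0 := fun x hx h => hx (hf (h.trans (map_zero f).symm))
  cases o with
  | none =>
    refine addOrderOf_eq_prime (h0 _) (hne _ fun h => ?_)
    simpa using congrFun h i
  | some i =>
    refine addOrderOf_eq_prime (h0 _) (hne _ fun h => ?_)
    simpa using congrFun h i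

lemma IsMinZeroSum.eq_replicate_or_of_basisAndSum [Finite G] [DecidableEq G] (hp : p.Prime)
    (hs : 2 ≤ s) (hf : Function.Injective f) {A : Multiset G} (hA : IsMinZeroSum A)
    (hmem : ∀ x ∈ A, ∃ o, basisAndSum f o = x) :
    (∃ o, A = Multiset.replicate p (basisAndSum f o)) ∨
      A.count (basisAndSum f none) ≠ 0 ∧ ∀ i, A.count (basisAndSum f (some i)) +
        A.count (basisAndSum f none) = p := by
  by_cases h : ∃ o, p ≤ A.count (basisAndSum f o)
  · obtain ⟨o, ho⟩ := h
    have hord := addOrderOf_basisAndSum hp hs hf o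
    left
    refine ⟨o, ?_⟩
    have := hA.eq_replicate (g := basisAndSum f o) (by
      rw [hord]
      exact Multiset.le_count_iff_replicate_le.1 ho)
    rwa [hord] at this
  right
  push Not at h
  have hAeq := eq_sum_replicate_count (basisAndSum_injective hp hs hf) hmem
  have hsum : ∑ o, A.count (basisAndSum f o) • basisAndSum f o = 0 := by
    have := hA.1
    rw [hAeq, ← Multiset.coe_sumAddMonoidHom, map_sum] at this
    simpa using this
  rw [sum_nsmul_basisAndSum] at hsum
  have hdvd : ∀ i, p ∣ A.count (basisAndSum f (some i)) + A.count (basisAndSum f none) := by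
    intro i
    rw [← ZMod.natCast_eq_zero_iff]
    exact congrFun (hf (hsum.trans (map_zero f).symm)) i
  have hne : A.count (basisAndSum f none) ≠ 0 := by
    intro h0
    apply hA.2.1
    rw [hAeq]
    refine Finset.sum_eq_zero fun o _ => ?_
    cases o with
    | none => simp [h0]
    | some i =>
      have := hdvd i
      rw [h0, add_zero] at this
      rw [Nat.eq_zero_of_dvd_of_lt this (h (some i)), Multiset.replicate_zero]
  refine ⟨hne, fun i => ?_⟩
  obtain ⟨q, hq⟩ := hdvd i
  have h1 := h (some i)
  have h2 := h none
  have hq1 : q = 1 := by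
    rcases Nat.lt_trichotomy q 1 with h | h | h
    · rw [show q = 0 by omega, mul_zero] at hq
      omega
    · exact h
    · have := Nat.mul_le_mul_left p h
      omega
  rw [hq, hq1, mul_one]

lemma hasLongLengths_of_injective [Finite G] (hp : p.Prime) (hs : 2 ≤ s)
    (hf : Function.Injective f) : HasLongLengths G (s - 1) := by
  classical
  have hp2 := hp.two_le
  have hinj := basisAndSum_injective hp hs hf
  let E := basisAndSum f
  let c : Option (Fin s) → ℕ := fun o => o.elim 1 fun _ => p - 1
  let V : Multiset G := ∑ o, Multiset.replicate (c o) (E o)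
  have hVmem : ∀ x ∈ V, ∃ o, E o = x := fun x hx => by
    obtain ⟨o, -, ho⟩ := Multiset.mem_sum.1 hx
    exact ⟨o, (Multiset.eq_of_mem_replicate ho).symm⟩
  have hVcount : ∀ o, V.count (E o) = c o := fun o => by
    cases o <;> simp [V, Multiset.count_sum', Multiset.count_replicate, E, hinj.eq_iff]
  have hVsum : V.sum = 0 := by
    simp only [V]
    rw [← Multiset.coe_sumAddMonoidHom, map_sum]
    simp only [Multiset.coe_sumAddMonoidHom, Multiset.sum_replicate, E]
    rw [sum_nsmul_basisAndSum, ← map_zero f]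
    congr 1
    ext i
    simp [c, Nat.sub_add_cancel hp.one_le]
  have hV0 : V ≠ 0 := fun h => by
    have := hVcount none
    simp [h, c] at this
  have hV : IsMinZeroSum V := by
    obtain ⟨A, hAV, hA⟩ := exists_isMinZeroSum_le hVsum hV0
    have hmem : ∀ x ∈ A, ∃ o, E o = x := fun x hx => hVmem x (Multiset.mem_of_le hAV hx)
    have hle : ∀ o, A.count (E o) ≤ c o := fun o => hVcount o ▸ Multiset.count_le_of_le _ hAV
    rcases hA.eq_replicate_or_of_basisAndSum hp hs hf hmem with ⟨o, ho⟩ | ⟨h0, h1⟩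
    · have := hle o
      rw [ho, Multiset.count_replicate_self] at this
      cases o with
      | none => simp only [c, Option.elim_none] at this; omega
      | some i => simp only [c, Option.elim_some] at this; omega
    · have hn : A.count (E none) = 1 := le_antisymm (hle none) (Nat.one_le_iff_ne_zero.2 h0)
      have : A = V := by
        rw [eq_sum_replicate_count hinj hmem]
        refine Finset.sum_congr rfl fun o _ => ?_
        cases o with
        | none => exact congrArg (Multiset.replicate · (E none)) hn
        | some i =>
          refine congrArg (Multiset.replicate · (E (some i))) ?_
          have := h1 i
          simp only [c, Option.elim_some]
          simp only [E] at hn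
          omega
      exact this ▸ hA
  have hpow : 1 + s * (p - 1) ∈ factLengths (p • V) := by
    have h1 : p • V = ∑ o, c o • Multiset.replicate (addOrderOf (E o)) (E o) := by
      simp only [V, Finset.smul_sum, Multiset.nsmul_replicate, E,
        addOrderOf_basisAndSum hp hs hf, mul_comm]
    have h2 : 1 + s * (p - 1) = ∑ o, c o := by simp [c]
    rw [h1, h2]
    exact sum_mem_factLengths _ fun o _ => (isMinZeroSum_replicate (E o)).mem_factLengths_nsmul _
  have hmod : p * s ≡ p [MOD p * (s - 1)] := by
    rw [show s = 1 + (s - 1) by omega, mul_add, mul_one, Nat.add_sub_cancel_left]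
    exact Nat.add_modEq_right
  refine hasLongLengths_of_modEq fun k => ⟨k • p • V, by simp [Multiset.sum_nsmul, hVsum],
    fun a ha b hb => modEq_of_mem_factLengths (w := fun x => if x = E none then s else 1)
      (N := p) hp.ne_zero (fun A hA hAB => ?_) ha hb, k * p,
      mul_mem_factLengths_nsmul (hV.mem_factLengths_nsmul p) k,
      k * (1 + s * (p - 1)), mul_mem_factLengths_nsmul hpow k, ?_⟩
  · have hmem : ∀ x ∈ A, ∃ o, E o = x := fun x hx => hVmem x
      (Multiset.mem_of_mem_nsmul (Multiset.mem_of_mem_nsmul (Multiset.mem_of_le hAB hx)))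
    have hsome : ∀ i, E (some i) ≠ E none := fun i h => by simpa using hinj h
    rcases hA.eq_replicate_or_of_basisAndSum hp hs hf hmem with ⟨o, ho⟩ | ⟨-, h1⟩
    · rw [ho]
      cases o with
      | none => simpa [E] using hmod
      | some i => simpa [if_neg (hsome i), E] using Nat.ModEq.refl p
    · have hsum : (A.map fun x => if x = E none then s else 1).sum = p * s := by
        rw [eq_sum_replicate_count hinj hmem, ← Multiset.coe_mapAddMonoidHom, map_sum,
          ← Multiset.coe_sumAddMonoidHom, map_sum, Fintype.sum_option]
        simp only [Multiset.coe_mapAddMonoidHom, Multiset.coe_sumAddMonoidHom,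
          Multiset.map_replicate, Multiset.sum_replicate, smul_eq_mul]
        have h2 : ∀ i, A.count (E (some i)) * (if E (some i) = E none then s else 1) +
            A.count (E none) = p := fun i => by
          rw [if_neg (hsome i), mul_one]
          exact h1 i
        have h3 := Finset.sum_congr rfl fun i (_ : i ∈ Finset.univ) => h2 i
        rw [Finset.sum_add_distrib] at h3
        simp only [Finset.sum_const, Finset.card_univ, Fintype.card_fin, smul_eq_mul] at h3
        simp only [E, if_true] at h3 ⊢
        linarith
      rw [hsum]
      exact hmod
  · obtain ⟨q, rfl⟩ := Nat.exists_eq_add_of_le hp2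
    obtain ⟨t, rfl⟩ := Nat.exists_eq_add_of_le hs
    rw [show 2 + q - 1 = q + 1 by omega, ← mul_add_one]
    refine Nat.mul_le_mul_left k ?_
    nlinarith [Nat.zero_le (t * q)]

end Independent

lemma hasLongLengths_of_le_grank [Finite G] {s : ℕ} (hs : 2 ≤ s) (hsr : s ≤ grank G) :
    HasLongLengths G (s - 1) := by
  obtain ⟨p, hp, f, hf⟩ := exists_injective_of_grank (G := G)
  have : Nonempty (Fin s) := ⟨⟨0, by omega⟩⟩
  have hg : Function.Surjective (Function.invFun (Fin.castLE hsr)) :=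
    Function.invFun_surjective (Fin.castLE_injective hsr)
  exact hasLongLengths_of_injective (f := f.comp
    (LinearMap.funLeft (ZMod p) (ZMod p) (Function.invFun (Fin.castLE hsr))).toAddMonoidHom) hp hs
    (hf.comp (LinearMap.funLeft_injective_of_surjective (ZMod p) (ZMod p) _ hg))

end Constructions

theorem stmt_17 {G G' : Type*} [AddCommGroup G] [Fintype G] [AddCommGroup G'] [Fintype G']
    (hL : SystemSets G = SystemSets G') (n r : ℕ)
    (hn : AddMonoid.exponent G = n) (hr : grank G = r)
    (hr2 : 2 ≤ r) (hrn : (r : ℚ) ≤ ((n : ℚ) - 2) / 4) :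
    AddMonoid.exponent G' = n ∧ grank G' + 1 < n := by
  classical
  have hrn' : 4 * r + 2 ≤ n := by
    have : 4 * (r : ℚ) + 2 ≤ n := by linarith
    exact_mod_cast this
  have hiff : ∀ d, HasLongLengths G d ↔ HasLongLengths G' d := fun d => by
    rw [HasLongLengths, HasLongLengths, hL]
  have hgap : ¬ HasLongLengths G ((n + 1) / 2) :=
    hn ▸ not_hasLongLengths_half (by omega) (by omega)
  have hrank : grank G' ≤ (n + 1) / 2 := by
    by_contra hlt
    exact hgap ((hiff _).2 (hasLongLengths_of_le_grank (G := G') (s := (n + 1) / 2 + 1)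
      (by omega) (by omega)))
  have hle : n ≤ AddMonoid.exponent G' := by
    have := ((hiff _).1 (hasLongLengths_exponent_sub_two (G := G) (by omega))).le_or
    omega
  have hge : AddMonoid.exponent G' ≤ n := by
    have := ((hiff _).2 (hasLongLengths_exponent_sub_two (G := G') (by omega))).le_or
    omega
  exact ⟨le_antisymm hge hle, by omega⟩
end
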